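/- Let (A_i)_{i∈I} be a family of unital C*-algebras, H a separable infinite-dimensional Hilbert space, and K(H) the compact operators. Then the homomorphism Θ : K_*(∏_{i∈I}(A_i ⊗ K(H))) → ∏_{i∈I} K_*(A_i ⊗ K(H)) induced on the i-th factor by the canonical projection ∏_{j∈I}(A_j ⊗ K(H)) → A_i ⊗ K(H) is an isomorphism of abelian groups, for * = 0 and * = 1. -/

import Mathlib

noncomputable section
open scoped ENNReal

/-! ## Stabilization

`B` is a stabilization `A ⊗ K(H)` (`H` a separable infinite-dimensional
Hilbert space), presented concretely: `A ⊗ K(H)` is the closure of the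
increasing union of the matrix algebras `M_n(A)`. -/

/-- The corner embedding `M_n(R) → M_{n+1}(R)`. -/
def cornerEmb {R : Type*} [Zero R] (n : ℕ) (M : Matrix (Fin n) (Fin n) R) :
    Matrix (Fin (n + 1)) (Fin (n + 1)) R :=
  fun i j =>
    if h : (i : ℕ) < n then
      (if h' : (j : ℕ) < n then M ⟨i, h⟩ ⟨j, h'⟩ else 0)
    else 0

/-- `B` is (a copy of) the stabilization `A ⊗ K(H)` of `A` for a separable
infinite-dimensional Hilbert space `H`: `B` is the closure of an increasing
union of copies of the matrix algebras `M_n(A)`. -/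
structure IsStabilization (A B : Type*) [CStarAlgebra A]
    [NonUnitalCStarAlgebra B] : Type _ where
  φ : ∀ n : ℕ, Matrix (Fin n) (Fin n) A →⋆ₙₐ[ℂ] B
  inj : ∀ n, Function.Injective (φ n)
  compat : ∀ (n) (M : Matrix (Fin n) (Fin n) A), φ (n + 1) (cornerEmb n M) = φ n M
  dense : Dense (⋃ n, Set.range (φ n))

/-! ## Operator K-theory, concretely -/

/-- A projection in a matrix algebra. -/
def IsProjM {R : Type*} [Ring R] [StarRing R] {m : ℕ}
    (p : Matrix (Fin m) (Fin m) R) : Prop :=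
  IsSelfAdjoint p ∧ IsIdempotentElem p

/-- The embedding of `M_m(R)` into `M_M(R)` as the diagonal block with
offset `o` (zero elsewhere). -/
def emb {R : Type*} [Zero R] {m M : ℕ} (o : ℕ)
    (p : Matrix (Fin m) (Fin m) R) : Matrix (Fin M) (Fin M) R :=
  fun i j =>
    if h : o ≤ (i : ℕ) ∧ (i : ℕ) < o + m ∧ o ≤ (j : ℕ) ∧ (j : ℕ) < o + m then
      p ⟨(i : ℕ) - o, by omega⟩ ⟨(j : ℕ) - o, by omega⟩
    else 0

/-- A cycle for `K₀(B)`: a formal difference `[p] − [q]` of projections in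
matrices over the unitization `B⁺`, with `p − q` having entries in `B`. -/
structure K0Rep (B : Type*) [NonUnitalCStarAlgebra B] where
  m : ℕ
  p : Matrix (Fin m) (Fin m) (Unitization ℂ B)
  q : Matrix (Fin m) (Fin m) (Unitization ℂ B)

/-- The conditions making a `K0Rep` a genuine `K₀`-cycle. -/
def K0Good {B : Type*} [NonUnitalCStarAlgebra B] (x : K0Rep B) : Prop :=
  IsProjM x.p ∧ IsProjM x.q ∧ ∀ i j, (x.p i j).fst = (x.q i j).fst

/-- Equivalence of `K₀`-cycles: `[p]−[q] = [p']−[q']` iff `p ⊕ q' ⊕ r` and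
`p' ⊕ q ⊕ r` are homotopic through projections in some large matrix algebra. -/
def K0Rel (B : Type*) [NonUnitalCStarAlgebra B]
    (x y : {z : K0Rep B // K0Good z}) : Prop :=
  ∃ (s M : ℕ), x.1.m + y.1.m + s ≤ M ∧
    ∃ rr : Matrix (Fin s) (Fin s) (Unitization ℂ B), IsProjM rr ∧
      ∃ path : ℝ → Matrix (Fin M) (Fin M) (Unitization ℂ B),
        Continuous path ∧ (∀ t ∈ Set.Icc (0:ℝ) 1, IsProjM (path t)) ∧
        path 0 = emb 0 x.1.p + emb x.1.m y.1.q + emb (x.1.m + y.1.m) rr ∧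
        path 1 = emb 0 y.1.p + emb y.1.m x.1.q + emb (y.1.m + x.1.m) rr

/-- The `K₀`-group (as a set: homotopy classes of formal differences). -/
def K0 (B : Type*) [NonUnitalCStarAlgebra B] : Type _ :=
  Quot (K0Rel B)

/-- Block sum of `K₀`-cycles (the addition of `K₀`). -/
def K0RepAdd {B : Type*} [NonUnitalCStarAlgebra B] (x y : K0Rep B) : K0Rep B :=
  ⟨x.m + y.m, emb 0 x.p + emb x.m y.p, emb 0 x.q + emb x.m y.q⟩

/-- Entrywise image of a `K₀`-cycle under a morphism of C*-algebras. -/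
def K0RepMap {B C : Type*} [NonUnitalCStarAlgebra B] [NonUnitalCStarAlgebra C]
    (ψ : B →⋆ₙₐ[ℂ] C) (x : K0Rep B) : K0Rep C :=
  ⟨x.m, x.p.map (Unitization.starMap ψ), x.q.map (Unitization.starMap ψ)⟩

/-- A cycle for `K₁(B)`: a unitary in matrices over `B⁺` with scalar part the
identity. -/
structure K1Rep (B : Type*) [NonUnitalCStarAlgebra B] where
  m : ℕ
  u : Matrix (Fin m) (Fin m) (Unitization ℂ B)

/-- The conditions making a `K1Rep` a genuine `K₁`-cycle. -/
def K1Good {B : Type*} [NonUnitalCStarAlgebra B] (x : K1Rep B) : Prop :=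
  x.u ∈ unitary (Matrix (Fin x.m) (Fin x.m) (Unitization ℂ B)) ∧
    ∀ i j, (x.u i j).fst = ((1 : Matrix (Fin x.m) (Fin x.m) (Unitization ℂ B)) i j).fst

/-- The embedding `M_m(R) → M_M(R)`, `u ↦ diag(u, 1)`. -/
def embU {R : Type*} [Ring R] {m M : ℕ}
    (u : Matrix (Fin m) (Fin m) R) : Matrix (Fin M) (Fin M) R :=
  fun i j =>
    if h : (i : ℕ) < m then
      (if h' : (j : ℕ) < m then u ⟨i, h⟩ ⟨j, h'⟩ else 0)
    else if (i : ℕ) = (j : ℕ) then 1 else 0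

/-- Equivalence of `K₁`-cycles: homotopy through unitaries (with scalar part
the identity) after stabilization. -/
def K1Rel (B : Type*) [NonUnitalCStarAlgebra B]
    (x y : {z : K1Rep B // K1Good z}) : Prop :=
  ∃ M : ℕ, x.1.m ≤ M ∧ y.1.m ≤ M ∧
    ∃ path : ℝ → Matrix (Fin M) (Fin M) (Unitization ℂ B),
      Continuous path ∧
      (∀ t ∈ Set.Icc (0:ℝ) 1,
        path t ∈ unitary (Matrix (Fin M) (Fin M) (Unitization ℂ B)) ∧
        ∀ i j, ((path t) i j).fst =
          ((1 : Matrix (Fin M) (Fin M) (Unitization ℂ B)) i j).fst) ∧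
      path 0 = embU x.1.u ∧ path 1 = embU y.1.u

/-- The `K₁`-group (as a set: homotopy classes of stabilized unitaries). -/
def K1 (B : Type*) [NonUnitalCStarAlgebra B] : Type _ :=
  Quot (K1Rel B)

/-- Block sum of `K₁`-cycles (the addition of `K₁`). -/
def K1RepAdd {B : Type*} [NonUnitalCStarAlgebra B] (x y : K1Rep B) : K1Rep B :=
  ⟨x.m + y.m, emb 0 x.u + emb x.m y.u⟩

/-- Entrywise image of a `K₁`-cycle under a morphism of C*-algebras. -/
def K1RepMap {B C : Type*} [NonUnitalCStarAlgebra B] [NonUnitalCStarAlgebra C]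
    (ψ : B →⋆ₙₐ[ℂ] C) (x : K1Rep B) : K1Rep C :=
  ⟨x.m, x.u.map (Unitization.starMap ψ)⟩

/-- The coordinate projection `∏_i B_i → B_j` on the C*-product (bounded
families), as a morphism of C*-algebras. -/
def lpProj {I : Type*} (B : I → Type*) [∀ i, NonUnitalCStarAlgebra (B i)]
    (j : I) : lp B ∞ →⋆ₙₐ[ℂ] B j where
  toFun f := f j
  map_smul' _ _ := rfl
  map_zero' := rfl
  map_add' _ _ := rfl
  map_mul' _ _ := rfl
  map_star' _ := rfl

set_option linter.unusedSectionVars false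

section CStarLemmas

variable {A : Type*} [CStarAlgebra A]

lemma norm_le_one_of_star_mul_self_isStarProjection {w p : A} (hp : IsStarProjection p)
    (h : star w * w = p) : ‖w‖ ≤ 1 := by
  have h1 := hp.norm_le
  rw [← h, CStarRing.norm_star_mul_self] at h1
  nlinarith [norm_nonneg w]

lemma norm_le_one_of_mem_unitary {u : A} (hu : u ∈ unitary A) : ‖u‖ ≤ 1 :=
  norm_le_one_of_star_mul_self_isStarProjection (IsStarProjection.one A)
    (Unitary.star_mul_self_of_mem hu)

lemma exists_invSqrt {a : A} (ha : IsSelfAdjoint a) {δ : ℝ} (h : ‖a - 1‖ ≤ δ) (hδ : δ < 1) :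
    ∃ b : A, IsSelfAdjoint b ∧ b * b * a = 1 ∧ ‖b - 1‖ ≤ δ / (1 - δ) ∧
      ∀ x, Commute a x → Commute b x := by
  have hδ0 : 0 ≤ δ := (norm_nonneg _).trans h
  have hsp : ∀ x ∈ spectrum ℝ a, |x - 1| ≤ δ := by
    have h1 : cfc (fun x : ℝ => x - 1) a = a - 1 := by
      rw [cfc_sub (fun x : ℝ => x) (fun _ => (1 : ℝ)) a, cfc_id' ℝ a, cfc_const_one ℝ a]
    rw [← h1, norm_cfc_le_iff _ _ hδ0] at h
    exact h
  have hpos : ∀ x ∈ spectrum ℝ a, 0 < x := fun x hx => by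
    have := abs_le.1 (hsp x hx)
    linarith
  have hc : ContinuousOn (fun x : ℝ => (√x)⁻¹) (spectrum ℝ a) :=
    ContinuousOn.inv₀ Real.continuous_sqrt.continuousOn
      fun x hx => (Real.sqrt_pos.2 (hpos x hx)).ne'
  refine ⟨cfc (fun x : ℝ => (√x)⁻¹) a, IsSelfAdjoint.cfc, ?_, ?_, fun x hx => hx.cfc_real _⟩
  · nth_rw 3 [← cfc_id' ℝ a]
    rw [← cfc_mul _ _ a hc hc, ← cfc_mul (fun x : ℝ => (√x)⁻¹ * (√x)⁻¹) (fun x => x) a (hc.mul hc),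
      ← cfc_one ℝ a]
    refine cfc_congr fun x hx => ?_
    have := Real.sqrt_pos.2 (hpos x hx)
    have h2 := Real.mul_self_sqrt (hpos x hx).le
    simp only [Pi.one_apply]
    field_simp
    nlinarith
  · have h1 : cfc (fun x : ℝ => (√x)⁻¹ - 1) a = cfc (fun x : ℝ => (√x)⁻¹) a - 1 := by
      rw [cfc_sub (fun x : ℝ => (√x)⁻¹) (fun _ => (1 : ℝ)) a hc, cfc_const_one ℝ a]
    rw [← h1]
    refine norm_cfc_le (div_nonneg hδ0 (by linarith)) fun x hx => ?_
    have hx0 := hpos x hx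
    have hs := Real.sqrt_pos.2 hx0
    have h2 := Real.mul_self_sqrt hx0.le
    have h3 := abs_le.1 (hsp x hx)
    have h4 : 1 - δ ≤ √x := by
      by_contra! hlt
      nlinarith
    have h5 : (√x)⁻¹ - 1 = (1 - x) / (√x * (1 + √x)) := by
      field_simp
      nlinarith
    rw [h5, Real.norm_eq_abs, abs_div, abs_of_pos (by positivity : 0 < √x * (1 + √x))]
    refine div_le_div₀ hδ0 ?_ (by linarith) (by nlinarith)
    rw [abs_sub_comm]
    exact hsp x hx

lemma exists_isStarProjection_near {a : A} (ha : IsSelfAdjoint a) {δ : ℝ}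
    (h : ‖a * a - a‖ ≤ δ) (hδ : δ < 1 / 4) :
    ∃ p : A, IsStarProjection p ∧ ‖p - a‖ ≤ 2 * δ ∧ ∀ x, Commute a x → Commute p x := by
  have hδ0 : 0 ≤ δ := (norm_nonneg _).trans h
  have hsp : ∀ x ∈ spectrum ℝ a, |x * x - x| ≤ δ := by
    have h1 : cfc (fun x : ℝ => x * x - x) a = a * a - a := by
      rw [cfc_sub (fun x : ℝ => x * x) (fun x => x) a, cfc_mul (fun x : ℝ => x) (fun x => x) a,
        cfc_id' ℝ a]
    rw [← h1, norm_cfc_le_iff _ _ hδ0] at h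
    exact h
  set f : ℝ → ℝ := fun x => if 1 / 2 < x then 1 else 0 with hf
  have hne : ∀ x ∈ spectrum ℝ a, x ≠ 1 / 2 := by
    rintro x hx rfl
    have := hsp _ hx
    norm_num [abs_le] at this
    linarith
  have hc : ContinuousOn f (spectrum ℝ a) := by
    intro x hx
    refine ContinuousAt.continuousWithinAt ?_
    rcases lt_or_gt_of_ne (hne x hx) with h1 | h1
    · refine (continuousAt_const (y := (0 : ℝ))).congr ?_
      filter_upwards [Iio_mem_nhds h1] with y hy
      simp only [hf]
      rw [if_neg (not_lt.2 (le_of_lt hy))]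
    · refine (continuousAt_const (y := (1 : ℝ))).congr ?_
      filter_upwards [Ioi_mem_nhds h1] with y hy
      simp only [hf]
      rw [if_pos (Set.mem_Ioi.1 hy)]
  refine ⟨cfc f a, ⟨?_, IsSelfAdjoint.cfc⟩, ?_, fun x hx => hx.cfc_real _⟩
  · rw [IsIdempotentElem, ← cfc_mul _ _ a hc hc]
    refine cfc_congr fun x _ => ?_
    simp [hf]
  · have h1 : cfc (fun x : ℝ => f x - x) a = cfc f a - a := by
      rw [cfc_sub _ _ a hc (by fun_prop), cfc_id' ℝ a]
    rw [← h1]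
    refine norm_cfc_le (by positivity) fun x hx => ?_
    have h2 := hsp x hx
    have h3 : x * x - x = x * (x - 1) := by ring
    rw [h3, abs_mul] at h2
    simp only [hf, Real.norm_eq_abs]
    split_ifs with hx2
    · rw [abs_sub_comm]
      have : 1 / 2 ≤ |x| := le_trans hx2.le (le_abs_self x)
      nlinarith [abs_nonneg (x - 1)]
    · rw [zero_sub, abs_neg]
      have : 1 / 2 ≤ |x - 1| := by
        rw [abs_sub_comm]; exact le_trans (by linarith) (le_abs_self _)
      nlinarith [abs_nonneg x]

/-- An approximate Murray–von Neumann equivalence can be corrected to an exact one. -/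
lemma exists_partialIsometry {p q T : A} (hp : IsStarProjection p) (hq : IsStarProjection q)
    (hTp : T * p = T) (hqT : q * T = T) (h1 : ‖star T * T - p‖ < 1)
    (h2 : ‖T * star T - q‖ < 1) : ∃ w : A, star w * w = p ∧ w * star w = q := by
  have hpT : p * star T = star T := by
    rw [← hp.isSelfAdjoint.star_eq, ← star_mul, hTp]
  have hTq : star T * q = star T := by
    rw [← hq.isSelfAdjoint.star_eq, ← star_mul, hqT]
  have hpp := hp.isIdempotentElem.eq
  have hqq := hq.isIdempotentElem.eq
  have hps := hp.isSelfAdjoint.star_eq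
  have hqs := hq.isSelfAdjoint.star_eq
  set a := star T * T + (1 - p) with ha
  have has : IsSelfAdjoint a := by
    rw [ha, IsSelfAdjoint]; simp [hps]
  obtain ⟨b, hb, hba, -, hcomm⟩ := exists_invSqrt has (δ := ‖star T * T - p‖)
    (by rw [ha]; apply le_of_eq; congr 1; abel) h1
  have hap : a * p = star T * T := by
    rw [ha, add_mul, sub_mul, mul_assoc, hTp, hpp, one_mul, sub_self, add_zero]
  have hpa : p * a = star T * T := by
    rw [ha, mul_add, mul_sub, ← mul_assoc, hpT, hpp, mul_one, sub_self, add_zero]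
  have hbp : b * p = p * b := hcomm p (by rw [Commute, SemiconjBy, hap, hpa])
  have hab : a * b = b * a := (hcomm a (Commute.refl a)).symm
  have hww : star (T * b) * (T * b) = p := by
    calc star (T * b) * (T * b) = b * (star T * T) * b := by
          rw [star_mul, hb.star_eq]; simp only [mul_assoc]
      _ = b * (a * b) * p := by rw [← hap]; simp only [mul_assoc, hbp]
      _ = p := by rw [hab, ← mul_assoc, hba, one_mul]
  refine ⟨T * b, hww, ?_⟩
  set f := q - (T * b) * star (T * b) with hf
  have hwq : q * (T * b) = T * b := by rw [← mul_assoc, hqT]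
  have hfT : f * (T * star T) = 0 := by
    have : (T * b) * star (T * b) * T = T := by
      calc (T * b) * star (T * b) * T = T * (b * b * (star T * T)) := by
            rw [star_mul, hb.star_eq]; simp only [mul_assoc]
        _ = T := by rw [← hap, ← mul_assoc (b * b), hba, one_mul, hTp]
    rw [hf, sub_mul, ← mul_assoc, hqT, ← mul_assoc, this, sub_self]
  have hfq : f * q = f := by
    have : star (T * b) * q = star (T * b) := by
      rw [← hqs, ← star_mul, hwq]
    rw [hf, sub_mul, hqq, mul_assoc, this]
  have hfb : f * (T * star T + (1 - q)) = 0 := by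
    rw [mul_add, hfT, mul_sub, mul_one, hfq, sub_self, add_zero]
  have hu : IsUnit (T * star T + (1 - q)) := by
    have := isUnit_one_sub_of_norm_lt_one (x := q - T * star T) (by rwa [norm_sub_rev])
    convert this using 1
    abel
  have : f = 0 := by
    rw [← hu.mul_left_eq_zero]; exact hfb
  exact (sub_eq_zero.1 this).symm

lemma exists_partialIsometry_of_norm_sub_lt {p q : A} (hp : IsStarProjection p)
    (hq : IsStarProjection q) (h : ‖p - q‖ < 1) : ∃ w : A, star w * w = p ∧ w * star w = q := by
  have hpp := hp.isIdempotentElem.eq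
  have hqq := hq.isIdempotentElem.eq
  have hps := hp.isSelfAdjoint.star_eq
  have hqs := hq.isSelfAdjoint.star_eq
  have key : ∀ p q : A, IsStarProjection p → p * p = p → ‖p - q‖ < 1 →
      ‖p * q * p - p‖ < 1 := by
    intro p q hp hpp h
    have : p * q * p - p = p * (q - p) * p := by
      rw [mul_sub, sub_mul, hpp, hpp]
    rw [this]
    refine lt_of_le_of_lt ?_ h
    calc ‖p * (q - p) * p‖ ≤ ‖p‖ * ‖q - p‖ * ‖p‖ := norm_mul₃_le
      _ ≤ 1 * ‖q - p‖ * 1 := by gcongr <;> exact hp.norm_le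
      _ = ‖p - q‖ := by rw [one_mul, mul_one, norm_sub_rev]
  refine exists_partialIsometry (T := q * p) hp hq (by rw [mul_assoc, hpp])
    (by rw [← mul_assoc, hqq]) ?_ ?_
  · convert key p q hp hpp h using 3
    simp only [star_mul, hps, hqs, mul_assoc]
    rw [← mul_assoc q q, hqq]
  · convert key q p hq hqq (by rwa [norm_sub_rev]) using 3
    simp only [star_mul, hps, hqs, mul_assoc]
    rw [← mul_assoc p p, hpp]

/-- Polar correction of an element close to a unitary. -/
lemma exists_polar {u y : A} (hu : u ∈ unitary A) {η : ℝ} (h : ‖y - u‖ ≤ η) (hη : η ≤ 1 / 20) :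
    ∃ b : A, IsSelfAdjoint b ∧ b * b * (star y * y) = 1 ∧ y * (b * b) * star y = 1 ∧
      ‖y * b - u‖ ≤ 10 * η ∧ ∀ x, Commute (star y * y) x → Commute b x := by
  have hη0 : 0 ≤ η := (norm_nonneg _).trans h
  have hu1 := norm_le_one_of_mem_unitary hu
  have hus := Unitary.star_mul_self_of_mem hu
  have hy1 : ‖y‖ ≤ 1 + η := by
    calc ‖y‖ = ‖u + (y - u)‖ := by congr 1; abel
      _ ≤ ‖u‖ + ‖y - u‖ := norm_add_le _ _
      _ ≤ 1 + η := by gcongr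
  have hc : ‖star y * y - 1‖ ≤ 3 * η := by
    have : star y * y - 1 = star y * (y - u) + star (y - u) * u := by
      rw [star_sub, mul_sub, sub_mul, hus]; abel
    rw [this]
    calc _ ≤ ‖star y‖ * ‖y - u‖ + ‖star (y - u)‖ * ‖u‖ :=
          (norm_add_le _ _).trans (add_le_add (norm_mul_le _ _) (norm_mul_le _ _))
      _ ≤ (1 + η) * η + η * 1 := by rw [norm_star, norm_star]; gcongr
      _ ≤ 3 * η := by nlinarith
  obtain ⟨b, hb, hbc, hb1, hcomm⟩ := exists_invSqrt (IsSelfAdjoint.star_mul_self y) hc (by linarith)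
  have hb1' : ‖b - 1‖ ≤ 6 * η := by
    refine hb1.trans ?_
    rw [div_le_iff₀ (by linarith)]
    nlinarith
  refine ⟨b, hb, hbc, ?_, ?_, hcomm⟩
  · have hyu : IsUnit y := by
      have h1 : IsUnit (1 - (1 - star u * y)) := by
        apply isUnit_one_sub_of_norm_lt_one
        have : 1 - star u * y = star u * (u - y) := by rw [mul_sub, hus]
        rw [this]
        calc _ ≤ ‖star u‖ * ‖u - y‖ := norm_mul_le _ _
          _ ≤ 1 * η := by rw [norm_star, norm_sub_rev]; gcongr
          _ < 1 := by linarith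
      rw [sub_sub_cancel] at h1
      have h2 : y = u * (star u * y) := by
        rw [← mul_assoc, Unitary.mul_star_self_of_mem hu, one_mul]
      rw [h2]
      exact (Unitary.toUnits ⟨u, hu⟩).isUnit.mul h1
    obtain ⟨v, rfl⟩ := hyu
    have : b * b * star (v : A) = ↑v⁻¹ := by
      rw [← Units.mul_eq_one_iff_eq_inv, ← hbc, mul_assoc]
    rw [mul_assoc, this, Units.mul_inv]
  · have : y * b - u = y * (b - 1) + (y - u) := by rw [mul_sub, mul_one]; abel
    rw [this]
    calc _ ≤ ‖y‖ * ‖b - 1‖ + ‖y - u‖ := (norm_add_le _ _).trans (by gcongr; exact norm_mul_le _ _)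
      _ ≤ (1 + η) * (6 * η) + η := by gcongr
      _ ≤ 10 * η := by nlinarith

end CStarLemmas

section PairClasses

open Matrix

variable {R : Type*} [Ring R] [StarRing R]
variable {ι κ μ : Type*} [Fintype ι] [Fintype κ] [Fintype μ]

/-- A pair `(p, x)` of a projection `p` and an element `x` of the corner cut out by `p`. -/
structure IsPair (p x : Matrix ι ι R) : Prop where
  proj : IsStarProjection p
  left : p * x = x
  right : x * p = x

/-- Murray–von Neumann equivalence of pairs. -/
def PairIso (p x : Matrix ι ι R) (q y : Matrix κ κ R) : Prop :=
  ∃ w : Matrix κ ι R, wᴴ * w = p ∧ w * wᴴ = q ∧ w * p = w ∧ w * x * wᴴ = y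

lemma IsStarProjection.isPair_zero {p : Matrix ι ι R} (hp : IsStarProjection p) : IsPair p 0 :=
  ⟨hp, by simp, by simp⟩

lemma IsStarProjection.conjTranspose_eq {p : Matrix ι ι R} (hp : IsStarProjection p) : pᴴ = p :=
  hp.isSelfAdjoint.star_eq

lemma IsStarProjection.mul_self {p : Matrix ι ι R} (hp : IsStarProjection p) : p * p = p :=
  hp.isIdempotentElem.eq

lemma isStarProjection_mul_conjTranspose {p : Matrix ι ι R} {w : Matrix κ ι R}
    (hw : wᴴ * w = p) (hwp : w * p = w) : IsStarProjection (w * wᴴ) := by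
  refine ⟨?_, ?_⟩
  · rw [IsIdempotentElem, Matrix.mul_assoc, ← Matrix.mul_assoc wᴴ, hw, ← Matrix.mul_assoc, hwp]
  · rw [IsSelfAdjoint, star_eq_conjTranspose]; simp

lemma IsPair.map {p x : Matrix ι ι R} (h : IsPair p x) {w : Matrix κ ι R} (hw : wᴴ * w = p)
    (hwp : w * p = w) : IsPair (w * wᴴ) (w * x * wᴴ) := by
  refine ⟨isStarProjection_mul_conjTranspose hw hwp, ?_, ?_⟩
  · calc w * wᴴ * (w * x * wᴴ) = w * (wᴴ * w * x) * wᴴ := by simp only [Matrix.mul_assoc]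
      _ = _ := by rw [hw, h.left]
  · calc w * x * wᴴ * (w * wᴴ) = w * (x * (wᴴ * w)) * wᴴ := by simp only [Matrix.mul_assoc]
      _ = _ := by rw [hw, h.right]

namespace PairIso

variable {p x : Matrix ι ι R} {q y : Matrix κ κ R} {r z : Matrix μ μ R}

lemma refl (h : IsPair p x) : PairIso p x p x :=
  ⟨p, by rw [h.proj.conjTranspose_eq, h.proj.mul_self],
    by rw [h.proj.conjTranspose_eq, h.proj.mul_self], h.proj.mul_self,
    by rw [h.proj.conjTranspose_eq, h.left, h.right]⟩

lemma symm (h : IsPair p x) : PairIso p x q y → PairIso q y p x := by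
  rintro ⟨w, rfl, rfl, hw, rfl⟩
  refine ⟨wᴴ, by simp, by simp, ?_, ?_⟩
  · have := congrArg conjTranspose hw
    simpa [conjTranspose_mul, Matrix.mul_assoc] using this
  · calc wᴴ * (w * x * wᴴ) * wᴴᴴ = (wᴴ * w) * x * (wᴴ * w) := by
          simp only [conjTranspose_conjTranspose, Matrix.mul_assoc]
      _ = x := by rw [h.left, h.right]

lemma trans : PairIso p x q y → PairIso q y r z → PairIso p x r z := by
  rintro ⟨w, h1, h2, h3, rfl⟩ ⟨v, h4, rfl, h5, rfl⟩
  refine ⟨v * w, ?_, ?_, ?_, ?_⟩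
  · calc (v * w)ᴴ * (v * w) = wᴴ * (vᴴ * v) * w := by
          simp only [conjTranspose_mul, Matrix.mul_assoc]
      _ = wᴴ * (w * (wᴴ * w)) := by rw [h4, ← h2]; simp only [Matrix.mul_assoc]
      _ = p := by rw [h1, h3, h1]
  · rw [conjTranspose_mul, Matrix.mul_assoc, ← Matrix.mul_assoc w, h2, ← Matrix.mul_assoc, h5]
  · rw [Matrix.mul_assoc, h3]
  · simp only [conjTranspose_mul, Matrix.mul_assoc]

end PairIso

/-- Representatives of classes of pairs. -/
structure PairRep (R : Type*) [Ring R] [StarRing R] where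
  n : ℕ
  p : Matrix (Fin n) (Fin n) R
  x : Matrix (Fin n) (Fin n) R
  isPair : IsPair p x

instance PairRep.setoid (R : Type*) [Ring R] [StarRing R] : Setoid (PairRep R) where
  r a b := PairIso a.p a.x b.p b.x
  iseqv := ⟨fun a => .refl a.isPair, fun {a _} h => h.symm a.isPair, fun h h' => h.trans h'⟩

/-- The monoid of equivalence classes of pairs. -/
def PairClass (R : Type*) [Ring R] [StarRing R] : Type _ := Quotient (PairRep.setoid R)

section Incl

variable [DecidableEq ι] [DecidableEq κ] [DecidableEq μ]

/-- The matrix of a map of index sets. -/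
def incl (R : Type*) [Ring R] (f : ι → κ) : Matrix κ ι R :=
  of fun a i => if a = f i then 1 else 0

lemma incl_apply (f : ι → κ) (a : κ) (i : ι) : incl R f a i = if a = f i then 1 else 0 := rfl

lemma conjTranspose_incl_apply (f : ι → κ) (a : κ) (i : ι) :
    (incl R f)ᴴ i a = if a = f i then 1 else 0 := by
  rw [conjTranspose_apply, incl_apply]; split_ifs <;> simp

lemma conjTranspose_incl_mul_apply {ν : Type*} (f : ι → κ) (X : Matrix κ ν R) (i : ι) (j : ν) :
    ((incl R f)ᴴ * X) i j = X (f i) j := by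
  rw [Matrix.mul_apply]
  simp only [conjTranspose_incl_apply]
  simp

lemma mul_incl_apply {ν : Type*} (f : ι → κ) (X : Matrix ν κ R) (i : ι) (j : ν) :
    (X * incl R f) j i = X j (f i) := by
  simp [Matrix.mul_apply, incl_apply]

lemma conjTranspose_incl_mul_incl {f : ι → κ} (hf : Function.Injective f) :
    (incl R f)ᴴ * incl R f = 1 := by
  ext i j
  rw [conjTranspose_incl_mul_apply, incl_apply, Matrix.one_apply]
  simp [hf.eq_iff]

lemma conjTranspose_incl_mul_incl_eq_zero {f : ι → κ} {g : μ → κ} (h : ∀ i j, f i ≠ g j) :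
    (incl R f)ᴴ * incl R g = 0 := by
  ext i j
  rw [conjTranspose_incl_mul_apply, incl_apply, if_neg (h i j)]; rfl

lemma incl_mul_incl (f : ι → κ) (g : κ → μ) : incl R g * incl R f = incl R (g ∘ f) := by
  ext a i
  rw [mul_incl_apply, incl_apply, incl_apply]; rfl

end Incl

lemma IsPair.exists_rep {p x : Matrix ι ι R} (h : IsPair p x) :
    ∃ a : PairRep R, PairIso p x a.p a.x := by
  classical
  have h1 : (incl R (Fintype.equivFin ι) * p)ᴴ * (incl R (Fintype.equivFin ι) * p) = p := by
    rw [conjTranspose_mul, Matrix.mul_assoc, ← Matrix.mul_assoc _ (incl R _),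
      conjTranspose_incl_mul_incl (Fintype.equivFin ι).injective, Matrix.one_mul,
      h.proj.conjTranspose_eq, h.proj.mul_self]
  have h2 : incl R (Fintype.equivFin ι) * p * p = incl R (Fintype.equivFin ι) * p := by
    rw [Matrix.mul_assoc, h.proj.mul_self]
  exact ⟨⟨_, _, _, h.map h1 h2⟩, _, h1, rfl, h2, rfl⟩

lemma IsPair.fromBlocks {p x : Matrix ι ι R} (h : IsPair p x) {q y : Matrix κ κ R}
    (h' : IsPair q y) : IsPair (fromBlocks p 0 0 q) (fromBlocks x 0 0 y) := by
  refine ⟨⟨?_, ?_⟩, ?_, ?_⟩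
  · simp [IsIdempotentElem, fromBlocks_multiply, h.proj.mul_self, h'.proj.mul_self]
  · simp [IsSelfAdjoint, star_eq_conjTranspose, fromBlocks_conjTranspose, h.proj.conjTranspose_eq,
      h'.proj.conjTranspose_eq]
  · simp [fromBlocks_multiply, h.left, h'.left]
  · simp [fromBlocks_multiply, h.right, h'.right]

lemma PairIso.fromBlocks {ι' κ' : Type*} [Fintype ι'] [Fintype κ']
    {p x : Matrix ι ι R} {q y : Matrix κ κ R} {p' x' : Matrix ι' ι' R} {q' y' : Matrix κ' κ' R} :
    PairIso p x p' x' → PairIso q y q' y' →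
      PairIso (fromBlocks p 0 0 q) (fromBlocks x 0 0 y) (fromBlocks p' 0 0 q')
        (fromBlocks x' 0 0 y') := by
  rintro ⟨w, h1, h2, h3, h4⟩ ⟨v, h5, h6, h7, h8⟩
  exact ⟨Matrix.fromBlocks w 0 0 v, by simp [fromBlocks_conjTranspose, fromBlocks_multiply, *]⟩

/-- An orthogonal pair of partial isometries merges two pairs. -/
lemma PairIso.merge {p x : Matrix ι ι R} {q y : Matrix κ κ R}
    {w : Matrix μ ι R} {v : Matrix μ κ R} (hw : wᴴ * w = p) (hwp : w * p = w) (hv : vᴴ * v = q)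
    (hvq : v * q = v) (hwv : wᴴ * v = 0) :
    PairIso (Matrix.fromBlocks p 0 0 q) (Matrix.fromBlocks x 0 0 y) (w * wᴴ + v * vᴴ)
      (w * x * wᴴ + v * y * vᴴ) := by
  have hvw : vᴴ * w = 0 := by simpa using congrArg conjTranspose hwv
  refine ⟨fromCols w v, ?_, ?_, ?_, ?_⟩
  · rw [conjTranspose_fromCols_eq_fromRows_conjTranspose, fromRows_mul_fromCols, hw, hv, hwv, hvw]
  · rw [conjTranspose_fromCols_eq_fromRows_conjTranspose, fromCols_mul_fromRows]
  · rw [fromCols_mul_fromBlocks]; simp [hwp, hvq]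
  · rw [conjTranspose_fromCols_eq_fromRows_conjTranspose, fromCols_mul_fromBlocks,
      fromCols_mul_fromRows]; simp

namespace PairClass

/-- The class of a pair of matrices with arbitrary finite index set. -/
def cls {p x : Matrix ι ι R} (h : IsPair p x) : PairClass R :=
  Quotient.mk (PairRep.setoid R) h.exists_rep.choose

lemma cls_eq_iff {p x : Matrix ι ι R} (h : IsPair p x) {q y : Matrix κ κ R} (h' : IsPair q y) :
    cls h = cls h' ↔ PairIso p x q y := by
  have ha := h.exists_rep.choose_spec
  have hb := h'.exists_rep.choose_spec
  refine Quotient.eq.trans ?_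
  exact ⟨fun H => (ha.trans H).trans (hb.symm h'), fun H => ((ha.symm h).trans H).trans hb⟩

lemma cls_rep (a : PairRep R) : cls a.isPair = Quotient.mk (PairRep.setoid R) a :=
  Quotient.sound (a.isPair.exists_rep.choose_spec.symm a.isPair)

@[elab_as_elim]
lemma ind {motive : PairClass R → Prop}
    (H : ∀ (n : ℕ) (p x : Matrix (Fin n) (Fin n) R) (h : IsPair p x), motive (cls h))
    (a : PairClass R) : motive a := by
  induction a using Quotient.ind with
  | _ a => exact cls_rep a ▸ H a.n a.p a.x a.isPair

instance : Add (PairClass R) :=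
  ⟨Quotient.lift₂ (fun a b => cls (a.isPair.fromBlocks b.isPair)) fun _ _ _ _ h h' =>
    (cls_eq_iff _ _).2 (PairIso.fromBlocks h h')⟩

instance : Zero (PairClass R) :=
  ⟨cls (p := (0 : Matrix (Fin 0) (Fin 0) R)) (x := 0) ⟨.zero _, by simp, by simp⟩⟩

lemma cls_fromBlocks {p x : Matrix ι ι R} (h : IsPair p x) {q y : Matrix κ κ R}
    (h' : IsPair q y) : cls (h.fromBlocks h') = cls h + cls h' :=
  (cls_eq_iff _ (h.exists_rep.choose.isPair.fromBlocks h'.exists_rep.choose.isPair)).2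
    (PairIso.fromBlocks h.exists_rep.choose_spec h'.exists_rep.choose_spec)

lemma cls_merge {p x : Matrix ι ι R} {q y : Matrix κ κ R} {r z : Matrix μ μ R} (h : IsPair p x)
    (h' : IsPair q y) (h'' : IsPair r z)
    {w : Matrix μ ι R} {v : Matrix μ κ R} (hw : wᴴ * w = p) (hwp : w * p = w) (hv : vᴴ * v = q)
    (hvq : v * q = v) (hwv : wᴴ * v = 0) (hr : w * wᴴ + v * vᴴ = r)
    (hz : w * x * wᴴ + v * y * vᴴ = z) :
    cls h'' = cls h + cls h' := by
  subst hr hz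
  rw [← cls_fromBlocks]
  exact ((cls_eq_iff _ _).2 (PairIso.merge hw hwp hv hvq hwv)).symm

/-- The class of an orthogonal sum. -/
lemma cls_orthogonal {p x q y r z : Matrix ι ι R} (h : IsPair p x) (h' : IsPair q y)
    (h'' : IsPair r z) (hpq : p * q = 0) (hr : p + q = r) (hz : x + y = z) :
    cls h'' = cls h + cls h' := by
  refine cls_merge h h' h'' (w := p) (v := q) ?_ h.proj.mul_self ?_ h'.proj.mul_self ?_ ?_ ?_
  all_goals simp only [h.proj.conjTranspose_eq, h'.proj.conjTranspose_eq, h.proj.mul_self,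
    h'.proj.mul_self, h.left, h.right, h'.left, h'.right, hpq, hr, hz]

lemma cls_of_isometry {p x : Matrix ι ι R} {q y : Matrix κ κ R} (h : IsPair p x) (h' : IsPair q y)
    {w : Matrix κ ι R} (hw : wᴴ * w = p) (hwp : w * p = w) (hq : w * wᴴ = q)
    (hy : w * x * wᴴ = y) : cls h' = cls h :=
  ((cls_eq_iff _ _).2 ⟨w, hw, hq, hwp, hy⟩).symm

lemma cls_zero {x : Matrix ι ι R} (h : IsPair 0 x) : cls h = 0 := by
  have hx : x = 0 := by rw [← h.left, Matrix.zero_mul]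
  subst hx
  exact (cls_eq_iff _ _).2 ⟨0, by simp⟩

lemma cls_fromBlocks_comm {p x : Matrix ι ι R} {q y : Matrix κ κ R} (h : IsPair p x)
    (h' : IsPair q y) : cls (h.fromBlocks h') = cls h' + cls h := by
  refine cls_merge h' h _ (w := fromRows 0 q) (v := fromRows p 0) ?_ ?_ ?_ ?_ ?_ ?_ ?_
  all_goals simp only [conjTranspose_fromRows_eq_fromCols_conjTranspose, fromCols_mul_fromRows,
    fromRows_mul, h.proj.conjTranspose_eq, h'.proj.conjTranspose_eq,
    conjTranspose_zero, Matrix.mul_zero, Matrix.zero_mul, zero_add, add_zero,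
    h.proj.mul_self, h'.proj.mul_self, h.left, h'.left]
  all_goals ext (i | i) (j | j) <;>
    simp [h.proj.mul_self, h'.proj.mul_self, h.right, h'.right]

lemma cls_fromBlocks_assoc {p x : Matrix ι ι R} {q y : Matrix κ κ R} {r z : Matrix μ μ R}
    (h : IsPair p x) (h' : IsPair q y) (h'' : IsPair r z) :
    cls (h.fromBlocks (h'.fromBlocks h'')) = cls h + cls h' + cls h'' := by
  rw [← cls_fromBlocks]
  refine cls_merge (h.fromBlocks h') h'' _
    (w := fromRows (fromCols p 0) (fromRows (fromCols 0 q) (fromCols 0 0)))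
    (v := fromRows 0 (fromRows 0 r)) ?_ ?_ ?_ ?_ ?_ ?_ ?_
  all_goals simp only [conjTranspose_fromRows_eq_fromCols_conjTranspose, fromCols_mul_fromRows,
    conjTranspose_fromCols_eq_fromRows_conjTranspose, fromCols_mul_fromBlocks,
    fromRows_mul, h.proj.conjTranspose_eq, h'.proj.conjTranspose_eq,
    conjTranspose_zero, Matrix.mul_zero, Matrix.zero_mul, zero_add, add_zero,
    h''.proj.conjTranspose_eq, h''.proj.mul_self, h''.left,
    h.proj.mul_self, h'.proj.mul_self, h.left, h'.left]
  · ext (i | i) (j | j) <;> simp [h.proj.mul_self, h'.proj.mul_self]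
  · simp
  all_goals ext (i | i | i) (j | j | j) <;>
    simp [mul_fromCols, fromCols_mul_fromRows, h.proj.mul_self, h'.proj.mul_self, h''.proj.mul_self,
      h.right, h'.right, h''.right]

instance : AddCommMonoid (PairClass R) where
  add_assoc a b c := by
    induction a using ind with | _ n p x h
    induction b using ind with | _ m q y h'
    induction c using ind with | _ k r z h''
    rw [← cls_fromBlocks_assoc h h' h'', cls_fromBlocks h (h'.fromBlocks h''), cls_fromBlocks]
  zero_add a := by
    induction a using ind with | _ n p x h
    have h0 : IsPair (0 : Matrix (Fin n) (Fin n) R) 0 := ⟨.zero _, by simp, by simp⟩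
    rw [← cls_zero h0]
    exact (cls_orthogonal h0 h h (by simp) (by simp) (by simp)).symm
  add_zero a := by
    induction a using ind with | _ n p x h
    have h0 : IsPair (0 : Matrix (Fin n) (Fin n) R) 0 := ⟨.zero _, by simp, by simp⟩
    rw [← cls_zero h0]
    exact (cls_orthogonal h h0 h (by simp) (by simp) (by simp)).symm
  add_comm a b := by
    induction a using ind with | _ n p x h
    induction b using ind with | _ m q y h'
    rw [← cls_fromBlocks_comm, cls_fromBlocks]
  nsmul := nsmulRec

end PairClass
end PairClasses

section MatrixCStar

open Matrix

section Instances

attribute [local instance] CStarAlgebra.spectralOrder CStarAlgebra.spectralOrderedRing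

/-- The C*-metric on matrices, inducing the entrywise uniformity definitionally. -/
@[reducible] def matrixMetricSpace (n A : Type*) [Fintype n] [DecidableEq n] [CStarAlgebra A] :
    MetricSpace (Matrix n n A) :=
  MetricSpace.replaceUniformity (U := inferInstance)
    (inferInstance : MetricSpace (CStarMatrix n n A)) rfl

/-- The C*-algebra structure on square matrices. -/
@[reducible] def matrixCStarAlgebra (n A : Type*) [Fintype n] [DecidableEq n] [CStarAlgebra A] :
    CStarAlgebra (Matrix n n A) where
  __ := (inferInstance : Ring (Matrix n n A))
  __ := (inferInstance : StarRing (Matrix n n A))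
  __ := (inferInstance : Algebra ℂ (Matrix n n A))
  __ := (inferInstance : StarModule ℂ (Matrix n n A))
  norm x := ‖CStarMatrix.ofMatrix x‖
  __ := matrixMetricSpace n A
  dist_eq x y := by
    refine (dist_eq_norm (E := CStarMatrix n n A) x y).trans ?_
    exact (norm_sub_rev (E := CStarMatrix n n A) x y).trans
      (congrArg (norm (E := CStarMatrix n n A)) (neg_add_eq_sub (α := CStarMatrix n n A) x y).symm)
  norm_mul_le x y := norm_mul_le (α := CStarMatrix n n A) x y
  norm_smul_le r x := norm_smul_le (β := CStarMatrix n n A) r x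
  norm_mul_self_le x := CStarRing.norm_mul_self_le (E := CStarMatrix n n A) x
  complete := (inferInstance : CompleteSpace (Matrix n n A)).complete

attribute [local instance] matrixCStarAlgebra

lemma norm_matrix_entry_le {n A : Type*} [Fintype n] [DecidableEq n] [CStarAlgebra A]
    (M : Matrix n n A) (i j : n) : ‖M i j‖ ≤ ‖M‖ :=
  CStarMatrix.norm_entry_le_norm (M := CStarMatrix.ofMatrix M)

end Instances

attribute [local instance] matrixCStarAlgebra

variable {R : Type*} [CStarAlgebra R] {ι κ μ : Type*} [Fintype ι] [Fintype κ] [Fintype μ]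
  [DecidableEq ι] [DecidableEq κ] [DecidableEq μ]

lemma norm_single_le (i j : ι) (a : R) : ‖Matrix.single i j a‖ ≤ ‖a‖ := by
  let φ : R →⋆ₙₐ[ℂ] Matrix ι ι R :=
    { toFun := fun a => Matrix.single i i a
      map_smul' := fun c a => (Matrix.smul_single _ _ _ _).symm
      map_zero' := by simp
      map_add' := fun a b => Matrix.single_add i i a b
      map_mul' := fun a b => (Matrix.single_mul_single_same _ _ _ _ _).symm
      map_star' := fun a => by rw [star_eq_conjTranspose, Matrix.conjTranspose_single] }
  have h1 : ‖φ (a * star a)‖ ≤ ‖a * star a‖ := NonUnitalStarAlgHom.norm_apply_le φ _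
  have h2 : φ (a * star a) = Matrix.single i j a * star (Matrix.single i j a) := by
    rw [star_eq_conjTranspose, Matrix.conjTranspose_single, Matrix.single_mul_single_same]
    rfl
  rw [h2, CStarRing.norm_self_mul_star, CStarRing.norm_self_mul_star] at h1
  exact abs_le_of_sq_le_sq' (by nlinarith) (norm_nonneg _) |>.2

lemma norm_matrix_le_sum (M : Matrix ι ι R) : ‖M‖ ≤ ∑ i, ∑ j, ‖M i j‖ := by
  conv_lhs => rw [Matrix.matrix_eq_sum_single M]
  refine (norm_sum_le _ _).trans (Finset.sum_le_sum fun i _ => (norm_sum_le _ _).trans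
    (Finset.sum_le_sum fun j _ => norm_single_le i j _))

lemma mul_eq_self_of_star_mul_self {A : Type*} [NonUnitalCStarAlgebra A] {p w : A}
    (hp : IsStarProjection p) (hw : star w * w = p) : w * p = w := by
  rw [← sub_eq_zero, ← CStarRing.star_mul_self_eq_zero_iff]
  have h1 := hp.isIdempotentElem.eq
  have h2 := hp.isSelfAdjoint.star_eq
  rw [star_sub, star_mul, h2, sub_mul, mul_sub, mul_sub, hw, mul_assoc, ← mul_assoc (star w), hw,
    h1, mul_assoc, hw, h1, sub_self]

lemma PairIso.of_partialIsometry {p q w : Matrix ι ι R} (hp : IsStarProjection p)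
    (h : star w * w = p) (h' : w * star w = q) : PairIso p 0 q 0 :=
  ⟨w, h, h', mul_eq_self_of_star_mul_self hp h, by simp⟩

section Map

variable {S : Type*} [CStarAlgebra S] (f : R →⋆ₐ[ℂ] S)

lemma map_mul_starAlgHom (M : Matrix ι κ R) (N : Matrix κ μ R) :
    (M * N).map f = M.map f * N.map f := by
  ext i j; simp [Matrix.mul_apply]

lemma map_conjTranspose_starAlgHom (M : Matrix ι κ R) : (Mᴴ).map f = (M.map f)ᴴ := by
  ext i j; simp [map_star]

lemma IsStarProjection.mapMatrix {p : Matrix ι ι R} (h : IsStarProjection p) :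
    IsStarProjection (p.map f) :=
  ⟨by rw [IsIdempotentElem, ← map_mul_starAlgHom, h.mul_self],
    by rw [IsSelfAdjoint, star_eq_conjTranspose, ← map_conjTranspose_starAlgHom,
      h.conjTranspose_eq]⟩

lemma IsPair.mapMatrix {p x : Matrix ι ι R} (h : IsPair p x) : IsPair (p.map f) (x.map f) :=
  ⟨h.proj.mapMatrix f, by rw [← map_mul_starAlgHom, h.left],
    by rw [← map_mul_starAlgHom, h.right]⟩

lemma PairIso.mapMatrix {p x : Matrix ι ι R} {q y : Matrix κ κ R} :
    PairIso p x q y → PairIso (p.map f) (x.map f) (q.map f) (y.map f) := by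
  rintro ⟨w, rfl, rfl, h, rfl⟩
  refine ⟨w.map f, ?_, ?_, ?_, ?_⟩
  all_goals simp only [← map_mul_starAlgHom, ← map_conjTranspose_starAlgHom, h]

end Map

section Unitization

variable {C : Type*} [NonUnitalCStarAlgebra C]

/-- The scalar part of a matrix over a unitization. -/
def fstM (M : Matrix ι κ (Unitization ℂ C)) : Matrix ι κ ℂ := M.map fun x => x.fst

/-- Scalar matrices. -/
def scal (C : Type*) [NonUnitalCStarAlgebra C] (M : Matrix ι κ ℂ) : Matrix ι κ (Unitization ℂ C) :=
  M.map Unitization.inl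

lemma fstM_apply (M : Matrix ι κ (Unitization ℂ C)) (i : ι) (j : κ) :
    fstM M i j = (M i j).fst := rfl

lemma fst_sum {α : Type*} (s : Finset α) (f : α → Unitization ℂ C) :
    (∑ a ∈ s, f a).fst = ∑ a ∈ s, (f a).fst :=
  map_sum (Unitization.fstHom ℂ C) f s

@[simp] lemma fstM_mul (M : Matrix ι κ (Unitization ℂ C)) (N : Matrix κ μ (Unitization ℂ C)) :
    fstM (M * N) = fstM M * fstM N := by
  ext i j; simp [fstM_apply, Matrix.mul_apply, fst_sum]

@[simp] lemma fstM_conjTranspose (M : Matrix ι κ (Unitization ℂ C)) : fstM Mᴴ = (fstM M)ᴴ := by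
  ext i j; simp [fstM_apply]

@[simp] lemma fstM_star (M : Matrix ι ι (Unitization ℂ C)) : fstM (star M) = (fstM M)ᴴ :=
  fstM_conjTranspose M

@[simp] lemma fstM_add (M N : Matrix ι κ (Unitization ℂ C)) : fstM (M + N) = fstM M + fstM N := by
  ext i j; simp [fstM_apply]

@[simp] lemma fstM_sub (M N : Matrix ι κ (Unitization ℂ C)) : fstM (M - N) = fstM M - fstM N := by
  ext i j; simp [fstM_apply, sub_eq_add_neg]

@[simp] lemma fstM_zero : fstM (0 : Matrix ι κ (Unitization ℂ C)) = 0 := rfl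

@[simp] lemma fstM_one : fstM (1 : Matrix ι ι (Unitization ℂ C)) = 1 := by
  ext i j; by_cases h : i = j <;> simp [fstM_apply, Matrix.one_apply, h]

@[simp] lemma fstM_scal (M : Matrix ι κ ℂ) : fstM (scal C M) = M := rfl

@[simp] lemma fstM_fromBlocks {ι' κ' : Type*} [Fintype ι'] [Fintype κ']
    (a : Matrix ι κ (Unitization ℂ C)) (b : Matrix ι κ' (Unitization ℂ C))
    (c : Matrix ι' κ (Unitization ℂ C)) (d : Matrix ι' κ' (Unitization ℂ C)) :
    fstM (fromBlocks a b c d) = fromBlocks (fstM a) (fstM b) (fstM c) (fstM d) :=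
  fromBlocks_map _ _ _ _ _

lemma scal_mul (M : Matrix ι κ ℂ) (N : Matrix κ μ ℂ) : scal C (M * N) = scal C M * scal C N := by
  ext1 i j
  simp only [scal, Matrix.map_apply, Matrix.mul_apply]
  rw [← Unitization.inlRingHom_apply]
  simp

lemma scal_conjTranspose (M : Matrix ι κ ℂ) : scal C Mᴴ = (scal C M)ᴴ := by
  ext1 i j; simp [scal, ← Unitization.inl_star]

lemma scal_one : scal C (1 : Matrix ι ι ℂ) = 1 := by
  ext1 i j; by_cases h : i = j <;> simp [scal, Matrix.one_apply, h]

/-- The constant diagonal matrix with entry `e`. -/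
def diagE (ι : Type*) [DecidableEq ι] (e : C) : Matrix ι ι (Unitization ℂ C) :=
  Matrix.diagonal fun _ => (e : Unitization ℂ C)

@[simp] lemma fstM_diagE (e : C) : fstM (diagE ι e) = 0 := by
  ext i j; by_cases h : i = j <;> simp [fstM_apply, diagE, h]

lemma diagE_mul_scal (e : C) (M : Matrix ι κ ℂ) : diagE ι e * scal C M = scal C M * diagE κ e := by
  ext1 i j
  simp only [diagE, scal, Matrix.diagonal_mul, Matrix.mul_diagonal, Matrix.map_apply]
  ext <;> simp

lemma isStarProjection_diagE {e : C} (he : IsStarProjection e) : IsStarProjection (diagE ι e) := by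
  refine ⟨?_, ?_⟩
  · rw [IsIdempotentElem, diagE, Matrix.diagonal_mul_diagonal]
    simp only [← Unitization.inr_mul, he.isIdempotentElem.eq]
  · rw [IsSelfAdjoint, star_eq_conjTranspose, diagE, Matrix.diagonal_conjTranspose]
    congr 1; ext1 i
    simp only [Pi.star_apply, ← Unitization.inr_star, he.isSelfAdjoint.star_eq]

open scoped ComplexOrder in
lemma fst_eq_zero_of_star_mul_self {p : Matrix ι ι (Unitization ℂ C)}
    {w : Matrix κ ι (Unitization ℂ C)} (hw : wᴴ * w = p) (hp : fstM p = 0) : fstM w = 0 := by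
  rw [← hw, fstM_mul, fstM_conjTranspose] at hp
  exact Matrix.conjTranspose_mul_self_eq_zero.1 hp

end Unitization

end MatrixCStar

section Stability

open Matrix
attribute [local instance] matrixCStarAlgebra

/-- Every finite set of elements is almost supported under a projection of which there are
infinitely many orthogonal copies. -/
def StableLike (C : Type*) [NonUnitalCStarAlgebra C] : Prop :=
  ∀ (s : Finset C) (ε : ℝ), 0 < ε → ∃ e : C, IsStarProjection e ∧
    (∀ b ∈ s, ‖e * b - b‖ ≤ ε ∧ ‖b * e - b‖ ≤ ε) ∧
    ∃ v : ℕ → C, ∀ k l, star (v k) * v l = if k = l then e else 0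

variable {ι κ : Type*} [Fintype ι] [DecidableEq ι] [Fintype κ] [DecidableEq κ]
variable {C : Type*} [NonUnitalCStarAlgebra C]

lemma norm_matrix_le_of_entries {M : Matrix ι ι (Unitization ℂ C)} {ε : ℝ}
    (h : ∀ i j, ‖M i j‖ ≤ ε) : ‖M‖ ≤ Fintype.card ι * Fintype.card ι * ε := by
  refine (norm_matrix_le_sum M).trans ((Finset.sum_le_sum fun i _ => Finset.sum_le_sum
    fun j _ => h i j).trans (le_of_eq ?_))
  simp [mul_assoc]

lemma exists_inr_of_fstM {M : Matrix ι κ (Unitization ℂ C)} (h : fstM M = 0) (i : ι) (j : κ) :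
    M i j = ((M i j).snd : C) := by
  have := congrFun (congrFun h i) j
  ext <;> simp_all [fstM_apply]

lemma StableLike.matrix (hC : StableLike C) (s : Finset (Matrix ι ι (Unitization ℂ C)))
    (hs : ∀ D ∈ s, fstM D = 0) {ε : ℝ} (hε : 0 < ε) :
    ∃ e : C, IsStarProjection e ∧
      (∀ D ∈ s, ‖diagE ι e * D - D‖ ≤ ε ∧ ‖D * diagE ι e - D‖ ≤ ε) ∧
      ∃ v : ℕ → C, ∀ k l, star (v k) * v l = if k = l then e else 0 := by
  classical
  set K : ℝ := Fintype.card ι * Fintype.card ι + 1 with hK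
  have hK0 : 0 < K := by positivity
  obtain ⟨e, he, h, hv⟩ := hC
    (s.biUnion fun D => Finset.univ.image fun ij : ι × ι => (D ij.1 ij.2).snd) (ε / K)
    (by positivity)
  refine ⟨e, he, fun D hD => ?_, hv⟩
  have hent : ∀ i j, ‖e * (D i j).snd - (D i j).snd‖ ≤ ε / K ∧
      ‖(D i j).snd * e - (D i j).snd‖ ≤ ε / K := fun i j =>
    h _ (Finset.mem_biUnion.2 ⟨D, hD, Finset.mem_image.2 ⟨(i, j), Finset.mem_univ _, rfl⟩⟩)
  have hle : Fintype.card ι * Fintype.card ι * (ε / K) ≤ ε := by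
    rw [mul_div_assoc', div_le_iff₀ hK0, hK]
    nlinarith
  refine ⟨(norm_matrix_le_of_entries fun i j => ?_).trans hle,
    (norm_matrix_le_of_entries fun i j => ?_).trans hle⟩
  · rw [Matrix.sub_apply, diagE, Matrix.diagonal_mul, exists_inr_of_fstM (hs D hD) i j,
      ← Unitization.inr_mul, ← Unitization.inr_sub, Unitization.norm_inr]
    exact (hent i j).1
  · rw [Matrix.sub_apply, diagE, Matrix.mul_diagonal, exists_inr_of_fstM (hs D hD) i j,
      ← Unitization.inr_mul, ← Unitization.inr_sub, Unitization.norm_inr]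
    exact (hent i j).2

/-- The row of partial isometries `v (f i)`. -/
def rowV (v : ℕ → C) (f : ι → ℕ) : Matrix (Fin 1) ι (Unitization ℂ C) := of fun _ i => (v (f i) : C)

@[simp] lemma fstM_rowV (v : ℕ → C) (f : ι → ℕ) : fstM (rowV v f) = 0 := by
  ext i j; simp [fstM_apply, rowV]

lemma conjTranspose_rowV_mul {v : ℕ → C} {e : C}
    (hv : ∀ k l, star (v k) * v l = if k = l then e else 0) {f : ι → ℕ}
    (hf : Function.Injective f) : (rowV v f)ᴴ * rowV v f = diagE ι e := by
  ext1 i j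
  simp only [Matrix.mul_apply, rowV, conjTranspose_apply, of_apply, Finset.univ_unique,
    Finset.sum_singleton, diagE, Matrix.diagonal_apply]
  rw [← Unitization.inr_star, ← Unitization.inr_mul, hv]
  simp only [hf.eq_iff]
  split_ifs <;> simp

lemma rowV_mul_diagE {v : ℕ → C} {e : C} (he : IsStarProjection e)
    (hv : ∀ k l, star (v k) * v l = if k = l then e else 0) (f : ι → ℕ) :
    rowV v f * diagE ι e = rowV v f := by
  ext1 i j
  simp only [rowV, diagE, Matrix.mul_diagonal, of_apply]
  rw [← Unitization.inr_mul, mul_eq_self_of_star_mul_self he ((hv _ _).trans (if_pos rfl))]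

/-- Compression of a pair under `diagE ι e` to a `1 × 1` pair. -/
lemma IsPair.exists_unit {v : ℕ → C} {e : C}
    (hv : ∀ k l, star (v k) * v l = if k = l then e else 0)
    {p x : Matrix ι ι (Unitization ℂ C)} (h : IsPair p x) (hpe : diagE ι e * p = p) :
    ∃ (q y : Matrix (Fin 1) (Fin 1) (Unitization ℂ C)) (h' : IsPair q y), fstM q = 0 ∧
      PairClass.cls h' = PairClass.cls h := by
  set f : ι → ℕ := fun i => Fintype.equivFin ι i
  have hf : Function.Injective f := Fin.val_injective.comp (Fintype.equivFin ι).injective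
  set w := rowV v f * p with hw
  have h1 : wᴴ * w = p := by
    rw [hw, conjTranspose_mul, Matrix.mul_assoc, ← Matrix.mul_assoc _ (rowV v f),
      conjTranspose_rowV_mul hv hf, hpe, h.proj.conjTranspose_eq, h.proj.mul_self]
  have h2 : w * p = w := by rw [hw, Matrix.mul_assoc, h.proj.mul_self]
  refine ⟨_, _, h.map h1 h2, ?_, PairClass.cls_of_isometry h _ h1 h2 rfl rfl⟩
  simp [hw]

lemma norm_le_one_of_rowV {v : ℕ → C} {e : C} (he : IsStarProjection e)
    (hv : ∀ k l, star (v k) * v l = if k = l then e else 0) (k : ℕ) : ‖v k‖ ≤ 1 := by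
  have h1 := he.norm_le
  have h2 := hv k k
  rw [if_pos rfl] at h2
  rw [← h2, CStarRing.norm_star_mul_self] at h1
  nlinarith [norm_nonneg (v k)]

section Product

variable {I : Type*} {B : I → Type*} [∀ i, NonUnitalCStarAlgebra (B i)]

lemma exists_lp (b : ∀ i, B i) (K : ℝ) (h : ∀ i, ‖b i‖ ≤ K) : ∃ x : lp B ∞, ∀ i, x i = b i :=
  ⟨⟨b, memℓp_infty ⟨K, by rintro _ ⟨i, rfl⟩; exact h i⟩⟩, fun _ => rfl⟩

lemma lp_ext {x y : lp B ∞} (h : ∀ i, x i = y i) : x = y := Subtype.ext (funext h)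

lemma StableLike.lp (h : ∀ i, StableLike (B i)) : StableLike (lp B ∞) := by
  classical
  intro s ε hε
  choose e he hb v hv using fun i => h i (s.image fun b => b i) ε hε
  obtain ⟨E, hE⟩ := exists_lp e 1 fun i => (he i).norm_le
  choose V hV using fun k => exists_lp (fun i => v i k) 1 fun i =>
    norm_le_one_of_rowV (he i) (hv i) k
  refine ⟨E, ⟨lp_ext fun i => ?_, lp_ext fun i => ?_⟩, fun b hbs => ?_, V,
    fun k l => lp_ext fun i => ?_⟩
  · rw [lp.infty_coeFn_mul, Pi.mul_apply, hE]; exact (he i).isIdempotentElem.eq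
  · rw [lp.coeFn_star, Pi.star_apply, hE]; exact (he i).isSelfAdjoint.star_eq
  · refine ⟨lp.norm_le_of_forall_le hε.le fun i => ?_, lp.norm_le_of_forall_le hε.le fun i => ?_⟩
    · rw [lp.coeFn_sub, Pi.sub_apply, lp.infty_coeFn_mul, Pi.mul_apply, hE]
      exact (hb i _ (Finset.mem_image_of_mem _ hbs)).1
    · rw [lp.coeFn_sub, Pi.sub_apply, lp.infty_coeFn_mul, Pi.mul_apply, hE]
      exact (hb i _ (Finset.mem_image_of_mem _ hbs)).2
  · rw [lp.infty_coeFn_mul, Pi.mul_apply, lp.coeFn_star, Pi.star_apply, hV, hV, hv]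
    split_ifs
    · rw [hE]
    · rfl

/-- Coordinate of a matrix over the unitization of a product. -/
def coord (i : I) (M : Matrix ι κ (Unitization ℂ (lp B ∞))) : Matrix ι κ (Unitization ℂ (B i)) :=
  M.map (Unitization.starMap (lpProj B i))

lemma coord_apply (i : I) (M : Matrix ι κ (Unitization ℂ (lp B ∞))) (a : ι) (b : κ) :
    coord i M a b = Unitization.starMap (lpProj B i) (M a b) := rfl

lemma starMap_apply {C D : Type*} [NonUnitalCStarAlgebra C] [NonUnitalCStarAlgebra D]
    (ψ : C →⋆ₙₐ[ℂ] D) (x : Unitization ℂ C) :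
    (Unitization.starMap ψ x).fst = x.fst ∧ (Unitization.starMap ψ x).snd = ψ x.snd := by
  induction x with
  | inl_add_inr r a => simp [Unitization.algebraMap_eq_inl]

lemma coord_ext {M N : Matrix ι κ (Unitization ℂ (lp B ∞))} (h : fstM M = fstM N)
    (h' : ∀ i, coord i M = coord i N) : M = N := by
  ext1 a b
  ext1
  · exact congrFun (congrFun h a) b
  refine lp_ext fun i => ?_
  have := congrArg (fun x : Unitization ℂ (B i) => x.snd) (congrFun (congrFun (h' i) a) b)
  simp only [coord_apply, (starMap_apply _ _).2] at this
  exact this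

lemma exists_coord (M : ∀ i, Matrix ι ι (Unitization ℂ (B i))) (hM : ∀ i, fstM (M i) = 0) (K : ℝ)
    (hK : ∀ i, ‖M i‖ ≤ K) :
    ∃ N : Matrix ι ι (Unitization ℂ (lp B ∞)), fstM N = 0 ∧ ∀ i, coord i N = M i := by
  have hb : ∀ a b i, ‖(M i a b).snd‖ ≤ K := fun a b i => by
    rw [← Unitization.norm_inr (𝕜 := ℂ), ← exists_inr_of_fstM (hM i)]
    exact (norm_matrix_entry_le _ _ _).trans (hK i)
  choose x hx using fun a b => exists_lp (fun i => (M i a b).snd) K (hb a b)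
  refine ⟨of fun a b => (x a b : Unitization ℂ (lp B ∞)), ?_, fun i => ?_⟩
  · ext a b; simp [fstM_apply]
  · ext1 a b
    rw [exists_inr_of_fstM (hM i), coord_apply, of_apply, Unitization.starMap_inr, ← hx a b i]
    rfl

lemma fstM_starMap {C D : Type*} [NonUnitalCStarAlgebra C] [NonUnitalCStarAlgebra D]
    (ψ : C →⋆ₙₐ[ℂ] D) (M : Matrix ι κ (Unitization ℂ C)) :
    fstM (M.map (Unitization.starMap ψ)) = fstM M := by
  ext a b
  exact (starMap_apply _ _).1

end Product

end Stability

section StabilizationStable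

open Matrix

variable {A B : Type*} [CStarAlgebra A] [NonUnitalCStarAlgebra B]

/-- Truncation of an infinite matrix. -/
def trunc (F : ℕ → ℕ → A) (n : ℕ) : Matrix (Fin n) (Fin n) A := of fun i j => F i j

lemma IsStabilization.map_trunc (st : IsStabilization A B) {F : ℕ → ℕ → A} {n N : ℕ}
    (hF : ∀ i j, ¬ (i < n ∧ j < n) → F i j = 0) (hN : n ≤ N) :
    st.φ N (trunc F N) = st.φ n (trunc F n) := by
  induction N, hN using Nat.le_induction with
  | base => rfl
  | succ N hN ih =>
    rw [← ih, ← st.compat N]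
    refine congrArg (st.φ (N + 1)) ?_
    ext i j
    simp only [cornerEmb, trunc, of_apply]
    split_ifs with h h'
    · rfl
    · exact hF _ _ (by omega)
    · exact hF _ _ (by omega)

lemma IsStabilization.exists_le (st : IsStabilization A B) {n N : ℕ} (hN : n ≤ N)
    (M : Matrix (Fin n) (Fin n) A) : ∃ M', st.φ N M' = st.φ n M := by
  refine ⟨_, (st.map_trunc
    (F := fun i j => if h : i < n ∧ j < n then M ⟨i, h.1⟩ ⟨j, h.2⟩ else 0)
    (fun i j h => dif_neg h) hN).trans (congrArg _ ?_)⟩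
  ext i j
  simp [trunc]

/-- The matrix units moving the first `n` coordinates to the `k`-th block of length `n`. -/
def blockShift (A : Type*) [CStarAlgebra A] (n k i j : ℕ) : A :=
  if j < n ∧ i = j + k * n then 1 else 0

lemma blockShift_eq_zero {n k i j m : ℕ} (hm : (k + 1) * n ≤ m) (h : ¬ (i < m ∧ j < m)) :
    blockShift A n k i j = 0 := by
  refine if_neg fun ⟨h1, h2⟩ => h ?_
  rw [add_mul, one_mul] at hm
  omega

lemma star_blockShift_mul (n k l N : ℕ) (hk : (k + 1) * n ≤ N) :
    star (trunc (blockShift A n k) N) * trunc (blockShift A n l) N =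
      if k = l then trunc (blockShift A n 0) N else 0 := by
  ext i j
  rw [Matrix.mul_apply]
  by_cases hi : (i : ℕ) < n
  · have h1 : (i : ℕ) + k * n < N := by rw [add_mul, one_mul] at hk; omega
    rw [Finset.sum_eq_single ⟨i + k * n, h1⟩]
    · have h2 : (j : ℕ) < n → ((i : ℕ) + k * n = j + l * n ↔ k = l ∧ (i : ℕ) = j) := by
        refine fun hj => ⟨fun h => ?_, fun ⟨h, h'⟩ => by rw [h, h']⟩
        have h3 : k = l := by
          have := congrArg (· / n) h
          simpa [Nat.add_mul_div_right _ _ (Nat.zero_lt_of_lt hi), Nat.div_eq_of_lt hi,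
            Nat.div_eq_of_lt hj] using this
        subst h3
        exact ⟨rfl, by omega⟩
      by_cases hj : (j : ℕ) < n
      · by_cases hkl : k = l <;> simp [trunc, blockShift, star_apply, hi, hj, h2 hj, hkl]
      · by_cases hkl : k = l <;> simp [trunc, blockShift, star_apply, hi, hj, hkl]
    · intro b _ hb
      have : (b : ℕ) ≠ i + k * n := fun h => hb (Fin.ext h)
      simp [trunc, blockShift, star_apply, this]
    · simp
  · rw [Finset.sum_eq_zero]
    · split_ifs with h
      · simp only [trunc, blockShift, of_apply, zero_mul, add_zero]
        rw [if_neg]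
        omega
      · rfl
    · intro b _
      simp [trunc, blockShift, star_apply, hi]

lemma trunc_blockShift_zero (n : ℕ) : trunc (blockShift A n 0) n = 1 := by
  ext i j
  simp [trunc, blockShift, Matrix.one_apply, Fin.ext_iff]

theorem IsStabilization.stableLike (st : IsStabilization A B) : StableLike B := by
  classical
  intro s ε hε
  have h1 : ∀ b : B, ∃ n, ∃ M : Matrix (Fin n) (Fin n) A, ‖b - st.φ n M‖ < ε / 2 := by
    intro b
    obtain ⟨b', hb', h⟩ := Metric.dense_iff.1 st.dense b (ε / 2) (by positivity)
    obtain ⟨n, M, rfl⟩ := Set.mem_iUnion.1 h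
    exact ⟨n, M, by rwa [← dist_eq_norm, dist_comm]⟩
  choose m M hM using h1
  set n := s.sup m
  have he : IsStarProjection (st.φ n 1) :=
    ⟨by rw [IsIdempotentElem, ← map_mul, one_mul], by rw [IsSelfAdjoint, ← map_star, star_one]⟩
  refine ⟨st.φ n 1, he, fun b hb => ?_,
    fun k => st.φ ((k + 1) * n) (trunc (blockShift A n k) _), fun k l => ?_⟩
  · obtain ⟨M', hM'⟩ := st.exists_le (Finset.le_sup hb : m b ≤ n) (M b)
    have h2 := hM b
    rw [← hM'] at h2
    set b' := st.φ n M' with hb'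
    have h3 : st.φ n 1 * b' = b' := by rw [hb', ← map_mul, one_mul]
    have h4 : b' * st.φ n 1 = b' := by rw [hb', ← map_mul, mul_one]
    have h5 := he.norm_le
    constructor
    · have : st.φ n 1 * b - b = st.φ n 1 * (b - b') - (b - b') := by rw [mul_sub, h3]; abel
      rw [this]
      have h6 := (norm_mul_le (st.φ n 1) (b - b'))
      have h7 := norm_sub_le (st.φ n 1 * (b - b')) (b - b')
      nlinarith [norm_nonneg (b - b')]
    · have : b * st.φ n 1 - b = (b - b') * st.φ n 1 - (b - b') := by rw [sub_mul, h4]; abel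
      rw [this]
      have h6 := (norm_mul_le (b - b') (st.φ n 1))
      have h7 := norm_sub_le ((b - b') * st.φ n 1) (b - b')
      nlinarith [norm_nonneg (b - b')]
  · have h2 : ∀ j ≤ max k l, st.φ ((j + 1) * n) (trunc (blockShift A n j) _) =
        st.φ ((max k l + 1) * n) (trunc (blockShift A n j) _) := fun j hj =>
      (st.map_trunc (fun _ _ h => blockShift_eq_zero le_rfl h)
        (Nat.mul_le_mul_right n (by omega))).symm
    beta_reduce
    rw [h2 k (le_max_left _ _), h2 l (le_max_right _ _), ← map_star, ← map_mul,
      star_blockShift_mul _ _ _ _ (Nat.mul_le_mul_right n (by omega))]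
    split_ifs
    · rw [← trunc_blockShift_zero, st.map_trunc]
      · exact fun _ _ h => blockShift_eq_zero (by omega) h
      · exact Nat.le_mul_of_pos_left _ (Nat.succ_pos _)
    · exact map_zero _

end StabilizationStable

section ProjectionPaths

open Matrix PairClass
attribute [local instance] matrixCStarAlgebra

lemma joinedIn_iff_exists_real_path {X : Type*} [TopologicalSpace X] {S : Set X} {a b : X} :
    JoinedIn S a b ↔ ∃ path : ℝ → X, Continuous path ∧ (∀ t ∈ Set.Icc (0 : ℝ) 1, path t ∈ S) ∧
      path 0 = a ∧ path 1 = b := by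
  constructor
  · intro h
    refine ⟨h.somePath.extend, h.somePath.continuous_extend, fun t ht => ?_, by simp, by simp⟩
    rw [Path.extend_apply _ ht]
    exact h.somePath_mem _
  · rintro ⟨f, hf, hS, h0, h1⟩
    exact JoinedIn.ofLine hf.continuousOn h0 h1 (by rintro _ ⟨t, ht, rfl⟩; exact hS t ht)

variable {R : Type*} [CStarAlgebra R] {ι κ μ : Type*} [Fintype ι] [DecidableEq ι] [Fintype κ]
  [DecidableEq κ] [Fintype μ] [DecidableEq μ]

/-- The class of a projection. -/
abbrev pcls {p : Matrix ι ι R} (hp : IsStarProjection p) : PairClass R := cls hp.isPair_zero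

lemma pcls_eq_of_norm_sub_lt {p q : Matrix ι ι R} (hp : IsStarProjection p)
    (hq : IsStarProjection q) (h : ‖p - q‖ < 1) : pcls hp = pcls hq := by
  obtain ⟨w, h1, h2⟩ := exists_partialIsometry_of_norm_sub_lt hp hq h
  exact (cls_eq_iff _ _).2 (PairIso.of_partialIsometry hp h1 h2)

lemma pcls_eq_of_path {path : ℝ → Matrix ι ι R} (hc : Continuous path)
    (h : ∀ t ∈ Set.Icc (0 : ℝ) 1, IsStarProjection (path t)) :
    pcls (h 0 ⟨le_rfl, zero_le_one⟩) = pcls (h 1 ⟨zero_le_one, le_rfl⟩) := by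
  have hl : IsLocallyConstant fun t : Set.Icc (0 : ℝ) 1 => pcls (h t t.2) := by
    refine (IsLocallyConstant.iff_eventually_eq _).2 fun t => ?_
    have h1 : Filter.Tendsto (fun s : Set.Icc (0 : ℝ) 1 => ‖path s - path t‖) (nhds t)
        (nhds 0) := by
      have : Continuous fun s : Set.Icc (0 : ℝ) 1 => ‖path s - path t‖ := by fun_prop
      simpa using this.tendsto t
    filter_upwards [h1.eventually_lt_const one_pos] with s hs
    exact pcls_eq_of_norm_sub_lt _ _ hs
  exact hl.apply_eq_of_preconnectedSpace ⟨0, le_rfl, zero_le_one⟩ ⟨1, zero_le_one, le_rfl⟩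

lemma joinedIn_of_isometries {P : Matrix ι ι R} {w z : Matrix κ ι R}
    (hw : wᴴ * w = P) (hz : zᴴ * z = P) (hwz : wᴴ * z = 0) (hwP : w * P = w) (hzP : z * P = z) :
    JoinedIn {p : Matrix κ κ R | IsStarProjection p} (w * wᴴ) (z * zᴴ) := by
  have hzw : zᴴ * w = 0 := by simpa using congrArg conjTranspose hwz
  set V : ℝ → Matrix κ ι R := fun t =>
    ((Real.cos (Real.pi / 2 * t) : ℝ) : ℂ) • w + ((Real.sin (Real.pi / 2 * t) : ℝ) : ℂ) • z with hV
  have hVc : Continuous V := by fun_prop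
  refine joinedIn_iff_exists_real_path.2 ⟨fun t => V t * (V t)ᴴ, ?_, fun t _ => ?_, ?_, ?_⟩
  · exact hVc.matrix_mul hVc.matrix_conjTranspose
  · refine isStarProjection_mul_conjTranspose (p := P) ?_ ?_
    · simp only [hV, conjTranspose_add, conjTranspose_smul, Matrix.add_mul, Matrix.mul_add,
        Matrix.smul_mul, Matrix.mul_smul, hw, hz, hwz, hzw, smul_zero, add_zero, zero_add,
        smul_smul, ← add_smul]
      have : ((Real.cos (Real.pi / 2 * t) : ℝ) : ℂ) * star ((Real.cos (Real.pi / 2 * t) : ℝ) : ℂ) +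
          ((Real.sin (Real.pi / 2 * t) : ℝ) : ℂ) * star ((Real.sin (Real.pi / 2 * t) : ℝ) : ℂ)
            = 1 := by
        simp only [Complex.star_def, Complex.conj_ofReal]
        norm_cast
        nlinarith [Real.sin_sq_add_cos_sq (Real.pi / 2 * t)]
      rw [this, one_smul]
    · simp only [hV, Matrix.add_mul, Matrix.smul_mul, hwP, hzP]
  · simp [hV]
  · simp [hV]

variable (R) in
lemma exists_path_of_pcls_eq {N M : ℕ} (hM : N + N ≤ M) {P Q : Matrix (Fin N) (Fin N) R}
    (hP : IsStarProjection P) (hQ : IsStarProjection Q) (h : pcls hP = pcls hQ) :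
    JoinedIn {p : Matrix (Fin M) (Fin M) R | IsStarProjection p}
      (incl R (Fin.castLE (show N ≤ M by omega)) * P *
        (incl R (Fin.castLE (show N ≤ M by omega)))ᴴ)
      (incl R (Fin.castLE (show N ≤ M by omega)) * Q *
        (incl R (Fin.castLE (show N ≤ M by omega)))ᴴ) := by
  obtain ⟨v, h1, h2, h3, -⟩ := (cls_eq_iff _ _).1 h
  set f : Fin N → Fin M := Fin.castLE (show N ≤ M by omega) with hf
  set g : Fin N → Fin M := fun i => ⟨N + i, by omega⟩ with hg
  have hfi : Function.Injective f := Fin.castLE_injective _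
  have hgi : Function.Injective g := fun i j hij => by
    have := congrArg Fin.val hij
    simp only [hg] at this
    exact Fin.ext (by omega)
  have hfg : ∀ i j, f i ≠ g j := fun i j hij => by
    have := congrArg Fin.val hij
    simp only [hg, hf, Fin.val_castLE] at this
    omega
  have hff := conjTranspose_incl_mul_incl (R := R) hfi
  have hgg := conjTranspose_incl_mul_incl (R := R) hgi
  have h0 := conjTranspose_incl_mul_incl_eq_zero (R := R) hfg
  have key : ∀ {P' : Matrix (Fin N) (Fin N) R} (w : Matrix (Fin N) (Fin N) R),
      IsStarProjection P' → wᴴ * w = P' → w * P' = w →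
      JoinedIn {p : Matrix (Fin M) (Fin M) R | IsStarProjection p} (incl R f * P' * (incl R f)ᴴ)
        (incl R g * (w * wᴴ) * (incl R g)ᴴ) := by
    intro P' w hP' hw hwP
    have := joinedIn_of_isometries (P := P') (w := incl R f * P') (z := incl R g * w) ?_ ?_ ?_ ?_ ?_
    · convert this using 1
      · simp only [conjTranspose_mul, hP'.conjTranspose_eq, Matrix.mul_assoc]
        rw [← Matrix.mul_assoc P' P', hP'.mul_self]
      · simp only [conjTranspose_mul, Matrix.mul_assoc]
    · rw [conjTranspose_mul, Matrix.mul_assoc, ← Matrix.mul_assoc _ (incl R f), hff,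
        Matrix.one_mul, hP'.conjTranspose_eq, hP'.mul_self]
    · rw [conjTranspose_mul, Matrix.mul_assoc, ← Matrix.mul_assoc _ (incl R g), hgg,
        Matrix.one_mul, hw]
    · rw [conjTranspose_mul, Matrix.mul_assoc, ← Matrix.mul_assoc _ (incl R g), h0,
        Matrix.zero_mul, Matrix.mul_zero]
    · rw [Matrix.mul_assoc, hP'.mul_self]
    · rw [Matrix.mul_assoc, hwP]
  have hA := key v hP h1 h3
  have hB := key Q hQ (by rw [hQ.conjTranspose_eq, hQ.mul_self]) hQ.mul_self
  rw [hQ.conjTranspose_eq, hQ.mul_self] at hB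
  rw [h2] at hA
  exact hA.trans hB.symm

end ProjectionPaths

section Embeddings

open Matrix PairClass

variable {R : Type*} [Ring R] [StarRing R] {ι κ : Type*} [Fintype ι] [Fintype κ]
  [DecidableEq κ]

lemma incl_conj_apply {f : ι → κ} (hf : Function.Injective f) (p : Matrix ι ι R) (i j : ι) :
    (incl R f * p * (incl R f)ᴴ) (f i) (f j) = p i j := by
  classical
  simp only [Matrix.mul_apply, conjTranspose_incl_apply, incl_apply, hf.eq_iff]
  simp

lemma incl_conj_apply_eq_zero {f : ι → κ} (p : Matrix ι ι R) {a b : κ}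
    (h : (∀ i, a ≠ f i) ∨ ∀ i, b ≠ f i) : (incl R f * p * (incl R f)ᴴ) a b = 0 := by
  rcases h with h | h
  · simp [Matrix.mul_apply, incl_apply, h]
  · simp [Matrix.mul_apply, incl_apply, h]

/-- The inclusion of `Fin m` in `Fin M` with offset `o`. -/
def offset {m M : ℕ} (o : ℕ) (h : o + m ≤ M) (i : Fin m) : Fin M := ⟨o + i, by omega⟩

lemma offset_injective {m M : ℕ} (o : ℕ) (h : o + m ≤ M) : Function.Injective (offset o h) :=
  fun i j hij => Fin.ext (by simpa [offset] using hij)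

lemma emb_eq_incl {m M : ℕ} (o : ℕ) (h : o + m ≤ M) (p : Matrix (Fin m) (Fin m) R) :
    emb o p = incl R (offset o h) * p * (incl R (offset o h))ᴴ := by
  ext a b
  by_cases hab : o ≤ (a : ℕ) ∧ (a : ℕ) < o + m ∧ o ≤ (b : ℕ) ∧ (b : ℕ) < o + m
  · obtain ⟨i, rfl⟩ : ∃ i, a = offset o h i := ⟨⟨a - o, by omega⟩,
      Fin.ext (by simp [offset]; omega)⟩
    obtain ⟨j, rfl⟩ : ∃ j, b = offset o h j := ⟨⟨b - o, by omega⟩,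
      Fin.ext (by simp [offset]; omega)⟩
    rw [incl_conj_apply (offset_injective o h), emb, dif_pos hab]
    simp [offset]
  · rw [emb, dif_neg hab, incl_conj_apply_eq_zero]
    by_contra! hc
    obtain ⟨⟨i, rfl⟩, ⟨j, rfl⟩⟩ := hc
    simp [offset] at hab

lemma emb_mul_emb_eq_zero {m m' M : ℕ} {o o' : ℕ} (h : o + m ≤ o') (h' : o' + m' ≤ M)
    (p : Matrix (Fin m) (Fin m) R) (q : Matrix (Fin m') (Fin m') R) :
    (emb o p : Matrix (Fin M) (Fin M) R) * emb o' q = 0 := by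
  rw [emb_eq_incl o (by omega), emb_eq_incl o' h', Matrix.mul_assoc,
    Matrix.mul_assoc (incl R (offset o' h')),
    ← Matrix.mul_assoc _ (incl R (offset o' h')), conjTranspose_incl_mul_incl_eq_zero,
    Matrix.zero_mul, Matrix.mul_zero]
  intro i j hij
  have := congrArg Fin.val hij
  simp only [offset] at this
  omega

lemma IsPair.incl_conj {p x : Matrix ι ι R} (h : IsPair p x) {f : ι → κ}
    (hf : Function.Injective f) : ∃ h' : IsPair (incl R f * p * (incl R f)ᴴ)
      (incl R f * x * (incl R f)ᴴ), cls h' = cls h := by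
  classical
  have h1 : (incl R f * p)ᴴ * (incl R f * p) = p := by
    rw [conjTranspose_mul, Matrix.mul_assoc, ← Matrix.mul_assoc _ (incl R _),
      conjTranspose_incl_mul_incl hf, Matrix.one_mul, h.proj.conjTranspose_eq, h.proj.mul_self]
  have h2 : incl R f * p * p = incl R f * p := by rw [Matrix.mul_assoc, h.proj.mul_self]
  have h3 : incl R f * p * (incl R f * p)ᴴ = incl R f * p * (incl R f)ᴴ := by
    rw [conjTranspose_mul, h.proj.conjTranspose_eq, ← Matrix.mul_assoc, h2]
  have h4 : incl R f * p * x * (incl R f * p)ᴴ = incl R f * x * (incl R f)ᴴ := by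
    rw [conjTranspose_mul, h.proj.conjTranspose_eq, ← Matrix.mul_assoc, Matrix.mul_assoc _ p x,
      h.left, Matrix.mul_assoc _ x p, h.right]
  have h5 := h.map h1 h2
  rw [h3, h4] at h5
  exact ⟨h5, cls_of_isometry h h5 h1 h2 h3 h4⟩

lemma IsPair.emb {m M : ℕ} {p x : Matrix (Fin m) (Fin m) R} (h : IsPair p x) (o : ℕ)
    (ho : o + m ≤ M) : ∃ h' : IsPair (emb o p : Matrix (Fin M) (Fin M) R) (_root_.emb o x),
      cls h' = cls h := by
  obtain ⟨h1, h2⟩ := h.incl_conj (offset_injective o ho)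
  rw [emb_eq_incl o ho, emb_eq_incl o ho]
  exact ⟨h1, h2⟩

lemma IsPair.add {p x q y : Matrix ι ι R} (h : IsPair p x) (h' : IsPair q y) (hpq : p * q = 0) :
    IsPair (p + q) (x + y) := by
  have hqp : q * p = 0 := by
    have := congrArg conjTranspose hpq
    rwa [conjTranspose_mul, h.proj.conjTranspose_eq, h'.proj.conjTranspose_eq,
      conjTranspose_zero] at this
  have h1 : p * y = 0 := by rw [← h'.left, ← Matrix.mul_assoc, hpq, Matrix.zero_mul]
  have h2 : q * x = 0 := by rw [← h.left, ← Matrix.mul_assoc, hqp, Matrix.zero_mul]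
  have h3 : y * p = 0 := by rw [← h'.right, Matrix.mul_assoc, hqp, Matrix.mul_zero]
  have h4 : x * q = 0 := by rw [← h.right, Matrix.mul_assoc, hpq, Matrix.mul_zero]
  refine ⟨⟨?_, ?_⟩, ?_, ?_⟩
  · rw [IsIdempotentElem, Matrix.mul_add, Matrix.add_mul, Matrix.add_mul, hpq, hqp,
      h.proj.mul_self, h'.proj.mul_self, add_zero, zero_add]
  · exact h.proj.isSelfAdjoint.add h'.proj.isSelfAdjoint
  · rw [Matrix.mul_add, Matrix.add_mul, Matrix.add_mul, h.left, h'.left, h1, h2, add_zero, zero_add]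
  · rw [Matrix.mul_add, Matrix.add_mul, Matrix.add_mul, h.right, h'.right, h3, h4, add_zero,
      zero_add]

lemma IsPair.emb_add_emb {m m' M : ℕ} {p x : Matrix (Fin m) (Fin m) R}
    {q y : Matrix (Fin m') (Fin m') R} (h : IsPair p x) (h' : IsPair q y) (hM : m + m' ≤ M) :
    ∃ h'' : IsPair (_root_.emb 0 p + _root_.emb m q : Matrix (Fin M) (Fin M) R)
      (_root_.emb 0 x + _root_.emb m y), cls h'' = cls h + cls h' := by
  obtain ⟨h1, h2⟩ := h.emb (M := M) 0 (by omega)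
  obtain ⟨h3, h4⟩ := h'.emb (M := M) m (by omega)
  have h5 := emb_mul_emb_eq_zero (R := R) (zero_add m).le hM p q
  exact ⟨h1.add h3 h5, by rw [← h2, ← h4]; exact cls_orthogonal h1 h3 _ h5 rfl rfl⟩

lemma IsPair.emb_add_emb_add_emb {m m' m'' M : ℕ} {p x : Matrix (Fin m) (Fin m) R}
    {q y : Matrix (Fin m') (Fin m') R} {r z : Matrix (Fin m'') (Fin m'') R} (h : IsPair p x)
    (h' : IsPair q y) (h'' : IsPair r z) (hM : m + m' + m'' ≤ M) :
    ∃ h''' : IsPair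
      (_root_.emb 0 p + _root_.emb m q + _root_.emb (m + m') r : Matrix (Fin M) (Fin M) R)
      (_root_.emb 0 x + _root_.emb m y + _root_.emb (m + m') z),
      cls h''' = cls h + cls h' + cls h'' := by
  obtain ⟨h1, h2⟩ := h.emb_add_emb h' (M := M) (by omega)
  obtain ⟨h3, h4⟩ := h''.emb (M := M) (m + m') hM
  have h5 : (_root_.emb 0 p + _root_.emb m q : Matrix (Fin M) (Fin M) R) *
      _root_.emb (m + m') r = 0 := by
    rw [Matrix.add_mul, emb_mul_emb_eq_zero (by omega) hM, emb_mul_emb_eq_zero (by omega) hM,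
      add_zero]
  exact ⟨h1.add h3 h5, by rw [← h2, ← h4]; exact cls_orthogonal h1 h3 _ h5 rfl rfl⟩

lemma emb_eq_incl_castLE_emb {m N M : ℕ} (hNM : N ≤ M) (o : ℕ) (h : o + m ≤ N)
    (p : Matrix (Fin m) (Fin m) R) :
    (emb o p : Matrix (Fin M) (Fin M) R) =
      incl R (Fin.castLE hNM) * (emb o p : Matrix (Fin N) (Fin N) R) *
        (incl R (Fin.castLE hNM))ᴴ := by
  rw [emb_eq_incl o (by omega : o + m ≤ M), emb_eq_incl o h, ← Matrix.mul_assoc,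
    ← Matrix.mul_assoc, Matrix.mul_assoc _ (incl R _)ᴴ, ← conjTranspose_mul, incl_mul_incl]
  rfl

lemma emb_zero {m M : ℕ} (o : ℕ) :
    (emb o (0 : Matrix (Fin m) (Fin m) R) : Matrix (Fin M) (Fin M) R) = 0 := by
  ext a b
  simp [emb]

end Embeddings

section KZero

open Matrix PairClass

lemma IsProjM.isStarProjection {R : Type*} [Ring R] [StarRing R] {m : ℕ}
    {p : Matrix (Fin m) (Fin m) R} (h : IsProjM p) : IsStarProjection p := ⟨h.2, h.1⟩

variable {B : Type*} [NonUnitalCStarAlgebra B]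

lemma K0Good.p {x : K0Rep B} (h : K0Good x) : IsStarProjection x.p := h.1.isStarProjection

lemma K0Good.q {x : K0Rep B} (h : K0Good x) : IsStarProjection x.q := h.2.1.isStarProjection

/-- Stable equality of formal differences in the monoid of classes. -/
def K0Eqv (x y : {z : K0Rep B // K0Good z}) : Prop :=
  ∃ a, pcls x.2.p + pcls y.2.q + a = pcls y.2.p + pcls x.2.q + a

lemma K0Eqv.equivalence : Equivalence (K0Eqv (B := B)) where
  refl _ := ⟨0, rfl⟩
  symm := fun ⟨a, h⟩ => ⟨a, h.symm⟩
  trans := by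
    rintro x y z ⟨a, h⟩ ⟨b, h'⟩
    refine ⟨pcls y.2.p + pcls y.2.q + a + b, ?_⟩
    calc _ = (pcls x.2.p + pcls y.2.q + a) + (pcls y.2.p + pcls z.2.q + b) := by abel
      _ = _ := by rw [h, h']; abel

lemma K0Rel.eqv {x y : {z : K0Rep B // K0Good z}} : K0Rel B x y → K0Eqv x y := by
  rintro ⟨s, M, hM, r, hr, path, hc, hp, h0, h1⟩
  have hr := hr.isStarProjection
  obtain ⟨a0, b0⟩ := x.2.p.isPair_zero.emb_add_emb_add_emb y.2.q.isPair_zero hr.isPair_zero hM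
  obtain ⟨a1, b1⟩ := y.2.p.isPair_zero.emb_add_emb_add_emb x.2.q.isPair_zero hr.isPair_zero
    (M := M) (by omega)
  refine ⟨pcls hr, ?_⟩
  rw [← b0, ← b1]
  have := pcls_eq_of_path hc fun t ht => (hp t ht).isStarProjection
  have e0 := (cls_eq_iff _ _).1 this
  rw [cls_eq_iff]
  rw [h0, h1] at e0
  simpa [emb_zero] using e0

lemma K0Eqv.rel {x y : {z : K0Rep B // K0Good z}} : K0Eqv x y → K0Rel B x y := by
  rintro ⟨a, ha⟩
  induction a using PairClass.ind with
  | _ s r z hrz =>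
  have hr := hrz.proj
  set N := x.1.m + y.1.m + s with hN
  obtain ⟨a0, b0⟩ := x.2.p.isPair_zero.emb_add_emb_add_emb y.2.q.isPair_zero hrz hN.ge
  obtain ⟨a1, b1⟩ := y.2.p.isPair_zero.emb_add_emb_add_emb x.2.q.isPair_zero hrz
    (M := N) (by omega)
  rw [← b0, ← b1, cls_eq_iff] at ha
  have hpq : pcls a0.proj = pcls a1.proj := by
    obtain ⟨w, h1, h2, h3, -⟩ := ha
    exact (cls_eq_iff _ _).2 ⟨w, h1, h2, h3, by simp⟩
  have hj := exists_path_of_pcls_eq (Unitization ℂ B) (M := N + N) le_rfl a0.proj a1.proj hpq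
  simp only [Matrix.mul_add, Matrix.add_mul] at hj
  simp only [← emb_eq_incl_castLE_emb (N := N) (M := N + N) (by omega) 0
    (show 0 + x.1.m ≤ N by omega),
    ← emb_eq_incl_castLE_emb (N := N) (M := N + N) (by omega) 0 (show 0 + y.1.m ≤ N by omega),
    ← emb_eq_incl_castLE_emb (N := N) (M := N + N) (by omega) x.1.m
      (show x.1.m + y.1.m ≤ N by omega),
    ← emb_eq_incl_castLE_emb (N := N) (M := N + N) (by omega) y.1.m
      (show y.1.m + x.1.m ≤ N by omega),
    ← emb_eq_incl_castLE_emb (N := N) (M := N + N) (by omega) (x.1.m + y.1.m)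
      (show x.1.m + y.1.m + s ≤ N by omega),
    ← emb_eq_incl_castLE_emb (N := N) (M := N + N) (by omega) (y.1.m + x.1.m)
      (show y.1.m + x.1.m + s ≤ N by omega)] at hj
  obtain ⟨path, hc, hp, h0, h1⟩ := joinedIn_iff_exists_real_path.1 hj
  exact ⟨s, N + N, by omega, r, ⟨hr.2, hr.1⟩, path, hc, fun t ht => ⟨(hp t ht).2, (hp t ht).1⟩,
    h0, h1⟩

lemma K0.mk_eq_iff {x y : {z : K0Rep B // K0Good z}} :
    (Quot.mk _ x : K0 B) = Quot.mk _ y ↔ K0Eqv x y := by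
  refine ⟨fun h => ?_, fun h => Quot.sound h.rel⟩
  exact K0Eqv.equivalence.eqvGen_iff.1 ((Quot.eqvGen_exact h).mono fun _ _ => K0Rel.eqv)

end KZero

section Perturbation

variable {A : Type*} [CStarAlgebra A]

lemma exists_isStarProjection_split {P P₀ E : A} (hP : IsStarProjection P)
    (hE : IsStarProjection E) (hc : E * P₀ = P₀ * E)
    (h1 : ‖E * (P - P₀) - (P - P₀)‖ ≤ 1 / 16) (h2 : ‖(P - P₀) * E - (P - P₀)‖ ≤ 1 / 16) :
    ∃ h : A, IsStarProjection h ∧ E * h = h ∧ h * E = h ∧ ‖P - (h + P₀ * (1 - E))‖ < 1 := by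
  have hEE := hE.isIdempotentElem.eq
  have hPP := hP.isIdempotentElem.eq
  have hE1 := hE.norm_le
  have hP1 := hP.norm_le
  set D := P - P₀ with hD
  have hPD : P = P₀ + D := by rw [hD]; abel
  set a := E * P * E with ha
  have hE' := hE.isSelfAdjoint.star_eq
  have has : IsSelfAdjoint a := by
    rw [IsSelfAdjoint, ha, star_mul, star_mul, hE', hP.isSelfAdjoint.star_eq, mul_assoc]
  have hQ : (1 - E) * P * E = -(E * D - D) * E := by
    have h0 : P₀ * E = E * (P₀ * E) := by rw [← hc, ← mul_assoc, hEE]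
    rw [hPD, sub_mul, one_mul, mul_add, sub_mul, add_mul, add_mul, mul_assoc E P₀, ← h0]
    simp only [neg_sub, sub_mul]
    abel
  have haa : ‖a * a - a‖ ≤ 1 / 16 := by
    have e1 : a * a - a = -(E * P * ((1 - E) * P * E)) := by
      calc a * a - a = E * P * (E * E) * P * E - E * (P * P) * E := by
            rw [hPP, ha]; simp only [mul_assoc]
        _ = _ := by rw [hEE]; noncomm_ring
    have hEP : ‖E * P‖ ≤ 1 := (norm_mul_le _ _).trans (mul_le_one₀ hE1 (norm_nonneg _) hP1)
    rw [e1, hQ, norm_neg]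
    calc ‖E * P * (-(E * D - D) * E)‖ ≤ ‖E * P‖ * (‖E * D - D‖ * ‖E‖) := by
          refine (norm_mul_le _ _).trans ?_
          gcongr
          exact (norm_mul_le _ _).trans_eq (by rw [norm_neg])
      _ ≤ 1 * (1 / 16 * 1) := by gcongr
      _ = 1 / 16 := by norm_num
  obtain ⟨p, hp, hpa, hcomm⟩ := exists_isStarProjection_near has haa (by norm_num)
  have hpE : p * E = E * p := hcomm E (by
    rw [Commute, SemiconjBy, ha, mul_assoc, hEE]; simp only [← mul_assoc, hEE])
  have hh : IsStarProjection (p * E) := by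
    refine ⟨?_, ?_⟩
    · rw [IsIdempotentElem, mul_assoc, ← mul_assoc E, ← hpE, mul_assoc p E E, hEE, ← mul_assoc,
        hp.isIdempotentElem.eq]
    · rw [IsSelfAdjoint, star_mul, hE', hp.isSelfAdjoint.star_eq, hpE]
  refine ⟨p * E, hh, by rw [hpE, ← mul_assoc, hEE], by rw [mul_assoc, hEE], ?_⟩
  have e2 : P - (p * E + P₀ * (1 - E)) = -(E * D - D) - E * (D * E - D) - (p - a) * E := by
    have e3 : a * E = a := by rw [ha, mul_assoc, hEE]
    have e4 : E * P₀ * E = P₀ * E := by rw [hc, mul_assoc, hEE]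
    rw [sub_mul p, e3, ha, hPD]
    have : E * (P₀ + D) * E = P₀ * E + E * (D * E) := by rw [mul_add, add_mul, e4, mul_assoc E D]
    rw [this]
    noncomm_ring
  rw [e2]
  calc _ ≤ ‖E * D - D‖ + ‖E‖ * ‖D * E - D‖ + ‖p - a‖ * ‖E‖ := by
        refine (norm_sub_le _ _).trans (add_le_add ((norm_sub_le _ _).trans
          (add_le_add (norm_neg _).le (norm_mul_le _ _))) (norm_mul_le _ _))
    _ ≤ 1 / 16 + 1 * (1 / 16) + 2 * (1 / 16) * 1 := by gcongr
    _ < 1 := by norm_num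

lemma norm_conj_sub_le {w E X Y G G' : A} (hX : star w * w = X) (hw : Y * w = w)
    (hYs : star Y = Y) (hY : IsStarProjection (w * star w))
    (hc : ‖E * w - w * E‖ ≤ 1 / 8) (hG : ‖G - X * E‖ ≤ 1 / 16) (hG' : ‖G' - Y * E‖ ≤ 1 / 16) :
    ‖star w * G' * w - G‖ ≤ 1 / 4 := by
  have hw1 : ‖w‖ ≤ 1 := by
    have h1 := hY.norm_le
    rw [CStarRing.norm_self_mul_star] at h1
    nlinarith [norm_nonneg w]
  have hw2 : ‖star w‖ ≤ 1 := by rwa [norm_star]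
  have e1 : star w * Y = star w := by rw [← hYs, ← star_mul, hw]
  have e2 : star w * G' * w - G =
      star w * (G' - Y * E) * w + star w * (E * w - w * E) - (G - X * E) := by
    rw [mul_sub, ← mul_assoc _ Y, e1, mul_sub, ← mul_assoc _ w, hX]
    noncomm_ring
  rw [e2]
  calc _ ≤ ‖star w‖ * ‖G' - Y * E‖ * ‖w‖ + ‖star w‖ * ‖E * w - w * E‖ + ‖G - X * E‖ := by
        refine (norm_sub_le _ _).trans (add_le_add ((norm_add_le _ _).trans
          (add_le_add ?_ (norm_mul_le _ _))) le_rfl)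
        exact (norm_mul_le _ _).trans (mul_le_mul_of_nonneg_right (norm_mul_le _ _) (norm_nonneg _))
    _ ≤ 1 * (1 / 16) * 1 + 1 * (1 / 8) + 1 / 16 := by gcongr
    _ = 1 / 4 := by norm_num

lemma exists_partialIsometry_compress {w E X Y G G' : A} (hX : star w * w = X)
    (hY : w * star w = Y) (hXp : IsStarProjection X) (hYp : IsStarProjection Y)
    (hEs : star E = E) (hGp : IsStarProjection G) (hGp' : IsStarProjection G')
    (hc : ‖E * w - w * E‖ ≤ 1 / 8) (hG : ‖G - X * E‖ ≤ 1 / 16) (hG' : ‖G' - Y * E‖ ≤ 1 / 16) :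
    ∃ v : A, star v * v = G ∧ v * star v = G' := by
  have hwX : w * X = w := mul_eq_self_of_star_mul_self hXp hX
  have hYw : Y * w = w := by rw [← hY, mul_assoc, hX, hwX]
  have hG1 := hGp.norm_le
  have hG1' := hGp'.norm_le
  have hGG := hGp.isIdempotentElem.eq
  have hGG' := hGp'.isIdempotentElem.eq
  have hGs := hGp.isSelfAdjoint.star_eq
  have hGs' := hGp'.isSelfAdjoint.star_eq
  have h1 := norm_conj_sub_le hX hYw hYp.isSelfAdjoint.star_eq (hY ▸ hYp) hc hG hG'
  have h2 := norm_conj_sub_le (w := star w) (E := E) (by rwa [star_star])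
    (by rw [← hXp.isSelfAdjoint.star_eq, ← star_mul, hwX]) hXp.isSelfAdjoint.star_eq
    (by rw [star_star, hX]; exact hXp)
    (by
      have : E * star w - star w * E = -star (E * w - w * E) := by
        rw [star_sub, star_mul, star_mul, hEs]; abel
      rwa [this, norm_neg, norm_star]) hG' hG
  rw [star_star] at h2
  have key : ∀ {G S : A}, G * G = G → ‖G‖ ≤ 1 → ‖S - G‖ ≤ 1 / 4 → ‖G * S * G - G‖ < 1 := by
    intro G S hGG hG1 hS
    have e : G * S * G - G = G * (S - G) * G := by
      rw [mul_sub, sub_mul, hGG, hGG]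
    rw [e]
    calc _ ≤ ‖G‖ * ‖S - G‖ * ‖G‖ :=
          (norm_mul_le _ _).trans (mul_le_mul_of_nonneg_right (norm_mul_le _ _) (norm_nonneg _))
      _ ≤ 1 * (1 / 4) * 1 := by gcongr
      _ < 1 := by norm_num
  refine exists_partialIsometry (T := G' * w * G) hGp hGp' (by rw [mul_assoc, hGG])
    (by rw [← mul_assoc, ← mul_assoc, hGG']) ?_ ?_
  · convert key hGG hG1 h1 using 2
    rw [star_mul, star_mul, hGs, hGs', ← mul_assoc, ← mul_assoc, ← mul_assoc, mul_assoc _ G' G',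
      hGG']
    simp only [mul_assoc]
  · convert key hGG' hG1' h2 using 2
    rw [star_mul, star_mul, hGs, hGs', ← mul_assoc, ← mul_assoc, mul_assoc _ G G, hGG]
    simp only [mul_assoc]

end Perturbation

section StableProjections

open Matrix PairClass
attribute [local instance] matrixCStarAlgebra

variable {C : Type*} [NonUnitalCStarAlgebra C] {ι : Type*} [Fintype ι] [DecidableEq ι]

lemma isStarProjection_scal_fstM {P : Matrix ι ι (Unitization ℂ C)} (hP : IsStarProjection P) :
    IsStarProjection (scal C (fstM P)) :=
  ⟨by rw [IsIdempotentElem, ← scal_mul, ← fstM_mul, hP.mul_self],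
    by rw [IsSelfAdjoint, star_eq_conjTranspose, ← scal_conjTranspose, ← fstM_conjTranspose,
      hP.conjTranspose_eq]⟩

lemma exists_pcls_split {P : Matrix ι ι (Unitization ℂ C)} (hP : IsStarProjection P) {e : C}
    (he : IsStarProjection e)
    (h1 : ‖diagE ι e * (P - scal C (fstM P)) - (P - scal C (fstM P))‖ ≤ 1 / 16)
    (h2 : ‖(P - scal C (fstM P)) * diagE ι e - (P - scal C (fstM P))‖ ≤ 1 / 16)
    (hc : IsStarProjection (scal C (fstM P) * (1 - diagE ι e))) :
    ∃ (h : Matrix ι ι (Unitization ℂ C)) (hh : IsStarProjection h), diagE ι e * h = h ∧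
      pcls hP = pcls hh + pcls hc := by
  have hE := isStarProjection_diagE (ι := ι) he
  obtain ⟨h, hh, h3, h4, h5⟩ := exists_isStarProjection_split hP hE (diagE_mul_scal e _) h1 h2
  have h6 : h * (scal C (fstM P) * (1 - diagE ι e)) = 0 := by
    have : scal C (fstM P) * (1 - diagE ι e) = (1 - diagE ι e) * scal C (fstM P) := by
      rw [mul_sub, sub_mul, mul_one, one_mul, diagE_mul_scal]
    rw [this, ← mul_assoc, mul_sub, mul_one, h4, sub_self, zero_mul]
  have h7 := (hh.isPair_zero.add hc.isPair_zero h6).proj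
  exact ⟨h, hh, h3, (pcls_eq_of_norm_sub_lt hP h7 h5).trans
    (cls_orthogonal _ _ _ h6 rfl (add_zero 0))⟩

lemma IsStarProjection.exists_unit {v : ℕ → C} {e : C}
    (hv : ∀ k l, star (v k) * v l = if k = l then e else 0)
    {p : Matrix ι ι (Unitization ℂ C)} (hp : IsStarProjection p) (hpe : diagE ι e * p = p) :
    ∃ (q : Matrix (Fin 1) (Fin 1) (Unitization ℂ C)) (hq : IsStarProjection q), fstM q = 0 ∧
      pcls hq = pcls hp := by
  obtain ⟨q, y, hqy, h0, h⟩ := hp.isPair_zero.exists_unit hv hpe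
  obtain ⟨w, h1, h2, h3, -⟩ := (cls_eq_iff _ _).1 h
  exact ⟨q, hqy.proj, h0, (cls_eq_iff _ _).2 ⟨w, h1, h2, h3, by simp⟩⟩

/-- Over a stable algebra, a formal difference of projections with equal scalar parts is
represented by `1 × 1` projections over the algebra itself. -/
theorem StableLike.exists_projection (hC : StableLike C) {P Q : Matrix ι ι (Unitization ℂ C)}
    (hP : IsStarProjection P) (hQ : IsStarProjection Q) (hPQ : fstM P = fstM Q) :
    ∃ (p q : Matrix (Fin 1) (Fin 1) (Unitization ℂ C)) (hp : IsStarProjection p)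
      (hq : IsStarProjection q), fstM p = 0 ∧ fstM q = 0 ∧
      pcls hP + pcls hq = pcls hQ + pcls hp := by
  classical
  obtain ⟨e, he, h, v, hv⟩ := hC.matrix {P - scal C (fstM P), Q - scal C (fstM Q)}
    (by simp) (show (0 : ℝ) < 1 / 16 by norm_num)
  have hE := isStarProjection_diagE (ι := ι) he
  have h0 := isStarProjection_scal_fstM hP
  have hc : IsStarProjection (scal C (fstM P) * (1 - diagE ι e)) := by
    have hcm : (1 - diagE ι e) * scal C (fstM P) = scal C (fstM P) * (1 - diagE ι e) := by
      rw [mul_sub, sub_mul, mul_one, one_mul, diagE_mul_scal]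
    have h1E := hE.one_sub
    refine ⟨?_, ?_⟩
    · rw [IsIdempotentElem, mul_assoc, ← mul_assoc (1 - _) (scal _ _), hcm, mul_assoc,
        h1E.mul_self, ← mul_assoc, h0.mul_self]
    · rw [IsSelfAdjoint, star_mul, h1E.isSelfAdjoint.star_eq, h0.isSelfAdjoint.star_eq, hcm]
  obtain ⟨p', hp', h1, h2⟩ := exists_pcls_split hP he (h _ (by simp)).1 (h _ (by simp)).2 hc
  obtain ⟨q', hq', h3, h4⟩ := exists_pcls_split hQ he (h _ (by simp)).1 (h _ (by simp)).2
    (hPQ ▸ hc)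
  obtain ⟨p, hp, h5, h6⟩ := hp'.exists_unit hv h1
  obtain ⟨q, hq, h7, h8⟩ := hq'.exists_unit hv h3
  refine ⟨p, q, hp, hq, h5, h7, ?_⟩
  rw [h6, h8, h2, h4]
  simp only [← hPQ]
  abel

/-- Stable equivalence of projections over a stable algebra is witnessed by a `1 × 1`
projection over the algebra itself. -/
theorem StableLike.exists_complement (hC : StableLike C) {P Q : Matrix ι ι (Unitization ℂ C)}
    (hP : IsStarProjection P) (hQ : IsStarProjection Q) (hP0 : fstM P = 0) (hQ0 : fstM Q = 0)
    {a : PairClass (Unitization ℂ C)} (ha : pcls hP + a = pcls hQ + a) :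
    ∃ (g : Matrix (Fin 1) (Fin 1) (Unitization ℂ C)) (hg : IsStarProjection g), fstM g = 0 ∧
      pcls hP + pcls hg = pcls hQ + pcls hg := by
  classical
  induction a using PairClass.ind with
  | _ s r z hrz =>
  have hr := hrz.proj
  have h1 : IsStarProjection (1 : Matrix (Fin s) (Fin s) (Unitization ℂ C)) :=
    IsStarProjection.one _
  have ha1 : pcls hP + pcls h1 = pcls hQ + pcls h1 := by
    have e1 : pcls h1 = pcls hr + pcls hr.one_sub :=
      cls_orthogonal _ _ _ (by rw [mul_sub, mul_one, hr.mul_self, sub_self]) (by abel) (add_zero 0)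
    have e2 : pcls hP + pcls hr = pcls hQ + pcls hr := by
      rw [← cls_fromBlocks, ← cls_fromBlocks, cls_eq_iff] at ha ⊢
      obtain ⟨w, h1, h2, h3, -⟩ := ha
      exact ⟨w, h1, h2, h3, by simp⟩
    rw [e1, ← add_assoc, e2, add_assoc]
  rw [← cls_fromBlocks, ← cls_fromBlocks, cls_eq_iff] at ha1
  obtain ⟨w, hwX, hwY, -, -⟩ := ha1
  obtain ⟨e, he, h, v, hv⟩ := hC.matrix
    {fromBlocks P 0 0 0, fromBlocks Q 0 0 0, w - scal C (fstM w)}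
    (by simp [hP0, hQ0]) (show (0 : ℝ) < 1 / 16 by norm_num)
  have hE := isStarProjection_diagE (ι := Fin s) he
  have hEs := (isStarProjection_diagE (ι := ι ⊕ Fin s) he).isSelfAdjoint.star_eq
  have hEb : diagE (ι ⊕ Fin s) e = fromBlocks (diagE ι e) 0 0 (diagE (Fin s) e) := by
    ext1 (i | i) (j | j) <;> simp [diagE, Matrix.diagonal_apply]
  have hG : ∀ {P : Matrix ι ι (Unitization ℂ C)},
      ‖(fromBlocks P 0 0 0 : Matrix (ι ⊕ Fin s) (ι ⊕ Fin s) _) * diagE _ e -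
        fromBlocks P 0 0 0‖ ≤ 1 / 16 →
      ‖fromBlocks P 0 0 (diagE (Fin s) e) - fromBlocks P 0 0 1 * diagE _ e‖ ≤ 1 / 16 := by
    intro P hP
    rw [norm_sub_rev] at hP
    refine (congrArg norm ?_).trans_le hP
    rw [hEb]
    simp only [fromBlocks_multiply, Matrix.mul_zero, Matrix.zero_mul, add_zero, zero_add,
      Matrix.one_mul]
    ext1 (i | i) (j | j) <;> simp
  have hcomm : ‖diagE _ e * w - w * diagE _ e‖ ≤ 1 / 8 := by
    obtain ⟨h2, h3⟩ := h (w - scal C (fstM w)) (by simp)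
    have h4 : diagE _ e * w - w * diagE _ e =
        (diagE _ e * (w - scal C (fstM w)) - (w - scal C (fstM w))) -
          ((w - scal C (fstM w)) * diagE _ e - (w - scal C (fstM w))) := by
      rw [mul_sub, sub_mul, diagE_mul_scal]
      abel
    rw [h4]
    exact (norm_sub_le _ _).trans ((add_le_add h2 h3).trans (by norm_num))
  obtain ⟨u, hu, hu'⟩ := exists_partialIsometry_compress (w := w) (E := diagE _ e) hwX hwY
    (hP.isPair_zero.fromBlocks h1.isPair_zero).proj (hQ.isPair_zero.fromBlocks h1.isPair_zero).proj
    hEs (hP.isPair_zero.fromBlocks hE.isPair_zero).proj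
    (hQ.isPair_zero.fromBlocks hE.isPair_zero).proj hcomm
    (hG (h _ (by simp)).2) (hG (h _ (by simp)).2)
  obtain ⟨g, hg, h0, h2⟩ := hE.exists_unit hv (hE.mul_self)
  refine ⟨g, hg, h0, ?_⟩
  rw [h2, ← cls_fromBlocks, ← cls_fromBlocks, cls_eq_iff]
  have := PairIso.of_partialIsometry (hP.isPair_zero.fromBlocks hE.isPair_zero).proj hu hu'
  simpa using this

end StableProjections

section KZeroProduct

open Matrix PairClass
attribute [local instance] matrixCStarAlgebra

section PairClassMap

variable {R S : Type*} [CStarAlgebra R] [CStarAlgebra S]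

/-- Functoriality of the monoid of classes. -/
def PairClass.map (f : R →⋆ₐ[ℂ] S) : PairClass R → PairClass S :=
  Quotient.lift (fun a => cls (a.isPair.mapMatrix f)) fun _ _ h =>
    (cls_eq_iff _ _).2 (PairIso.mapMatrix f h)

lemma PairClass.map_cls (f : R →⋆ₐ[ℂ] S) {ι : Type*} [Fintype ι] [DecidableEq ι]
    {p x : Matrix ι ι R} (h : IsPair p x) :
    PairClass.map f (cls h) = cls (h.mapMatrix f) :=
  ((cls_eq_iff (h.mapMatrix f) (h.exists_rep.choose.isPair.mapMatrix f)).2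
    (PairIso.mapMatrix f h.exists_rep.choose_spec)).symm

lemma PairClass.map_pcls (f : R →⋆ₐ[ℂ] S) {ι : Type*} [Fintype ι] [DecidableEq ι]
    {p : Matrix ι ι R} (h : IsStarProjection p) :
    PairClass.map f (pcls h) = pcls (h.mapMatrix f) := by
  rw [PairClass.map_cls, cls_eq_iff]
  simpa using PairIso.refl (h.mapMatrix f).isPair_zero

lemma PairClass.map_add (f : R →⋆ₐ[ℂ] S) (a b : PairClass R) :
    PairClass.map f (a + b) = PairClass.map f a + PairClass.map f b := by
  induction a using PairClass.ind with
  | _ m p x h =>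
  induction b using PairClass.ind with
  | _ n q y h' =>
  rw [← cls_fromBlocks, map_cls, map_cls, map_cls, ← cls_fromBlocks, cls_eq_iff]
  have := PairIso.refl ((h.fromBlocks h').mapMatrix f)
  simpa [fromBlocks_map] using this

lemma pcls_congr {ι : Type*} [Fintype ι] [DecidableEq ι] {p q : Matrix ι ι R}
    (hp : IsStarProjection p) (h : p = q) : pcls hp = pcls (h ▸ hp) := by
  subst h; rfl

end PairClassMap

lemma K0Good.map {B C : Type*} [NonUnitalCStarAlgebra B] [NonUnitalCStarAlgebra C]
    (ψ : B →⋆ₙₐ[ℂ] C) {x : K0Rep B} (hx : K0Good x) : K0Good (K0RepMap ψ x) := by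
  have hp := hx.p.mapMatrix (Unitization.starMap ψ)
  have hq := hx.q.mapMatrix (Unitization.starMap ψ)
  refine ⟨⟨hp.2, hp.1⟩, ⟨hq.2, hq.1⟩, fun i j => ?_⟩
  exact ((starMap_apply ψ _).1.trans (hx.2.2 i j)).trans (starMap_apply ψ _).1.symm

/-- The image of a cycle. -/
def K0Cycle.map {B C : Type*} [NonUnitalCStarAlgebra B] [NonUnitalCStarAlgebra C]
    (ψ : B →⋆ₙₐ[ℂ] C) (x : {z : K0Rep B // K0Good z}) : {z : K0Rep C // K0Good z} :=
  ⟨K0RepMap ψ x.1, x.2.map ψ⟩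

lemma K0Cycle.pcls_map {B C : Type*} [NonUnitalCStarAlgebra B] [NonUnitalCStarAlgebra C]
    (ψ : B →⋆ₙₐ[ℂ] C) (x : {z : K0Rep B // K0Good z}) :
    pcls (K0Cycle.map ψ x).2.p = PairClass.map (Unitization.starMap ψ) (pcls x.2.p) ∧
      pcls (K0Cycle.map ψ x).2.q = PairClass.map (Unitization.starMap ψ) (pcls x.2.q) :=
  ⟨(PairClass.map_pcls _ _).symm, (PairClass.map_pcls _ _).symm⟩

lemma K0Eqv.map {B C : Type*} [NonUnitalCStarAlgebra B] [NonUnitalCStarAlgebra C]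
    (ψ : B →⋆ₙₐ[ℂ] C) {x y : {z : K0Rep B // K0Good z}} (h : K0Eqv x y) :
    K0Eqv (K0Cycle.map ψ x) (K0Cycle.map ψ y) := by
  obtain ⟨a, h⟩ := h
  refine ⟨PairClass.map (Unitization.starMap ψ) a, ?_⟩
  rw [(K0Cycle.pcls_map ψ x).1, (K0Cycle.pcls_map ψ x).2, (K0Cycle.pcls_map ψ y).1,
    (K0Cycle.pcls_map ψ y).2, ← PairClass.map_add, ← PairClass.map_add, h, PairClass.map_add,
    PairClass.map_add]

/-- Functoriality of `K₀`. -/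
def K0.map {B C : Type*} [NonUnitalCStarAlgebra B] [NonUnitalCStarAlgebra C]
    (ψ : B →⋆ₙₐ[ℂ] C) : K0 B → K0 C :=
  Quot.lift (fun x => Quot.mk _ (K0Cycle.map ψ x)) fun _ _ h => Quot.sound (h.eqv.map ψ).rel

lemma pcls_of_eq_K0RepAdd {B : Type*} [NonUnitalCStarAlgebra B]
    {x y z : {w : K0Rep B // K0Good w}} (h : z.1 = K0RepAdd x.1 y.1) :
    pcls z.2.p = pcls x.2.p + pcls y.2.p ∧ pcls z.2.q = pcls x.2.q + pcls y.2.q := by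
  obtain ⟨z, hz⟩ := z
  subst h
  obtain ⟨h1, h2⟩ := x.2.p.isPair_zero.emb_add_emb y.2.p.isPair_zero le_rfl
  obtain ⟨h3, h4⟩ := x.2.q.isPair_zero.emb_add_emb y.2.q.isPair_zero le_rfl
  rw [← h2, ← h4, cls_eq_iff, cls_eq_iff]
  rw [emb_zero, emb_zero, add_zero] at h1 h3
  simp only [emb_zero, add_zero]
  exact ⟨PairIso.refl h1, PairIso.refl h3⟩

lemma K0Eqv.add {B : Type*} [NonUnitalCStarAlgebra B]
    {x x' y y' z w : {w : K0Rep B // K0Good w}} (hz : z.1 = K0RepAdd x.1 x'.1)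
    (hw : w.1 = K0RepAdd y.1 y'.1) (h : K0Eqv x y) (h' : K0Eqv x' y') : K0Eqv z w := by
  obtain ⟨a, h⟩ := h
  obtain ⟨b, h'⟩ := h'
  refine ⟨a + b, ?_⟩
  obtain ⟨h1, h2⟩ := pcls_of_eq_K0RepAdd hz
  obtain ⟨h3, h4⟩ := pcls_of_eq_K0RepAdd hw
  rw [h1, h2, h3, h4]
  calc _ = (pcls x.2.p + pcls y.2.q + a) + (pcls x'.2.p + pcls y'.2.q + b) := by abel
    _ = _ := by rw [h, h']; abel

lemma emb_map {B C : Type*} [NonUnitalCStarAlgebra B] [NonUnitalCStarAlgebra C]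
    (ψ : B →⋆ₙₐ[ℂ] C) {m M : ℕ} (o : ℕ) (p : Matrix (Fin m) (Fin m) (Unitization ℂ B)) :
    (emb o p : Matrix (Fin M) (Fin M) _).map (Unitization.starMap ψ) =
      emb o (p.map (Unitization.starMap ψ)) := by
  ext1 a b
  simp only [emb, Matrix.map_apply]
  split_ifs
  · rfl
  · exact map_zero _

lemma K0RepMap_add {B C : Type*} [NonUnitalCStarAlgebra B] [NonUnitalCStarAlgebra C]
    (ψ : B →⋆ₙₐ[ℂ] C) (x y : K0Rep B) :
    K0RepMap ψ (K0RepAdd x y) = K0RepAdd (K0RepMap ψ x) (K0RepMap ψ y) := by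
  simp only [K0RepMap, K0RepAdd, ← emb_map,
    Matrix.map_add _ (_root_.map_add (Unitization.starMap ψ))]
  rfl

section Lift

variable {I : Type*} {B : I → Type*} [∀ i, NonUnitalCStarAlgebra (B i)]
  {ι : Type*} [Fintype ι] [DecidableEq ι]

lemma coord_mul (i : I) (M N : Matrix ι ι (Unitization ℂ (lp B ∞))) :
    coord i (M * N) = coord i M * coord i N := map_mul_starAlgHom _ _ _

lemma coord_conjTranspose (i : I) (M : Matrix ι ι (Unitization ℂ (lp B ∞))) :
    coord i Mᴴ = (coord i M)ᴴ := map_conjTranspose_starAlgHom _ _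

/-- A family of projections lifts to a projection over the product. -/
lemma exists_coord_isStarProjection {p : ∀ i, Matrix ι ι (Unitization ℂ (B i))}
    (hp : ∀ i, IsStarProjection (p i)) (h0 : ∀ i, fstM (p i) = 0) :
    ∃ P : Matrix ι ι (Unitization ℂ (lp B ∞)), IsStarProjection P ∧ fstM P = 0 ∧
      ∀ i, coord i P = p i := by
  obtain ⟨P, hP0, hP⟩ := exists_coord p h0 1 fun i => (hp i).norm_le
  refine ⟨P, ⟨coord_ext ?_ fun i => ?_, coord_ext ?_ fun i => ?_⟩, hP0, hP⟩
  · rw [fstM_mul, hP0, Matrix.zero_mul]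
  · rw [coord_mul, hP, (hp i).mul_self]
  · rw [fstM_star, hP0, conjTranspose_zero]
  · rw [star_eq_conjTranspose, coord_conjTranspose, hP, (hp i).conjTranspose_eq]

/-- Coordinatewise equality of classes of pairs with vanishing scalar part lifts. -/
lemma cls_eq_of_coord {p x q y : Matrix ι ι (Unitization ℂ (lp B ∞))} (h : IsPair p x)
    (h' : IsPair q y) (hp0 : fstM p = 0) (hq0 : fstM q = 0)
    (H : ∀ i, PairIso (coord i p) (coord i x) (coord i q) (coord i y)) : cls h = cls h' := by
  choose w hw hw' hwp hwx using H
  have hp : ∀ i, IsStarProjection (coord i p) := fun i => h.proj.mapMatrix _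
  have hw0 : ∀ i, fstM (w i) = 0 := fun i =>
    fst_eq_zero_of_star_mul_self (hw i) ((fstM_starMap _ p).trans hp0)
  obtain ⟨W, hW0, hW⟩ := exists_coord w hw0 1 fun i =>
    norm_le_one_of_star_mul_self_isStarProjection (hp i) (hw i)
  have hx0 : fstM x = 0 := by rw [← h.left, fstM_mul, hp0, Matrix.zero_mul]
  have hy0 : fstM y = 0 := by rw [← h'.left, fstM_mul, hq0, Matrix.zero_mul]
  refine (cls_eq_iff _ _).2 ⟨W, coord_ext ?_ fun i => ?_, coord_ext ?_ fun i => ?_,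
    coord_ext ?_ fun i => ?_, coord_ext ?_ fun i => ?_⟩
  all_goals simp only [fstM_mul, fstM_conjTranspose, hW0, hp0, hq0, hx0, hy0, Matrix.zero_mul,
    Matrix.mul_zero, coord_mul, coord_conjTranspose, hW, hw, hw', hwp, hwx]

end Lift

variable {I : Type*} {B : I → Type*} [∀ i, NonUnitalCStarAlgebra (B i)]

lemma coord_fromBlocks {ι κ : Type*} (i : I) (a : Matrix ι ι (Unitization ℂ (lp B ∞)))
    (b : Matrix κ κ (Unitization ℂ (lp B ∞))) :
    coord i (fromBlocks a 0 0 b) = fromBlocks (coord i a) 0 0 (coord i b) := by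
  simp [coord, fromBlocks_map]

lemma K0Eqv.of_coord (hB : ∀ i, StableLike (B i)) {x y : {z : K0Rep (lp B ∞) // K0Good z}}
    (H : ∀ i, K0Eqv (K0Cycle.map (lpProj B i) x) (K0Cycle.map (lpProj B i) y)) : K0Eqv x y := by
  have hS := StableLike.lp hB
  have fst_eq : ∀ z : {z : K0Rep (lp B ∞) // K0Good z}, fstM z.1.p = fstM z.1.q := fun z =>
    Matrix.ext z.2.2.2
  obtain ⟨p, q, hp, hq, hp0, hq0, h1⟩ := hS.exists_projection x.2.p x.2.q (fst_eq x)
  obtain ⟨p', q', hp', hq', hp0', hq0', h2⟩ := hS.exists_projection y.2.p y.2.q (fst_eq y)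
  set P := fromBlocks p 0 0 q' with hPdef
  set Q := fromBlocks p' 0 0 q with hQdef
  have hP : IsStarProjection P := (hp.isPair_zero.fromBlocks hq'.isPair_zero).proj
  have hQ : IsStarProjection Q := (hp'.isPair_zero.fromBlocks hq.isPair_zero).proj
  have hP0 : fstM P = 0 := by rw [hPdef, fstM_fromBlocks, hp0, hq0']; simp
  have hQ0 : fstM Q = 0 := by rw [hQdef, fstM_fromBlocks, hp0', hq0]; simp
  have hPc : pcls hP = pcls hp + pcls hq' := by
    rw [← cls_fromBlocks, cls_eq_iff]; simpa using PairIso.refl hP.isPair_zero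
  have hQc : pcls hQ = pcls hp' + pcls hq := by
    rw [← cls_fromBlocks, cls_eq_iff]; simpa using PairIso.refl hQ.isPair_zero
  have key : ∀ i, ∃ (g : Matrix (Fin 1) (Fin 1) (Unitization ℂ (B i))) (hg : IsStarProjection g),
      fstM g = 0 ∧ PairIso (fromBlocks (coord i P) 0 0 g) 0 (fromBlocks (coord i Q) 0 0 g) 0 := by
    intro i
    set f := Unitization.starMap (lpProj B i)
    obtain ⟨a, ha⟩ := H i
    rw [(K0Cycle.pcls_map _ x).1, (K0Cycle.pcls_map _ x).2, (K0Cycle.pcls_map _ y).1,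
      (K0Cycle.pcls_map _ y).2] at ha
    have h1' := congrArg (PairClass.map f) h1
    have h2' := congrArg (PairClass.map f) h2
    simp only [PairClass.map_add] at h1' h2'
    have hPQ : pcls (hP.mapMatrix f) +
          (PairClass.map f (pcls x.2.q) + PairClass.map f (pcls y.2.p) + a) =
        pcls (hQ.mapMatrix f) +
          (PairClass.map f (pcls x.2.q) + PairClass.map f (pcls y.2.p) + a) := by
      rw [← PairClass.map_pcls f hP, ← PairClass.map_pcls f hQ, hPc, hQc, PairClass.map_add,
        PairClass.map_add]
      calc _ = (PairClass.map f (pcls x.2.q) + PairClass.map f (pcls hp)) +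
            (PairClass.map f (pcls y.2.p) + PairClass.map f (pcls hq')) + a := by abel
        _ = (PairClass.map f (pcls x.2.p) + PairClass.map f (pcls y.2.q) + a) +
            PairClass.map f (pcls hq) + PairClass.map f (pcls hp') := by rw [← h1', h2']; abel
        _ = _ := by rw [ha]; abel
    obtain ⟨g, hg, hg0, h⟩ := (hB i).exists_complement (hP.mapMatrix f) (hQ.mapMatrix f)
      ((fstM_starMap _ P).trans hP0) ((fstM_starMap _ Q).trans hQ0) hPQ
    rw [← cls_fromBlocks, ← cls_fromBlocks, cls_eq_iff] at h
    rw [fromBlocks_zero] at h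
    exact ⟨g, hg, hg0, h⟩
  choose g hg hg0 hiso using key
  obtain ⟨G, hG, hG0, hGi⟩ := exists_coord_isStarProjection hg hg0
  have hPG := (hP.isPair_zero.fromBlocks hG.isPair_zero).proj.isPair_zero
  have hQG := (hQ.isPair_zero.fromBlocks hG.isPair_zero).proj.isPair_zero
  have hfin : cls hPG = cls hQG := by
    refine cls_eq_of_coord _ _ (by simp [hP0, hG0]) (by simp [hQ0, hG0]) fun i => ?_
    have h1 : coord i (fromBlocks P 0 0 G) = fromBlocks (coord i P) 0 0 (g i) := by
      rw [← hGi, ← coord_fromBlocks]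
    have h2 : coord i (fromBlocks Q 0 0 G) = fromBlocks (coord i Q) 0 0 (g i) := by
      rw [← hGi, ← coord_fromBlocks]
    have h0 : coord i (0 : Matrix ((Fin 1 ⊕ Fin 1) ⊕ Fin 1) ((Fin 1 ⊕ Fin 1) ⊕ Fin 1)
        (Unitization ℂ (lp B ∞))) = 0 :=
      Matrix.map_zero _ (map_zero _)
    rw [h0, h1, h2]
    exact hiso i
  have hfin' : pcls hP + pcls hG = pcls hQ + pcls hG := by
    rw [← cls_fromBlocks, ← cls_fromBlocks, cls_eq_iff]
    simpa using (cls_eq_iff _ _).1 hfin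
  rw [hPc, hQc] at hfin'
  refine ⟨pcls hq + pcls hp' + pcls hG, ?_⟩
  calc _ = (pcls x.2.p + pcls hq) + (pcls y.2.q + pcls hp') + pcls hG := by abel
    _ = (pcls x.2.q + pcls y.2.p) + (pcls hp + pcls hq' + pcls hG) := by rw [h1, ← h2]; abel
    _ = _ := by rw [hfin']; abel

lemma K0Cycle.exists_coord (hB : ∀ i, StableLike (B i)) (y : ∀ i, {z : K0Rep (B i) // K0Good z}) :
    ∃ x : {z : K0Rep (lp B ∞) // K0Good z}, ∀ i, K0Eqv (K0Cycle.map (lpProj B i) x) (y i) := by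
  choose p q hp hq hp0 hq0 h using fun i =>
    (hB i).exists_projection (y i).2.p (y i).2.q (Matrix.ext (y i).2.2.2)
  obtain ⟨P, hP, hP0, hPi⟩ := exists_coord_isStarProjection hp hp0
  obtain ⟨Q, hQ, hQ0, hQi⟩ := exists_coord_isStarProjection hq hq0
  refine ⟨⟨⟨1, P, Q⟩, ⟨hP.2, hP.1⟩, ⟨hQ.2, hQ.1⟩, fun a b =>
    congrFun (congrFun (hP0.trans hQ0.symm) a) b⟩, fun i => ⟨0, ?_⟩⟩
  have e1 := pcls_congr (hP.mapMatrix (Unitization.starMap (lpProj B i))) (hPi i)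
  have e2 := pcls_congr (hQ.mapMatrix (Unitization.starMap (lpProj B i))) (hQi i)
  have := h i
  rw [add_zero, add_zero]
  calc _ = pcls (hp i) + pcls (y i).2.q := congrArg (· + pcls (y i).2.q) e1
    _ = pcls (y i).2.p + pcls (hq i) := by rw [h i, add_comm]
    _ = _ := congrArg (pcls (y i).2.p + ·) e2.symm

theorem K0.map_lpProj_bijective (hB : ∀ i, StableLike (B i)) :
    Function.Bijective fun (X : K0 (lp B ∞)) (i : I) => K0.map (lpProj B i) X := by
  constructor
  · intro X Y
    induction X using Quot.ind with
    | _ x =>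
    induction Y using Quot.ind with
    | _ y =>
    intro h
    exact K0.mk_eq_iff.2 (K0Eqv.of_coord hB fun i => K0.mk_eq_iff.1 (congrFun h i))
  · intro Y
    choose y hy using fun i => Quot.exists_rep (Y i)
    obtain ⟨x, hx⟩ := K0Cycle.exists_coord hB y
    exact ⟨Quot.mk _ x, funext fun i => (K0.mk_eq_iff.2 (hx i)).trans (hy i)⟩

theorem K0.exists_equiv_pi (hB : ∀ i, StableLike (B i)) :
    ∃ e : K0 (lp B ∞) ≃ (∀ i, K0 (B i)),
      (∀ (x : {z : K0Rep (lp B ∞) // K0Good z})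
         (y : ∀ i, {z : K0Rep (B i) // K0Good z}),
        (∀ i, (y i).1 = K0RepMap (lpProj B i) x.1) →
        e (Quot.mk _ x) = fun i => Quot.mk _ (y i)) ∧
      ∀ (x x' z : {w : K0Rep (lp B ∞) // K0Good w})
        (y y' w : ∀ i, {v : K0Rep (B i) // K0Good v}),
        z.1 = K0RepAdd x.1 x'.1 →
        (∀ i, (w i).1 = K0RepAdd (y i).1 (y' i).1) →
        e (Quot.mk _ x) = (fun i => Quot.mk _ (y i)) →
        e (Quot.mk _ x') = (fun i => Quot.mk _ (y' i)) →
        e (Quot.mk _ z) = fun i => Quot.mk _ (w i) := by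
  refine ⟨Equiv.ofBijective _ (K0.map_lpProj_bijective hB), fun x y h => ?_,
    fun x x' z y y' w hz hw hx hx' => ?_⟩
  · exact funext fun i => congrArg (Quot.mk _) (Subtype.ext (h i).symm)
  · refine funext fun i => K0.mk_eq_iff.2 (K0Eqv.add ?_ (hw i) (K0.mk_eq_iff.1 (congrFun hx i))
      (K0.mk_eq_iff.1 (congrFun hx' i)))
    exact (congrArg (K0RepMap (lpProj B i)) hz).trans (K0RepMap_add _ _ _)

end KZeroProduct

section UnitaryPaths

open Matrix
attribute [local instance] matrixCStarAlgebra

variable {C : Type*} [NonUnitalCStarAlgebra C] {ι κ μ ν : Type*} [Fintype ι] [DecidableEq ι]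
  [Fintype κ] [DecidableEq κ] [Fintype μ] [DecidableEq μ] [Fintype ν] [DecidableEq ν]

/-- Unitary matrices over the unitization with scalar part the identity. -/
def uSet (C : Type*) [NonUnitalCStarAlgebra C] (ι : Type*) [Fintype ι] [DecidableEq ι] :
    Set (Matrix ι ι (Unitization ℂ C)) :=
  {u | u ∈ unitary (Matrix ι ι (Unitization ℂ C)) ∧ fstM u = 1}

lemma mem_uSet_iff {u : Matrix ι ι (Unitization ℂ C)} :
    u ∈ uSet C ι ↔ uᴴ * u = 1 ∧ u * uᴴ = 1 ∧ fstM u = 1 := by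
  rw [uSet, Set.mem_ofPred_eq, Unitary.mem_iff, and_assoc]; rfl

lemma one_mem_uSet : (1 : Matrix ι ι (Unitization ℂ C)) ∈ uSet C ι := ⟨one_mem _, by simp⟩

lemma mul_mem_uSet {u v : Matrix ι ι (Unitization ℂ C)} (hu : u ∈ uSet C ι) (hv : v ∈ uSet C ι) :
    u * v ∈ uSet C ι := ⟨mul_mem hu.1 hv.1, by rw [fstM_mul, hu.2, hv.2, Matrix.one_mul]⟩

lemma conjTranspose_mem_uSet {u : Matrix ι ι (Unitization ℂ C)} (hu : u ∈ uSet C ι) :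
    uᴴ ∈ uSet C ι := ⟨Unitary.star_mem hu.1, by rw [fstM_conjTranspose, hu.2, conjTranspose_one]⟩

lemma fromBlocks_mem_uSet {u : Matrix ι ι (Unitization ℂ C)} {v : Matrix κ κ (Unitization ℂ C)}
    (hu : u ∈ uSet C ι) (hv : v ∈ uSet C κ) : fromBlocks u 0 0 v ∈ uSet C (ι ⊕ κ) := by
  rw [mem_uSet_iff] at *
  simp [fromBlocks_conjTranspose, fromBlocks_multiply, hu, hv]

lemma fromBlocks_sub_one (u : Matrix ι ι (Unitization ℂ C)) (v : Matrix κ κ (Unitization ℂ C)) :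
    fromBlocks u 0 0 v - 1 = fromBlocks (u - 1) 0 0 (v - 1) := by
  ext1 (i | i) (j | j) <;> simp [Matrix.one_apply]

lemma one_add_fromBlocks (u : Matrix ι ι (Unitization ℂ C)) (v : Matrix κ κ (Unitization ℂ C)) :
    1 + fromBlocks u 0 0 v = fromBlocks (1 + u) 0 0 (1 + v) := by
  ext1 (i | i) (j | j) <;> simp [Matrix.one_apply]

/-- Transport of a unitary along an isometry, completed by the identity. -/
def adU (w : Matrix κ ι (Unitization ℂ C)) (u : Matrix ι ι (Unitization ℂ C)) :
    Matrix κ κ (Unitization ℂ C) := 1 + w * (u - 1) * wᴴ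

lemma adU_adU (v : Matrix μ κ (Unitization ℂ C)) (w : Matrix κ ι (Unitization ℂ C))
    (u : Matrix ι ι (Unitization ℂ C)) : adU v (adU w u) = adU (v * w) u := by
  simp only [adU, add_sub_cancel_left, conjTranspose_mul, Matrix.mul_assoc]

lemma isometry_mul_sub_one {w : Matrix κ ι (Unitization ℂ C)} (hw : wᴴ * w = 1)
    (u : Matrix ι ι (Unitization ℂ C)) : wᴴ * w * (u - 1) = u - 1 := by rw [hw, Matrix.one_mul]

lemma adU_inl (u : Matrix ι ι (Unitization ℂ C)) :
    adU (incl _ (Sum.inl : ι → ι ⊕ κ)) u = fromBlocks u 0 0 1 := by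
  have : incl (Unitization ℂ C) (Sum.inl : ι → ι ⊕ κ) = fromRows 1 0 := by
    ext (i | i) j <;> simp [incl_apply, Matrix.one_apply]
  rw [adU, this, conjTranspose_fromRows_eq_fromCols_conjTranspose, fromRows_mul,
    fromRows_mul_fromCols]
  simp [one_add_fromBlocks]

lemma adU_inr (u : Matrix ι ι (Unitization ℂ C)) :
    adU (incl _ (Sum.inr : ι → κ ⊕ ι)) u = fromBlocks 1 0 0 u := by
  have : incl (Unitization ℂ C) (Sum.inr : ι → κ ⊕ ι) = fromRows 0 1 := by
    ext (i | i) j <;> simp [incl_apply, Matrix.one_apply]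
  rw [adU, this, conjTranspose_fromRows_eq_fromCols_conjTranspose, fromRows_mul,
    fromRows_mul_fromCols]
  simp [one_add_fromBlocks]

lemma adU_mem_uSet {w : Matrix κ ι (Unitization ℂ C)} {u : Matrix ι ι (Unitization ℂ C)}
    (hu : u ∈ uSet C ι) (hw : wᴴ * w * (u - 1) = u - 1) : adU w u ∈ uSet C κ := by
  rw [mem_uSet_iff] at *
  obtain ⟨h1, h2, h3⟩ := hu
  have e : (u - 1)ᴴ = -((u - 1) * uᴴ) := by
    rw [Matrix.sub_mul, h2, conjTranspose_sub, conjTranspose_one]; simp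
  have hw' : wᴴ * w * (u - 1)ᴴ = (u - 1)ᴴ := by
    rw [e, Matrix.mul_neg, ← Matrix.mul_assoc, hw]
  have e1 : (u - 1)ᴴ * (u - 1) + ((u - 1)ᴴ + (u - 1)) = 0 := by
    rw [conjTranspose_sub, conjTranspose_one, Matrix.sub_mul, Matrix.mul_sub, h1]; simp
  have e2 : (u - 1) * (u - 1)ᴴ + ((u - 1) + (u - 1)ᴴ) = 0 := by
    rw [conjTranspose_sub, conjTranspose_one, Matrix.sub_mul, Matrix.mul_sub, h2]; simp
  have h0 : fstM (u - 1) = 0 := by rw [fstM_sub, h3, fstM_one, sub_self]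
  unfold adU
  generalize u - 1 = D at *
  have hA : ∀ {X Y : Matrix ι ι (Unitization ℂ C)}, wᴴ * w * Y = Y →
      (1 + w * X * wᴴ) * (1 + w * Y * wᴴ) = 1 + w * (X * Y + (X + Y)) * wᴴ := by
    intro X Y hY
    have : w * X * wᴴ * (w * Y * wᴴ) = w * (X * (wᴴ * w * Y)) * wᴴ := by
      simp only [Matrix.mul_assoc]
    rw [Matrix.add_mul, Matrix.mul_add, Matrix.mul_add, this, hY]
    simp only [Matrix.one_mul, Matrix.mul_one, Matrix.mul_add, Matrix.add_mul]
    abel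
  have hs : (1 + w * D * wᴴ)ᴴ = 1 + w * Dᴴ * wᴴ := by
    simp only [conjTranspose_add, conjTranspose_one, conjTranspose_mul, conjTranspose_conjTranspose,
      Matrix.mul_assoc]
  rw [hs, hA hw, hA hw', e1, e2]
  simp [h0]

lemma continuous_adU {X : Type*} [TopologicalSpace X] {w : X → Matrix κ ι (Unitization ℂ C)}
    {u : X → Matrix ι ι (Unitization ℂ C)} (hw : Continuous w) (hu : Continuous u) :
    Continuous fun t => adU (w t) (u t) :=
  continuous_const.add ((hw.matrix_mul (hu.sub continuous_const)).matrix_mul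
    hw.matrix_conjTranspose)

lemma joinedIn_adU {u : Matrix ι ι (Unitization ℂ C)} (hu : u ∈ uSet C ι)
    {w z : Matrix κ ι (Unitization ℂ C)} (hw : wᴴ * w * (u - 1) = u - 1)
    (hz : zᴴ * z * (u - 1) = u - 1) (hwz : wᴴ * z = 0) :
    JoinedIn (uSet C κ) (adU w u) (adU z u) := by
  have hzw : zᴴ * w = 0 := by simpa using congrArg conjTranspose hwz
  set V : ℝ → Matrix κ ι (Unitization ℂ C) := fun t =>
    ((Real.cos (Real.pi / 2 * t) : ℝ) : ℂ) • w + ((Real.sin (Real.pi / 2 * t) : ℝ) : ℂ) • z with hV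
  have hVc : Continuous V := by fun_prop
  refine joinedIn_iff_exists_real_path.2 ⟨fun t => adU (V t) u,
    continuous_adU hVc continuous_const, fun t _ => adU_mem_uSet hu ?_, ?_, ?_⟩
  · simp only [hV, conjTranspose_add, conjTranspose_smul, Matrix.add_mul, Matrix.mul_add,
      Matrix.smul_mul, Matrix.mul_smul, hw, hz, hwz, hzw, smul_zero, add_zero, zero_add,
      smul_smul, ← add_smul]
    have : ((Real.cos (Real.pi / 2 * t) : ℝ) : ℂ) * star ((Real.cos (Real.pi / 2 * t) : ℝ) : ℂ) +
        ((Real.sin (Real.pi / 2 * t) : ℝ) : ℂ) * star ((Real.sin (Real.pi / 2 * t) : ℝ) : ℂ)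
          = 1 := by
      simp only [Complex.star_def, Complex.conj_ofReal]
      norm_cast
      nlinarith [Real.sin_sq_add_cos_sq (Real.pi / 2 * t)]
    rw [this, one_smul]
  · simp [hV]
  · simp [hV]

lemma JoinedIn.adU {u v : Matrix ι ι (Unitization ℂ C)} (h : JoinedIn (uSet C ι) u v)
    {w : Matrix κ ι (Unitization ℂ C)} (hw : wᴴ * w = 1) :
    JoinedIn (uSet C κ) (adU w u) (_root_.adU w v) := by
  refine (h.map (continuous_adU continuous_const continuous_id)).mono ?_
  rintro _ ⟨x, hx, rfl⟩
  exact adU_mem_uSet hx (isometry_mul_sub_one hw x)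

lemma joinedIn_mul_right {u v x : Matrix ι ι (Unitization ℂ C)} (h : JoinedIn (uSet C ι) u v)
    (hx : x ∈ uSet C ι) : JoinedIn (uSet C ι) (u * x) (v * x) := by
  refine (h.map (f := fun y => y * x) (continuous_id.matrix_mul continuous_const)).mono ?_
  rintro _ ⟨y, hy, rfl⟩
  exact mul_mem_uSet hy hx

/-- Unitaries which become homotopic after stabilization. -/
def UEqv (u : Matrix ι ι (Unitization ℂ C)) (v : Matrix κ κ (Unitization ℂ C)) : Prop :=
  u ∈ uSet C ι ∧ v ∈ uSet C κ ∧ ∃ (N : ℕ) (f : ι → Fin N) (g : κ → Fin N),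
    Function.Injective f ∧ Function.Injective g ∧
      JoinedIn (uSet C (Fin N)) (adU (incl _ f) u) (adU (incl _ g) v)

namespace UEqv

variable {u : Matrix ι ι (Unitization ℂ C)} {v : Matrix κ κ (Unitization ℂ C)}
  {x : Matrix μ μ (Unitization ℂ C)} {y : Matrix ν ν (Unitization ℂ C)}

lemma symm (h : UEqv u v) : UEqv v u := by
  obtain ⟨hu, hv, N, f, g, hf, hg, h⟩ := h
  exact ⟨hv, hu, N, g, f, hg, hf, h.symm⟩

lemma of_incl (hu : u ∈ uSet C ι) (hv : v ∈ uSet C κ) {f : ι → μ} {g : κ → μ}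
    (hf : Function.Injective f) (hg : Function.Injective g)
    (h : JoinedIn (uSet C μ) (adU (incl _ f) u) (adU (incl _ g) v)) : UEqv u v := by
  refine ⟨hu, hv, _, Fintype.equivFin μ ∘ f, Fintype.equivFin μ ∘ g,
    (Fintype.equivFin μ).injective.comp hf, (Fintype.equivFin μ).injective.comp hg, ?_⟩
  rw [← incl_mul_incl, ← incl_mul_incl, ← adU_adU, ← adU_adU]
  exact h.adU (conjTranspose_incl_mul_incl (Fintype.equivFin μ).injective)

lemma trans (h : UEqv u v) (h' : UEqv v x) : UEqv u x := by
  obtain ⟨hu, hv, N, f, g, hf, hg, h⟩ := h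
  obtain ⟨-, hx, M, f', g', hf', hg', h'⟩ := h'
  have hl := Sum.inl_injective (α := Fin N) (β := Fin M)
  have hr := Sum.inr_injective (α := Fin N) (β := Fin M)
  have h1 := h.adU (conjTranspose_incl_mul_incl (R := Unitization ℂ C) hl)
  have h2 := h'.adU (conjTranspose_incl_mul_incl (R := Unitization ℂ C) hr)
  rw [adU_adU, adU_adU, incl_mul_incl, incl_mul_incl] at h1 h2
  have e1 := conjTranspose_incl_mul_incl (R := Unitization ℂ C) (hl.comp hg)
  have e2 := conjTranspose_incl_mul_incl (R := Unitization ℂ C) (hr.comp hf')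
  have e3 : (incl (Unitization ℂ C) (Sum.inl ∘ g : κ → Fin N ⊕ Fin M))ᴴ *
      incl (Unitization ℂ C) (Sum.inr ∘ f' : κ → Fin N ⊕ Fin M) = 0 :=
    conjTranspose_incl_mul_incl_eq_zero fun i j => Sum.inl_ne_inr
  have h3 := joinedIn_adU hv (isometry_mul_sub_one e1 v) (isometry_mul_sub_one e2 v) e3
  exact of_incl hu hx (hl.comp hf) (hr.comp hg') ((h1.trans h3).trans h2)

lemma of_joinedIn {v : Matrix ι ι (Unitization ℂ C)} (h : JoinedIn (uSet C ι) u v) :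
    UEqv u v :=
  of_incl h.source_mem h.target_mem Function.injective_id Function.injective_id
    (h.adU (conjTranspose_incl_mul_incl Function.injective_id))

lemma refl (hu : u ∈ uSet C ι) : UEqv u u := of_joinedIn (JoinedIn.refl hu)

lemma ad (hu : u ∈ uSet C ι) {w : Matrix κ ι (Unitization ℂ C)} (hw : wᴴ * w * (u - 1) = u - 1) :
    UEqv u (adU w u) := by
  have hl := conjTranspose_incl_mul_incl (R := Unitization ℂ C)
    (Sum.inl_injective (α := ι) (β := κ))
  have hr := conjTranspose_incl_mul_incl (R := Unitization ℂ C)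
    (Sum.inr_injective (α := ι) (β := κ))
  refine of_incl hu (adU_mem_uSet hu hw) Sum.inl_injective Sum.inr_injective ?_
  rw [adU_adU]
  refine joinedIn_adU hu (isometry_mul_sub_one hl u) ?_ ?_
  · rw [conjTranspose_mul, Matrix.mul_assoc wᴴ, ← Matrix.mul_assoc (incl _ _)ᴴ, hr, Matrix.one_mul,
      hw]
  · rw [← Matrix.mul_assoc, conjTranspose_incl_mul_incl_eq_zero fun i j => Sum.inl_ne_inr,
      Matrix.zero_mul]

lemma of_adU_eq (hu : u ∈ uSet C ι) {w : Matrix κ ι (Unitization ℂ C)}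
    (hw : wᴴ * w * (u - 1) = u - 1) (h : adU w u = v) : UEqv u v := h ▸ ad hu hw

lemma fromBlocks_incl (hu : u ∈ uSet C ι) (hx : x ∈ uSet C μ) {f : ι → κ}
    (hf : Function.Injective f) :
    UEqv (fromBlocks u 0 0 x) (fromBlocks (adU (incl _ f) u) 0 0 x) := by
  refine of_adU_eq (w := fromBlocks (incl _ f) 0 0 1) (fromBlocks_mem_uSet hu hx)
    (isometry_mul_sub_one ?_ _) ?_
  · simp [fromBlocks_conjTranspose, fromBlocks_multiply, conjTranspose_incl_mul_incl hf]
  · rw [adU, fromBlocks_sub_one]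
    simp [fromBlocks_conjTranspose, fromBlocks_multiply, adU, one_add_fromBlocks]

lemma fromBlocks_left (h : UEqv u v) (hx : x ∈ uSet C μ) :
    UEqv (fromBlocks u 0 0 x) (fromBlocks v 0 0 x) := by
  obtain ⟨hu, hv, N, f, g, hf, hg, h⟩ := h
  refine ((fromBlocks_incl hu hx hf).trans (of_joinedIn ?_)).trans (fromBlocks_incl hv hx hg).symm
  refine (h.map (f := fun y => fromBlocks y 0 0 x) (continuous_id.matrix_fromBlocks
    continuous_const continuous_const continuous_const)).mono ?_
  rintro _ ⟨y, hy, rfl⟩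
  exact fromBlocks_mem_uSet hy hx

lemma fromBlocks_swap (hu : u ∈ uSet C ι) (hx : x ∈ uSet C μ) :
    UEqv (fromBlocks u 0 0 x) (fromBlocks x 0 0 u) := by
  refine of_adU_eq (w := fromBlocks 0 1 1 0) (fromBlocks_mem_uSet hu hx)
    (isometry_mul_sub_one ?_ _) ?_
  · simp [fromBlocks_conjTranspose, fromBlocks_multiply]
  · rw [adU, fromBlocks_sub_one]
    simp [fromBlocks_conjTranspose, fromBlocks_multiply, one_add_fromBlocks]

lemma fromBlocks (h : UEqv u v) (h' : UEqv x y) :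
    UEqv (fromBlocks u 0 0 x) (fromBlocks v 0 0 y) :=
  (((h.fromBlocks_left h'.1).trans (fromBlocks_swap h.2.1 h'.1)).trans
    (h'.fromBlocks_left h.2.1)).trans (fromBlocks_swap h'.2.1 h.2.1)

lemma fromBlocks_one (hu : u ∈ uSet C ι) :
    UEqv u (Matrix.fromBlocks u 0 0 (1 : Matrix μ μ (Unitization ℂ C))) := by
  have hl := conjTranspose_incl_mul_incl (R := Unitization ℂ C)
    (Sum.inl_injective (α := ι) (β := μ))
  exact of_adU_eq hu (isometry_mul_sub_one hl u) (adU_inl u)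

lemma fromBlocks_assoc (hu : u ∈ uSet C ι) (hv : v ∈ uSet C κ) (hx : x ∈ uSet C μ) :
    UEqv (Matrix.fromBlocks (Matrix.fromBlocks u 0 0 v) 0 0 x)
      (Matrix.fromBlocks u 0 0 (Matrix.fromBlocks v 0 0 x)) := by
  have hm := fromBlocks_mem_uSet (fromBlocks_mem_uSet hu hv) hx
  obtain ⟨f, hf⟩ : ∃ f : (ι ⊕ κ) ⊕ μ → ι ⊕ κ ⊕ μ, f = Equiv.sumAssoc ι κ μ := ⟨_, rfl⟩
  have hi : Function.Injective f := hf ▸ Equiv.injective _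
  have hs : Function.Surjective f := hf ▸ Equiv.surjective _
  have hw := conjTranspose_incl_mul_incl (R := Unitization ℂ C) hi
  refine of_adU_eq hm (isometry_mul_sub_one hw _) ?_
  ext1 i j
  obtain ⟨i, rfl⟩ := hs i
  obtain ⟨j, rfl⟩ := hs j
  rw [adU, Matrix.add_apply, incl_conj_apply hi]
  subst hf
  obtain (i | i) | i := i <;> obtain (j | j) | j := j <;> simp [Matrix.one_apply]

lemma fromBlocks_conjTranspose (hu : u ∈ uSet C ι) :
    UEqv (Matrix.fromBlocks u 0 0 uᴴ) (1 : Matrix ι ι (Unitization ℂ C)) := by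
  have hl := conjTranspose_incl_mul_incl (R := Unitization ℂ C)
    (Sum.inl_injective (α := ι) (β := ι))
  have hr := conjTranspose_incl_mul_incl (R := Unitization ℂ C)
    (Sum.inr_injective (α := ι) (β := ι))
  have hlr : (incl (Unitization ℂ C) (Sum.inl : ι → ι ⊕ ι))ᴴ *
      incl (Unitization ℂ C) (Sum.inr : ι → ι ⊕ ι) = 0 :=
    conjTranspose_incl_mul_incl_eq_zero fun i j => Sum.inl_ne_inr
  have h := joinedIn_mul_right (joinedIn_adU hu (isometry_mul_sub_one hl u)
    (isometry_mul_sub_one hr u) hlr)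
    (fromBlocks_mem_uSet (one_mem_uSet (ι := ι)) (conjTranspose_mem_uSet hu))
  rw [adU_inl, adU_inr] at h
  simp only [fromBlocks_multiply, (mem_uSet_iff.1 hu).2.1] at h
  have h2 := of_joinedIn h
  simp only [Matrix.one_mul, Matrix.mul_one, Matrix.zero_mul, Matrix.mul_zero, add_zero,
    zero_add] at h2
  exact h2.trans (fromBlocks_one one_mem_uSet).symm

lemma cancel (hu : u ∈ uSet C ι) (hv : v ∈ uSet C κ) (hx : x ∈ uSet C μ)
    (h : UEqv (Matrix.fromBlocks u 0 0 x) (Matrix.fromBlocks v 0 0 x)) : UEqv u v := by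
  have hx' := conjTranspose_mem_uSet hx
  have h0 := fromBlocks_conjTranspose hx
  have aux := (fromBlocks_assoc hu hx hx').trans ((refl hu).fromBlocks h0)
  have aux' := (fromBlocks_assoc hv hx hx').trans ((refl hv).fromBlocks h0)
  exact (((fromBlocks_one hu).trans aux.symm).trans (h.fromBlocks_left hx')).trans
    (aux'.trans (fromBlocks_one hv).symm)

end UEqv

end UnitaryPaths

section KOne

open Matrix
attribute [local instance] matrixCStarAlgebra

variable {B C : Type*} [NonUnitalCStarAlgebra B] [NonUnitalCStarAlgebra C]

lemma mem_uSet_iff_unitary {m : ℕ} {u : Matrix (Fin m) (Fin m) (Unitization ℂ B)} :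
    u ∈ uSet B (Fin m) ↔ u ∈ unitary (Matrix (Fin m) (Fin m) (Unitization ℂ B)) ∧
      ∀ i j, (u i j).fst = ((1 : Matrix (Fin m) (Fin m) (Unitization ℂ B)) i j).fst := by
  rw [uSet, Set.mem_ofPred_eq, ← fstM_one (C := B), ← Matrix.ext_iff]; rfl

lemma K1Good.mem_uSet {x : K1Rep B} (hx : K1Good x) : x.u ∈ uSet B (Fin x.m) :=
  mem_uSet_iff_unitary.2 hx

lemma embU_eq_adU {m M : ℕ} (h : 0 + m ≤ M) (u : Matrix (Fin m) (Fin m) (Unitization ℂ B)) :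
    embU u = adU (incl _ (offset 0 h)) u := by
  rw [adU, ← emb_eq_incl]
  ext1 i j
  simp only [embU, emb, Matrix.add_apply, Matrix.one_apply, Matrix.sub_apply, Fin.ext_iff]
  split_ifs <;> simp <;> omega

lemma K1Rel.ueqv {x y : {z : K1Rep B // K1Good z}} (h : K1Rel B x y) : UEqv x.1.u y.1.u := by
  obtain ⟨M, hx, hy, path, hc, hp, h0, h1⟩ := h
  rw [embU_eq_adU (by omega)] at h0 h1
  exact ⟨x.2.mem_uSet, y.2.mem_uSet, M, _, _, offset_injective _ _, offset_injective _ _,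
    joinedIn_iff_exists_real_path.2 ⟨path, hc, fun t ht => mem_uSet_iff_unitary.2 (hp t ht),
      h0, h1⟩⟩

lemma UEqv.rel {x y : {z : K1Rep B // K1Good z}} (h : UEqv x.1.u y.1.u) : K1Rel B x y := by
  obtain ⟨hx, hy, N, f, g, hf, hg, h⟩ := h
  have hx0 : 0 + x.1.m ≤ x.1.m + y.1.m + N := by omega
  have hy0 : 0 + y.1.m ≤ x.1.m + y.1.m + N := by omega
  have hN : (x.1.m + y.1.m) + N ≤ x.1.m + y.1.m + N := le_rfl
  have aux : ∀ {m : ℕ} (h0 : 0 + m ≤ x.1.m + y.1.m + N) {k : Fin m → Fin N}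
      {u : Matrix (Fin m) (Fin m) (Unitization ℂ B)}, m ≤ x.1.m + y.1.m →
      Function.Injective k → u ∈ uSet B (Fin m) →
      JoinedIn (uSet B (Fin (x.1.m + y.1.m + N))) (embU u)
        (adU (incl _ (offset _ hN)) (adU (incl _ k) u)) := by
    intro m h0 k u hm hk hu
    have hi := (offset_injective _ hN).comp hk
    rw [embU_eq_adU h0, adU_adU, incl_mul_incl]
    have e1 := conjTranspose_incl_mul_incl (R := Unitization ℂ B) (offset_injective _ h0)
    have e2 := conjTranspose_incl_mul_incl (R := Unitization ℂ B) hi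
    have e3 : (incl (Unitization ℂ B) (offset 0 h0))ᴴ *
        incl (Unitization ℂ B) (offset _ hN ∘ k) = 0 := by
      refine conjTranspose_incl_mul_incl_eq_zero fun i j hij => ?_
      have := congrArg Fin.val hij
      simp only [offset, Function.comp_apply] at this
      omega
    exact joinedIn_adU hu (isometry_mul_sub_one e1 u) (isometry_mul_sub_one e2 u) e3
  have h' := h.adU (conjTranspose_incl_mul_incl (R := Unitization ℂ B) (offset_injective _ hN))
  obtain ⟨path, hc, hp, h0, h1⟩ := joinedIn_iff_exists_real_path.1
    (((aux hx0 (by omega) hf hx).trans h').trans (aux hy0 (by omega) hg hy).symm)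
  exact ⟨_, by omega, by omega, path, hc, fun t ht => mem_uSet_iff_unitary.1 (hp t ht), h0, h1⟩

lemma K1.mk_eq_iff {x y : {z : K1Rep B // K1Good z}} :
    (Quot.mk _ x : K1 B) = Quot.mk _ y ↔ UEqv x.1.u y.1.u := by
  refine ⟨fun h => ?_, fun h => Quot.sound h.rel⟩
  have e : Equivalence fun x y : {z : K1Rep B // K1Good z} => UEqv x.1.u y.1.u :=
    ⟨fun x => UEqv.refl x.2.mem_uSet, UEqv.symm, UEqv.trans⟩
  exact e.eqvGen_iff.1 ((Quot.eqvGen_exact h).mono fun _ _ => K1Rel.ueqv)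

lemma UEqv.emb_add_emb {m n : ℕ} {u : Matrix (Fin m) (Fin m) (Unitization ℂ B)}
    {v : Matrix (Fin n) (Fin n) (Unitization ℂ B)} (hu : u ∈ uSet B (Fin m))
    (hv : v ∈ uSet B (Fin n)) :
    UEqv (Matrix.fromBlocks u 0 0 v)
      (emb 0 u + emb m v : Matrix (Fin (m + n)) (Fin (m + n)) _) := by
  have hi := (finSumFinEquiv (m := m) (n := n)).injective
  have hw := conjTranspose_incl_mul_incl (R := Unitization ℂ B) hi
  refine of_adU_eq (fromBlocks_mem_uSet hu hv) (isometry_mul_sub_one hw _) ?_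
  ext1 i j
  obtain ⟨i, rfl⟩ := finSumFinEquiv.surjective i
  obtain ⟨j, rfl⟩ := finSumFinEquiv.surjective j
  rw [adU, Matrix.add_apply, incl_conj_apply hi]
  rcases i with i | i <;> rcases j with j | j <;> simp [Matrix.one_apply, emb, Fin.ext_iff]
  · rw [if_neg (by omega), dif_neg (by omega)]
  · rw [if_neg (by omega), dif_neg (by omega)]

lemma UEqv.of_eq_K1RepAdd {x y z : {w : K1Rep B // K1Good w}} (h : z.1 = K1RepAdd x.1 y.1) :
    UEqv (Matrix.fromBlocks x.1.u 0 0 y.1.u) z.1.u := by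
  obtain ⟨z, hz⟩ := z
  subst h
  exact UEqv.emb_add_emb x.2.mem_uSet y.2.mem_uSet

section Map

variable {ι κ : Type*} [Fintype ι] [DecidableEq ι] [Fintype κ] [DecidableEq κ] (ψ : B →⋆ₙₐ[ℂ] C)

lemma map_mem_uSet {u : Matrix ι ι (Unitization ℂ B)} (hu : u ∈ uSet B ι) :
    u.map (Unitization.starMap ψ) ∈ uSet C ι := by
  rw [mem_uSet_iff] at *
  rw [← map_conjTranspose_starAlgHom, ← map_mul_starAlgHom, ← map_mul_starAlgHom, hu.1, hu.2.1,
    fstM_starMap, hu.2.2]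
  simp

lemma map_adU (w : Matrix κ ι (Unitization ℂ B)) (u : Matrix ι ι (Unitization ℂ B)) :
    (adU w u).map (Unitization.starMap ψ) =
      adU (w.map (Unitization.starMap ψ)) (u.map (Unitization.starMap ψ)) := by
  simp only [adU, Matrix.map_add _ (map_add (Unitization.starMap ψ)),
    Matrix.map_sub _ (map_sub (Unitization.starMap ψ)), map_mul_starAlgHom,
    map_conjTranspose_starAlgHom,
    Matrix.map_one _ (map_zero (Unitization.starMap ψ)) (map_one (Unitization.starMap ψ))]

lemma map_incl (f : ι → κ) : (incl (Unitization ℂ B) f).map (Unitization.starMap ψ) =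
    incl (Unitization ℂ C) f := by
  ext1 i j
  simp only [Matrix.map_apply, incl_apply]
  split_ifs <;> simp

lemma continuous_starMap : Continuous (Unitization.starMap ψ) :=
  map_continuous (Unitization.starMap ψ)

lemma UEqv.map {u : Matrix ι ι (Unitization ℂ B)} {v : Matrix κ κ (Unitization ℂ B)}
    (h : UEqv u v) : UEqv (u.map (Unitization.starMap ψ)) (v.map (Unitization.starMap ψ)) := by
  obtain ⟨hu, hv, N, f, g, hf, hg, h⟩ := h
  refine ⟨map_mem_uSet ψ hu, map_mem_uSet ψ hv, N, f, g, hf, hg, ?_⟩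
  rw [← map_incl ψ, ← map_incl ψ, ← map_adU, ← map_adU]
  refine (h.map (f := fun M => M.map (Unitization.starMap ψ))
    (continuous_id.matrix_map (continuous_starMap ψ))).mono ?_
  rintro _ ⟨y, hy, rfl⟩
  exact map_mem_uSet ψ hy

end Map

/-- The image of a cycle. -/
def K1Cycle.map (ψ : B →⋆ₙₐ[ℂ] C) (x : {z : K1Rep B // K1Good z}) : {z : K1Rep C // K1Good z} :=
  ⟨K1RepMap ψ x.1, mem_uSet_iff_unitary.1 (map_mem_uSet ψ x.2.mem_uSet)⟩

/-- Functoriality of `K₁`. -/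
def K1.map (ψ : B →⋆ₙₐ[ℂ] C) : K1 B → K1 C :=
  Quot.lift (fun x => Quot.mk _ (K1Cycle.map ψ x)) fun x y h =>
    Quot.sound (UEqv.rel (x := K1Cycle.map ψ x) (y := K1Cycle.map ψ y) (h.ueqv.map ψ))

lemma K1RepMap_add (ψ : B →⋆ₙₐ[ℂ] C) (x y : K1Rep B) :
    K1RepMap ψ (K1RepAdd x y) = K1RepAdd (K1RepMap ψ x) (K1RepMap ψ y) := by
  simp only [K1RepMap, K1RepAdd, ← emb_map,
    Matrix.map_add _ (_root_.map_add (Unitization.starMap ψ))]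
  rfl

end KOne

/-- A unitary which is almost `1` outside a corner can be perturbed to be `1` outside it. -/
lemma exists_unitary_corner {A : Type*} [CStarAlgebra A] {z E : A} (hz : z ∈ unitary A)
    (hE : IsStarProjection E) {ε : ℝ} (h : ‖E * (z - 1) - (z - 1)‖ ≤ ε)
    (h' : ‖(z - 1) * E - (z - 1)‖ ≤ ε) (hε : ε ≤ 1 / 40) :
    ∃ u ∈ unitary A, E * (u - 1) = u - 1 ∧ (u - 1) * E = u - 1 ∧ ‖u - z‖ ≤ 21 * ε := by
  have hEE : E * E = E := hE.1
  have hEs : star E = E := hE.2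
  set y : A := 1 + E * (z - 1) * E with hy
  have hyz : ‖y - z‖ ≤ 2 * ε := by
    have : y - z = E * ((z - 1) * E - (z - 1)) + (E * (z - 1) - (z - 1)) := by
      rw [hy]; noncomm_ring
    rw [this]
    refine (norm_add_le _ _).trans ?_
    have h1 := norm_mul_le E ((z - 1) * E - (z - 1))
    have h2 := mul_le_mul_of_nonneg_right hE.norm_le (norm_nonneg ((z - 1) * E - (z - 1)))
    linarith
  obtain ⟨b, hb, hb1, hb2, hb3, hbc⟩ := exists_polar hz hyz (by linarith)
  have hEy : E * y = y * E := by
    simp only [hy, mul_add, add_mul, mul_one, one_mul, ← mul_assoc, hEE]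
    simp only [mul_assoc, hEE]
  have hEy' : E * star y = star y * E := by
    have := congrArg star hEy
    rw [star_mul, star_mul, hEs] at this
    exact this.symm
  have hcE : Commute (star y * y) E := by
    rw [Commute, SemiconjBy, mul_assoc, ← hEy, ← mul_assoc, ← hEy', mul_assoc]
  have hbE : b * E = E * b := hbc E hcE
  have hby : b * (star y * y) = star y * y * b := hbc _ (Commute.refl _)
  have hy1 : y * (1 - E) = 1 - E := by
    have : E * (z - 1) * E * (1 - E) = E * (z - 1) * (E - E * E) := by noncomm_ring
    rw [hy, add_mul, this, hEE]; simp
  have hy2 : star y * (1 - E) = 1 - E := by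
    have h1 := congrArg star hy1
    simp only [star_mul, star_sub, star_one, hEs] at h1
    rw [mul_sub, ← hEy', mul_one]
    rwa [sub_mul, one_mul] at h1
  clear_value y
  set c : A := b * E + (1 - E) with hc
  have hcs : star c = c := by
    rw [hc, star_add, star_mul, star_sub, star_one, hEs, hb.star_eq, hbE]
  have hcc : c * c = b * b * E + (1 - E) := by
    have e1 : b * E * (b * E) = b * b * E := by
      rw [mul_assoc, ← mul_assoc E, ← hbE, mul_assoc b E, hEE, ← mul_assoc]
    have e2 : E * (1 - E) = 0 := by rw [mul_sub, mul_one, hEE, sub_self]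
    have e3 : (1 - E) * (b * E) = 0 := by
      rw [hbE, ← mul_assoc, sub_mul, one_mul, hEE, sub_self, zero_mul]
    have e4 : (1 - E) * (1 - E) = 1 - E := by rw [mul_sub, mul_one, sub_mul, one_mul, hEE]; simp
    have e5 : b * E * (1 - E) = 0 := by rw [mul_assoc, e2, mul_zero]
    rw [hc, add_mul, mul_add, mul_add, e1, e5, e3, e4, add_zero, zero_add]
  have hcy : c * (star y * y) = star y * y * c := by
    rw [hc, add_mul, mul_add, mul_assoc, ← hcE.eq, ← mul_assoc, hby, mul_assoc, sub_mul, mul_sub,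
      hcE.eq, one_mul, mul_one]
  have hu : y * c - 1 = (y * b - 1) * E := by
    rw [hc, mul_add, hy1]; noncomm_ring
  refine ⟨y * c, Unitary.mem_iff.2 ⟨?_, ?_⟩, ?_, ?_, ?_⟩
  · calc star (y * c) * (y * c) = c * (star y * y) * c := by rw [star_mul, hcs]; noncomm_ring
      _ = b * b * (star y * y) * E + star y * (y * (1 - E)) := by
        rw [hcy, mul_assoc, hcc, mul_add, ← mul_assoc, ← mul_assoc, ← hby, mul_assoc b, ← hby]
        noncomm_ring
      _ = 1 := by rw [hb1, hy1, hy2]; simp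
  · calc y * c * star (y * c) = y * (c * c) * star y := by rw [star_mul, hcs]; noncomm_ring
      _ = y * (b * b) * star y * E + y * (1 - E) * star y := by
        rw [hcc, mul_add, add_mul, mul_assoc _ (star y), ← hEy']; noncomm_ring
      _ = 1 := by
        rw [hb2, hy1, sub_mul, hEy', one_mul, one_mul, ← mul_one_sub, hy2, add_sub_cancel]
  · rw [hu, ← mul_assoc, mul_sub, sub_mul, ← mul_assoc, hEy, mul_assoc y, ← hbE, mul_one,
      ← mul_assoc, sub_mul, mul_assoc _ E E, hEE, one_mul]
  · rw [hu, mul_assoc, hEE]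
  · have : y * c - z = (y * b - z) * E + ((z - 1) * E - (z - 1)) := by
      rw [← sub_sub_sub_cancel_right _ _ 1, hu]; noncomm_ring
    rw [this]
    refine (norm_add_le _ _).trans ?_
    have h1 := norm_mul_le (y * b - z) E
    have h2 := mul_le_mul_of_nonneg_left hE.norm_le (norm_nonneg (y * b - z))
    linarith

section UnitaryCompress

open Matrix
attribute [local instance] matrixCStarAlgebra

section Norms

variable {R : Type*} [CStarAlgebra R] {ι κ : Type*} [Fintype ι] [DecidableEq ι] [Fintype κ]
  [DecidableEq κ]

lemma norm_fromBlocks_diagonal (X : Matrix ι ι R) (Y : Matrix κ κ R) :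
    ‖fromBlocks X 0 0 Y‖ = max ‖X‖ ‖Y‖ := by
  let φ : Matrix ι ι R × Matrix κ κ R →⋆ₙₐ[ℂ] Matrix (ι ⊕ κ) (ι ⊕ κ) R :=
    { toFun := fun p => fromBlocks p.1 0 0 p.2
      map_smul' := fun c p => by simp [fromBlocks_smul]
      map_zero' := by simp
      map_add' := fun p q => by simp [fromBlocks_add]
      map_mul' := fun p q => by simp [fromBlocks_multiply]
      map_star' := fun p => by simp [star_eq_conjTranspose, fromBlocks_conjTranspose] }
  have hφ : Function.Injective φ := by
    intro p q h
    obtain ⟨h1, -, -, h2⟩ := fromBlocks_inj.1 (h : fromBlocks p.1 0 0 p.2 = fromBlocks q.1 0 0 q.2)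
    exact Prod.ext h1 h2
  exact NonUnitalStarAlgHom.norm_map φ hφ (X, Y)

lemma norm_conj_le {w : Matrix κ ι R} (hw : IsStarProjection (wᴴ * w)) (X : Matrix ι ι R) :
    ‖w * X * wᴴ‖ ≤ ‖X‖ := by
  set W : Matrix (κ ⊕ ι) (κ ⊕ ι) R := fromBlocks 0 w 0 0 with hW
  have hWs : star W * W = fromBlocks 0 0 0 (wᴴ * w) := by
    simp [hW, star_eq_conjTranspose, fromBlocks_conjTranspose, fromBlocks_multiply]
  have hp : IsStarProjection (fromBlocks 0 0 0 (wᴴ * w) : Matrix (κ ⊕ ι) (κ ⊕ ι) R) :=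
    ((IsStarProjection.zero _).isPair_zero.fromBlocks hw.isPair_zero).proj
  have hW1 := norm_le_one_of_star_mul_self_isStarProjection hp hWs
  have e : fromBlocks (w * X * wᴴ) 0 0 (0 : Matrix ι ι R) =
      W * fromBlocks (0 : Matrix κ κ R) 0 0 X * star W := by
    simp [hW, star_eq_conjTranspose, fromBlocks_conjTranspose, fromBlocks_multiply]
  have h1 : ‖w * X * wᴴ‖ = ‖W * fromBlocks (0 : Matrix κ κ R) 0 0 X * star W‖ := by
    rw [← e, norm_fromBlocks_diagonal]; simp
  have h2 : ‖fromBlocks (0 : Matrix κ κ R) 0 0 X‖ = ‖X‖ := by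
    rw [norm_fromBlocks_diagonal]; simp
  rw [h1, ← h2]
  refine (norm_mul_le _ _).trans ?_
  rw [norm_star]
  refine (mul_le_of_le_one_right (norm_nonneg _) hW1).trans ((norm_mul_le _ _).trans ?_)
  exact mul_le_of_le_one_left (norm_nonneg _) hW1

end Norms

variable {C : Type*} [NonUnitalCStarAlgebra C] {ι κ : Type*} [Fintype ι] [DecidableEq ι]
  [Fintype κ] [DecidableEq κ]

lemma continuous_scal_fstM : Continuous fun M : Matrix ι κ (Unitization ℂ C) => scal C (fstM M) :=
  continuous_id.matrix_map
    ((continuous_algebraMap ℂ (Unitization ℂ C)).comp Unitization.continuous_fst)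

lemma joinedIn_of_norm_sub_lt {u v : Matrix ι ι (Unitization ℂ C)} (hu : u ∈ uSet C ι)
    (hv : v ∈ uSet C ι) (h : ‖v - u‖ < 2) : JoinedIn (uSet C ι) u v := by
  obtain ⟨γ⟩ := Unitary.joined ⟨u, hu.1⟩ ⟨v, hv.1⟩ h
  have hγ : ∀ t, (γ t : Matrix ι ι (Unitization ℂ C))ᴴ * γ t = 1 ∧
      (γ t : Matrix ι ι (Unitization ℂ C)) * (γ t : Matrix ι ι (Unitization ℂ C))ᴴ = 1 := fun t =>
    Unitary.mem_iff.1 (γ t).2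
  refine ⟨⟨⟨fun t => (scal C (fstM (γ t : Matrix ι ι (Unitization ℂ C))))ᴴ * γ t, ?_⟩, ?_, ?_⟩,
    fun t => ?_⟩
  · have hc : Continuous fun t => (γ t : Matrix ι ι (Unitization ℂ C)) :=
      continuous_subtype_val.comp γ.continuous
    exact (continuous_scal_fstM.comp hc).matrix_conjTranspose.matrix_mul hc
  · simp [hu.2, scal_one]
  · simp [hv.2, scal_one]
  · obtain ⟨h1, h2⟩ := hγ t
    refine mem_uSet_iff.2 ⟨?_, ?_, ?_⟩
    all_goals change _ = _ at *
    all_goals simp only [Path.coe_mk_mk] at *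
    all_goals generalize (γ t : Matrix ι ι (Unitization ℂ C)) = g at *
    · have := congrArg (scal C) (congrArg fstM h2)
      rw [fstM_mul, scal_mul, fstM_conjTranspose, scal_conjTranspose, fstM_one, scal_one] at this
      calc _ = gᴴ * (scal C (fstM g) * (scal C (fstM g))ᴴ) * g := by
            rw [conjTranspose_mul, conjTranspose_conjTranspose]; simp only [Matrix.mul_assoc]
        _ = 1 := by rw [this, Matrix.mul_one, h1]
    · have := congrArg (scal C) (congrArg fstM h1)
      rw [fstM_mul, scal_mul, fstM_conjTranspose, scal_conjTranspose, fstM_one, scal_one] at this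
      calc _ = (scal C (fstM g))ᴴ * (g * gᴴ) * scal C (fstM g) := by
            rw [conjTranspose_mul, conjTranspose_conjTranspose]; simp only [Matrix.mul_assoc]
        _ = 1 := by rw [h2, Matrix.mul_one, this]
    · have := congrArg fstM h1
      rwa [fstM_mul, fstM_one, fstM_conjTranspose, ← fstM_scal (C := C) (fstM g),
        ← fstM_conjTranspose, fstM_scal, ← fstM_mul] at this

lemma UEqv.of_norm_sub_le {u v : Matrix ι ι (Unitization ℂ C)} (hu : u ∈ uSet C ι)
    (hv : v ∈ uSet C ι) {ε : ℝ} (h : ‖u - v‖ ≤ ε) (hε : ε < 2) : UEqv u v :=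
  .of_joinedIn (joinedIn_of_norm_sub_lt hu hv (by rw [norm_sub_rev]; exact h.trans_lt hε))

/-- Compression of a unitary matrix to the corner given by `e`. -/
lemma exists_uSet_corner {z : Matrix ι ι (Unitization ℂ C)} (hz : z ∈ uSet C ι) {e : C}
    (he : IsStarProjection e) {ε : ℝ} (h : ‖diagE ι e * (z - 1) - (z - 1)‖ ≤ ε)
    (h' : ‖(z - 1) * diagE ι e - (z - 1)‖ ≤ ε) (hε : ε ≤ 1 / 40) :
    ∃ u ∈ uSet C ι, IsPair (diagE ι e) (u - 1) ∧ ‖u - z‖ ≤ 21 * ε := by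
  obtain ⟨u, hu, h1, h2, h3⟩ := exists_unitary_corner hz.1 (isStarProjection_diagE he) h h' hε
  refine ⟨u, ⟨hu, ?_⟩, ⟨isStarProjection_diagE he, h1, h2⟩, h3⟩
  have := congrArg fstM h1
  rw [fstM_mul, fstM_diagE, Matrix.zero_mul, fstM_sub, fstM_one] at this
  exact (sub_eq_zero.1 this.symm)

/-- Over a stable algebra every unitary is equivalent to one of size one. -/
lemma StableLike.exists_ueqv (hC : StableLike C) {u : Matrix ι ι (Unitization ℂ C)}
    (hu : u ∈ uSet C ι) : ∃ u' ∈ uSet C (Fin 1), UEqv u u' := by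
  obtain ⟨e, he, h, v, hv⟩ := hC.matrix {u - 1} (ε := 1 / 40) (by simp [hu.2]) (by norm_num)
  obtain ⟨h1, h2⟩ := h _ (Finset.mem_singleton_self _)
  obtain ⟨u', hu', hp, h3⟩ := exists_uSet_corner hu he h1 h2 le_rfl
  have hw : (rowV v fun i => (Fintype.equivFin ι i : ℕ))ᴴ *
      rowV v (fun i => (Fintype.equivFin ι i : ℕ)) * (u' - 1) = u' - 1 := by
    have := conjTranspose_rowV_mul hv (f := fun i => (Fintype.equivFin ι i : ℕ))
      (Fin.val_injective.comp (Fintype.equivFin ι).injective)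
    rw [this, hp.left]
  exact ⟨_, adU_mem_uSet hu' hw, (UEqv.of_norm_sub_le hu' hu h3 (by norm_num)).symm.trans
    (UEqv.ad hu' hw)⟩

end UnitaryCompress

lemma JoinedIn.exists_chain {X : Type*} [PseudoMetricSpace X] {S : Set X} {x y : X}
    (h : JoinedIn S x y) {δ : ℝ} (hδ : 0 < δ) :
    ∃ (k : ℕ) (z : ℕ → X), z 0 = x ∧ z k = y ∧ (∀ j ≤ k, z j ∈ S) ∧
      ∀ j < k, dist (z j) (z (j + 1)) ≤ δ := by
  obtain ⟨γ, hc, hS, h0, h1⟩ := joinedIn_iff_exists_real_path.1 h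
  obtain ⟨η, hη, H⟩ := Metric.uniformContinuousOn_iff.1
    ((isCompact_Icc (a := (0 : ℝ)) (b := 1)).uniformContinuousOn_of_continuous hc.continuousOn) δ hδ
  obtain ⟨n, hn⟩ := exists_nat_gt η⁻¹
  have hn0 : (0 : ℝ) < n := (inv_pos.2 hη).trans hn
  have hI : ∀ j ≤ n, (j / n : ℝ) ∈ Set.Icc (0 : ℝ) 1 := fun j hj =>
    ⟨by positivity, (div_le_one hn0).2 (by exact_mod_cast hj)⟩
  refine ⟨n, fun j => γ (j / n), by simpa using h0, by simpa [hn0.ne'] using h1,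
    fun j hj => hS _ (hI j hj), fun j hj => (H _ (hI j hj.le) _ (hI (j + 1) hj) ?_).le⟩
  rw [dist_comm, Real.dist_eq, ← sub_div, Nat.cast_succ, add_sub_cancel_left,
    abs_of_pos (by positivity), one_div]
  exact inv_lt_of_inv_lt₀ hη hn

section UnitaryLink

open Matrix PairClass
attribute [local instance] matrixCStarAlgebra

variable {C : Type*} [NonUnitalCStarAlgebra C] {ι κ ν : Type*} [Fintype ι] [DecidableEq ι]
  [Fintype κ] [DecidableEq κ] [Fintype ν] [DecidableEq ν]

lemma norm_fromBlocks_sub (a c : Matrix ι ι (Unitization ℂ C))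
    (b d : Matrix κ κ (Unitization ℂ C)) :
    ‖fromBlocks a 0 0 b - fromBlocks c 0 0 d‖ = max ‖a - c‖ ‖b - d‖ := by
  have : fromBlocks a 0 0 b - fromBlocks c 0 0 d = fromBlocks (a - c) 0 0 (b - d) := by
    ext1 (i | i) (j | j) <;> simp
  rw [this, norm_fromBlocks_diagonal]

lemma fromBlocks_diagE (e : C) :
    fromBlocks (diagE ι e) 0 0 (diagE κ e) = diagE (ι ⊕ κ) e := by
  ext1 (i | i) (j | j) <;> simp [diagE, Matrix.diagonal_apply]

lemma cls_congr {p x q y : Matrix ι ι (Unitization ℂ C)} (h : IsPair p x) (h' : IsPair q y)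
    (hp : p = q) (hx : x = y) : cls h = cls h' := by subst hp hx; rfl

lemma isPair_diagE_fromBlocks {e : C} {u : Matrix ι ι (Unitization ℂ C)}
    {v : Matrix κ κ (Unitization ℂ C)} (h : IsPair (diagE ι e) (u - 1))
    (h' : IsPair (diagE κ e) (v - 1)) :
    IsPair (diagE (ι ⊕ κ) e) (fromBlocks u 0 0 v - 1) := by
  rw [← fromBlocks_diagE, fromBlocks_sub_one]
  exact h.fromBlocks h'

lemma cls_diagE_fromBlocks {e : C} {u : Matrix ι ι (Unitization ℂ C)}
    {v : Matrix κ κ (Unitization ℂ C)} (h : IsPair (diagE ι e) (u - 1))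
    (h' : IsPair (diagE κ e) (v - 1)) :
    cls (isPair_diagE_fromBlocks h h') = cls h + cls h' := by
  rw [← cls_fromBlocks]
  exact cls_congr _ _ (fromBlocks_diagE e).symm (fromBlocks_sub_one u v)

/-- Two classes which become equal after adding classes of close unitaries in the corner of `e`. -/
def UnitaryLink (e : C) (X Y : PairClass (Unitization ℂ C)) : Prop :=
  ∃ (κ : Type) (_ : Fintype κ) (_ : DecidableEq κ) (a c : Matrix κ κ (Unitization ℂ C))
    (ha : IsPair (diagE κ e) (a - 1)) (hc : IsPair (diagE κ e) (c - 1)),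
    a ∈ uSet C κ ∧ c ∈ uSet C κ ∧ ‖a - c‖ ≤ 1 / 2 ∧ X + cls hc = cls ha + Y

lemma UnitaryLink.trans {e : C} {X Y Z : PairClass (Unitization ℂ C)} (h : UnitaryLink e X Y)
    (h' : UnitaryLink e Y Z) : UnitaryLink e X Z := by
  obtain ⟨κ, _, _, a, c, ha, hc, hau, hcu, hn, h⟩ := h
  obtain ⟨κ', _, _, a', c', ha', hc', hau', hcu', hn', h'⟩ := h'
  have ha2 := isPair_diagE_fromBlocks ha ha'
  have hc2 := isPair_diagE_fromBlocks hc hc'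
  have h2 : X + cls hc2 = cls ha2 + Z := by
    rw [cls_diagE_fromBlocks ha ha', cls_diagE_fromBlocks hc hc', ← add_assoc, h, add_assoc, h',
      add_assoc]
  have hn2 : ‖fromBlocks a 0 0 a' - fromBlocks c 0 0 c'‖ ≤ 1 / 2 := by
    rw [norm_fromBlocks_sub]
    exact max_le hn hn'
  have hau2 := fromBlocks_mem_uSet hau hau'
  have hcu2 := fromBlocks_mem_uSet hcu hcu'
  exact ⟨κ ⊕ κ', inferInstance, inferInstance, _, _, ha2, hc2, hau2, hcu2, hn2, h2⟩

lemma UnitaryLink.of_norm_sub_le {ι : Type} [Fintype ι] [DecidableEq ι] {e : C}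
    {u v : Matrix ι ι (Unitization ℂ C)} (hu : u ∈ uSet C ι) (hv : v ∈ uSet C ι)
    (hup : IsPair (diagE ι e) (u - 1)) (hvp : IsPair (diagE ι e) (v - 1)) (h : ‖u - v‖ ≤ 1 / 2) :
    UnitaryLink e (cls hup) (cls hvp) :=
  ⟨ι, inferInstance, inferInstance, u, v, hup, hvp, hu, hv, h, rfl⟩

lemma UnitaryLink.cancel {ν : Type} [Fintype ν] [DecidableEq ν] {e : C}
    {X Y : PairClass (Unitization ℂ C)}
    (h1 : IsPair (diagE ν e) ((1 : Matrix ν ν (Unitization ℂ C)) - 1))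
    (h : UnitaryLink e (X + cls h1) (Y + cls h1)) : UnitaryLink e X Y := by
  obtain ⟨κ, _, _, a, c, ha, hc, hau, hcu, hn, h⟩ := h
  have ha2 := isPair_diagE_fromBlocks ha h1
  have hc2 := isPair_diagE_fromBlocks hc h1
  have h2 : X + cls hc2 = cls ha2 + Y := by
    rw [cls_diagE_fromBlocks ha h1, cls_diagE_fromBlocks hc h1]
    calc _ = X + cls h1 + cls hc := by abel
      _ = _ := by rw [h]; abel
  have hn2 : ‖fromBlocks a 0 0 (1 : Matrix ν ν (Unitization ℂ C)) - fromBlocks c 0 0 1‖ ≤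
      1 / 2 := by
    rw [norm_fromBlocks_sub, sub_self, norm_zero]
    exact max_le hn (by norm_num)
  have hau2 := fromBlocks_mem_uSet hau (one_mem_uSet (C := C) (ι := ν))
  have hcu2 := fromBlocks_mem_uSet hcu (one_mem_uSet (C := C) (ι := ν))
  exact ⟨κ ⊕ ν, inferInstance, inferInstance, _, _, ha2, hc2, hau2, hcu2, hn2, h2⟩

/-- Equivalent unitaries of the same size become homotopic after adding an identity block. -/
lemma UEqv.exists_joinedIn {u v : Matrix ι ι (Unitization ℂ C)} (h : UEqv u v) :
    ∃ N : ℕ, JoinedIn (uSet C (ι ⊕ Fin N)) (Matrix.fromBlocks u 0 0 1)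
      (Matrix.fromBlocks v 0 0 1) := by
  obtain ⟨hu, hv, N, f, g, hf, hg, h⟩ := h
  refine ⟨N, ?_⟩
  have hl := conjTranspose_incl_mul_incl (R := Unitization ℂ C)
    (Sum.inl_injective (α := ι) (β := Fin N))
  have hr := conjTranspose_incl_mul_incl (R := Unitization ℂ C)
    (Sum.inr_injective (α := ι) (β := Fin N))
  have aux : ∀ {k : ι → Fin N} {x : Matrix ι ι (Unitization ℂ C)}, Function.Injective k →
      x ∈ uSet C ι → JoinedIn (uSet C (ι ⊕ Fin N)) (Matrix.fromBlocks x 0 0 1)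
        (adU (incl _ (Sum.inr : Fin N → ι ⊕ Fin N)) (adU (incl _ k) x)) := by
    intro k x hk hx
    have hi := Sum.inr_injective (α := ι) |>.comp hk
    have e2 := conjTranspose_incl_mul_incl (R := Unitization ℂ C) hi
    have e3 : (incl (Unitization ℂ C) (Sum.inl : ι → ι ⊕ Fin N))ᴴ *
        incl (Unitization ℂ C) ((Sum.inr : Fin N → ι ⊕ Fin N) ∘ k) = 0 :=
      conjTranspose_incl_mul_incl_eq_zero fun i j => Sum.inl_ne_inr
    rw [adU_adU, incl_mul_incl, ← adU_inl]
    exact joinedIn_adU hx (isometry_mul_sub_one hl x) (isometry_mul_sub_one e2 x) e3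
  exact ((aux hf hu).trans (h.adU hr)).trans (aux hg hv).symm

lemma norm_compress_of_fromBlocks {e : C} {u : Matrix ι ι (Unitization ℂ C)} {ε : ℝ}
    (h : ‖diagE (ι ⊕ κ) e * (fromBlocks u 0 0 (1 : Matrix κ κ (Unitization ℂ C)) - 1) -
      (fromBlocks u 0 0 1 - 1)‖ ≤ ε ∧
      ‖(fromBlocks u 0 0 (1 : Matrix κ κ (Unitization ℂ C)) - 1) * diagE (ι ⊕ κ) e -
        (fromBlocks u 0 0 1 - 1)‖ ≤ ε) :
    ‖diagE ι e * (u - 1) - (u - 1)‖ ≤ ε ∧ ‖(u - 1) * diagE ι e - (u - 1)‖ ≤ ε := by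
  have aux : ∀ {X Y : Matrix ι ι (Unitization ℂ C)},
      fromBlocks X 0 0 (0 : Matrix κ κ (Unitization ℂ C)) - fromBlocks Y 0 0 0 =
        fromBlocks (X - Y) 0 0 0 := fun {X Y} => by
    ext1 (i | i) (j | j) <;> simp
  rw [fromBlocks_sub_one, ← fromBlocks_diagE] at h
  simp only [fromBlocks_multiply, Matrix.mul_zero, Matrix.zero_mul, add_zero, sub_self, aux,
    norm_fromBlocks_diagonal, norm_zero, max_le_iff] at h
  exact ⟨h.1.1, h.2.1⟩

/-- Equivalent unitaries over a stable algebra are linked, uniformly, through close unitaries. -/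
lemma StableLike.exists_link (hC : StableLike C) {u v : Matrix (Fin 1) (Fin 1) (Unitization ℂ C)}
    (huv : UEqv u v) :
    ∃ e : C, IsStarProjection e ∧
      (∃ s : ℕ → C, ∀ k l, star (s k) * s l = if k = l then e else 0) ∧
      ∃ u' ∈ uSet C (Fin 1), ∃ v' ∈ uSet C (Fin 1), ‖u' - u‖ ≤ 1 / 2 ∧ ‖v' - v‖ ≤ 1 / 2 ∧
        ∃ (hu : IsPair (diagE (Fin 1) e) (u' - 1)) (hv : IsPair (diagE (Fin 1) e) (v' - 1)),
          UnitaryLink e (cls hu) (cls hv) := by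
  classical
  obtain ⟨N, hN⟩ := huv.exists_joinedIn
  obtain ⟨k, Z, h0, hk, hZ, hd⟩ := hN.exists_chain (show (0 : ℝ) < 1 / 8 by norm_num)
  obtain ⟨e, he, h, s, hs⟩ := hC.matrix ((Finset.range (k + 1)).image fun j => Z j - 1)
    (ε := 1 / 336) (by
      intro D hD
      obtain ⟨j, hj, rfl⟩ := Finset.mem_image.1 hD
      rw [fstM_sub, (hZ j (Nat.lt_succ_iff.1 (Finset.mem_range.1 hj))).2, fstM_one, sub_self])
    (by norm_num)
  have hj : ∀ j ≤ k, _ := fun j hj =>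
    h _ (Finset.mem_image_of_mem _ (Finset.mem_range.2 (Nat.lt_succ_of_le hj)))
  have hz : ∀ j, ∃ z ∈ uSet C (Fin 1 ⊕ Fin N), IsPair (diagE _ e) (z - 1) ∧
      (j ≤ k → ‖z - Z j‖ ≤ 1 / 16) := by
    intro j
    by_cases hjk : j ≤ k
    · obtain ⟨z, hz, hp, hn⟩ := exists_uSet_corner (hZ j hjk) he (hj j hjk).1 (hj j hjk).2
        (by norm_num)
      exact ⟨z, hz, hp, fun _ => hn.trans (by norm_num)⟩
    · exact ⟨1, one_mem_uSet, by rw [sub_self]; exact (isStarProjection_diagE he).isPair_zero,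
        fun h => absurd h hjk⟩
  choose z hzu hzp hzn using hz
  obtain ⟨hu1, hu2⟩ := norm_compress_of_fromBlocks (h0 ▸ hj 0 (Nat.zero_le k))
  obtain ⟨hv1, hv2⟩ := norm_compress_of_fromBlocks (hk ▸ hj k le_rfl)
  obtain ⟨u', hu', hup, hun⟩ := exists_uSet_corner huv.1 he hu1 hu2 (by norm_num)
  obtain ⟨v', hv', hvp, hvn⟩ := exists_uSet_corner huv.2.1 he hv1 hv2 (by norm_num)
  refine ⟨e, he, ⟨s, hs⟩, u', hu', v', hv', hun.trans (by norm_num), hvn.trans (by norm_num),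
    hup, hvp, ?_⟩
  have h1 : IsPair (diagE (Fin N) e) ((1 : Matrix (Fin N) (Fin N) (Unitization ℂ C)) - 1) := by
    rw [sub_self]; exact (isStarProjection_diagE he).isPair_zero
  have hup' := isPair_diagE_fromBlocks hup h1
  have hvp' := isPair_diagE_fromBlocks hvp h1
  have hu1' := fromBlocks_mem_uSet hu' (one_mem_uSet (C := C) (ι := Fin N))
  have hv1' := fromBlocks_mem_uSet hv' (one_mem_uSet (C := C) (ι := Fin N))
  have hun' : ‖fromBlocks u' 0 0 (1 : Matrix (Fin N) (Fin N) (Unitization ℂ C)) - Z 0‖ ≤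
      1 / 16 := by
    rw [h0, norm_fromBlocks_sub, sub_self, norm_zero]
    exact max_le (hun.trans (by norm_num)) (by norm_num)
  have hvn' : ‖fromBlocks v' 0 0 (1 : Matrix (Fin N) (Fin N) (Unitization ℂ C)) - Z k‖ ≤
      1 / 16 := by
    rw [hk, norm_fromBlocks_sub, sub_self, norm_zero]
    exact max_le (hvn.trans (by norm_num)) (by norm_num)
  have hupc : cls hup' = cls hup + cls h1 := cls_diagE_fromBlocks hup h1
  have hvpc : cls hvp' = cls hvp + cls h1 := cls_diagE_fromBlocks hvp h1
  refine UnitaryLink.cancel h1 ?_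
  rw [← hupc, ← hvpc]
  clear hupc hvpc
  generalize fromBlocks u' 0 0 (1 : Matrix (Fin N) (Fin N) (Unitization ℂ C)) = U at *
  generalize fromBlocks v' 0 0 (1 : Matrix (Fin N) (Fin N) (Unitization ℂ C)) = V at *
  have step : ∀ {x y z t : Matrix (Fin 1 ⊕ Fin N) (Fin 1 ⊕ Fin N) (Unitization ℂ C)},
      ‖x - z‖ ≤ 1 / 16 → ‖y - t‖ ≤ 1 / 16 → ‖z - t‖ ≤ 1 / 8 → ‖x - y‖ ≤ 1 / 2 := by
    intro x y z t h1 h2 h3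
    have e1 := norm_sub_le_norm_sub_add_norm_sub x z y
    have e2 := norm_sub_le_norm_sub_add_norm_sub z t y
    rw [norm_sub_rev t y] at e2
    linarith
  have hchain : ∀ j ≤ k, UnitaryLink e (cls hup') (cls (hzp j)) := by
    intro j
    induction j with
    | zero =>
      intro _
      exact .of_norm_sub_le hu1' (hzu 0) _ _ (step hun' (hzn 0 (Nat.zero_le _)) (by simp))
    | succ j ih =>
      intro hjk
      have hjk' := Nat.le_of_succ_le hjk
      have e3 := hd j hjk
      rw [dist_eq_norm] at e3
      have e4 := step (hzn j hjk') (hzn _ hjk) e3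
      exact (ih hjk').trans (.of_norm_sub_le (hzu _) (hzu _) _ _ e4)
  have e4 := step (hzn k le_rfl) hvn' (by simp)
  exact (hchain k le_rfl).trans (.of_norm_sub_le (hzu k) hv1' _ _ e4)

/-- Uniform form of the equivalence of unitaries over a stable algebra. -/
lemma StableLike.exists_pairIso (hC : StableLike C)
    {u v : Matrix (Fin 1) (Fin 1) (Unitization ℂ C)} (huv : UEqv u v) :
    ∃ u' ∈ uSet C (Fin 1), ∃ v' ∈ uSet C (Fin 1), ∃ a ∈ uSet C (Fin 1), ∃ c ∈ uSet C (Fin 1),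
      ‖u' - u‖ ≤ 1 / 2 ∧ ‖v' - v‖ ≤ 1 / 2 ∧ ‖a - c‖ ≤ 1 / 2 ∧
      ∃ p f : Matrix (Fin 1) (Fin 1) (Unitization ℂ C), fstM p = 0 ∧ fstM f = 0 ∧
        IsPair p (u' - 1) ∧ IsPair p (v' - 1) ∧ IsPair f (a - 1) ∧ IsPair f (c - 1) ∧
        PairIso (fromBlocks p 0 0 f) (fromBlocks (u' - 1) 0 0 (c - 1))
          (fromBlocks f 0 0 p) (fromBlocks (a - 1) 0 0 (v' - 1)) := by
  obtain ⟨e, he, ⟨s, hs⟩, u', hu', v', hv', hun, hvn, hup, hvp, κ, _, _, a, c, ha, hc, hau, hcu,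
    hn, h⟩ := hC.exists_link huv
  have hi : Function.Injective fun i => (Fintype.equivFin κ i : ℕ) :=
    Fin.val_injective.comp (Fintype.equivFin κ).injective
  set w := rowV s fun i => (Fintype.equivFin κ i : ℕ)
  have hw : wᴴ * w = diagE κ e := conjTranspose_rowV_mul hs hi
  have hwe : w * diagE κ e = w := rowV_mul_diagE he hs _
  have hw0 : fstM w = 0 := fstM_rowV _ _
  clear_value w
  have had : ∀ x : Matrix κ κ (Unitization ℂ C), adU w x - 1 = w * (x - 1) * wᴴ := fun x =>
    add_sub_cancel_left _ _
  have ha' : IsPair (w * wᴴ) (adU w a - 1) := had a ▸ ha.map hw hwe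
  have hc' : IsPair (w * wᴴ) (adU w c - 1) := had c ▸ hc.map hw hwe
  refine ⟨u', hu', v', hv', _, adU_mem_uSet hau (by rw [hw, ha.left]), _,
    adU_mem_uSet hcu (by rw [hw, hc.left]), hun, hvn, ?_, _, _, fstM_diagE e, ?_, hup, hvp, ha',
    hc', ?_⟩
  · have : adU w a - adU w c = w * (a - c) * wᴴ := by
      rw [← sub_sub_sub_cancel_right _ _ 1, had, had, ← Matrix.sub_mul, ← Matrix.mul_sub,
        sub_sub_sub_cancel_right]
    rw [this]
    exact (norm_conj_le (hw ▸ ha.proj) _).trans hn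
  · rw [fstM_mul, hw0, Matrix.zero_mul]
  · have h1 := hup.fromBlocks hc'
    have h2 := ha'.fromBlocks hvp
    have e1 : cls h1 = cls hup + cls hc' := cls_fromBlocks hup hc'
    have e2 : cls h2 = cls ha' + cls hvp := cls_fromBlocks ha' hvp
    refine (cls_eq_iff h1 h2).1 ?_
    rw [e1, e2, cls_of_isometry hc hc' hw hwe rfl (had c).symm,
      cls_of_isometry ha ha' hw hwe rfl (had a).symm, h]

end UnitaryLink

section KOneProduct

open Matrix
attribute [local instance] matrixCStarAlgebra

lemma UEqv.of_pairIso {C : Type*} [NonUnitalCStarAlgebra C] {ι κ : Type*} [Fintype ι]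
    [DecidableEq ι] [Fintype κ] [DecidableEq κ] {u p : Matrix ι ι (Unitization ℂ C)}
    {v q : Matrix κ κ (Unitization ℂ C)} (hu : u ∈ uSet C ι) (h : IsPair p (u - 1))
    (H : PairIso p (u - 1) q (v - 1)) : UEqv u v := by
  obtain ⟨w, hw, -, -, hv⟩ := H
  exact of_adU_eq hu (by rw [hw, h.left]) (by rw [adU, hv, add_sub_cancel])

variable {I : Type*} {B : I → Type*} [∀ i, NonUnitalCStarAlgebra (B i)]

section Lift

variable {ι : Type*} [Fintype ι] [DecidableEq ι]

lemma coord_one (i : I) : coord i (1 : Matrix ι ι (Unitization ℂ (lp B ∞))) = 1 :=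
  Matrix.map_one _ (map_zero _) (map_one _)

lemma coord_sub (i : I) (M N : Matrix ι ι (Unitization ℂ (lp B ∞))) :
    coord i (M - N) = coord i M - coord i N := Matrix.map_sub _ (map_sub _) _ _

lemma coord_add (i : I) (M N : Matrix ι ι (Unitization ℂ (lp B ∞))) :
    coord i (M + N) = coord i M + coord i N := Matrix.map_add _ (map_add _) _ _

/-- A family of unitaries lifts to a unitary over the product. -/
lemma exists_coord_mem_uSet {u : ∀ i, Matrix ι ι (Unitization ℂ (B i))}
    (hu : ∀ i, u i ∈ uSet (B i) ι) : ∃ U ∈ uSet (lp B ∞) ι, ∀ i, coord i U = u i := by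
  obtain ⟨M, hM0, hM⟩ := exists_coord (fun i => u i - 1)
    (fun i => by rw [fstM_sub, (hu i).2, fstM_one, sub_self]) 2 fun i => by
      refine (norm_sub_le _ _).trans ?_
      have h1 := norm_le_one_of_mem_unitary (hu i).1
      have h2 := norm_le_one_of_mem_unitary (one_mem (unitary (Matrix ι ι (Unitization ℂ (B i)))))
      linarith
  have hc : ∀ i, coord i (1 + M) = u i := fun i => by
    rw [coord_add, coord_one, hM, add_sub_cancel]
  have h0 : fstM (1 + M) = 1 := by rw [fstM_add, hM0, fstM_one, add_zero]
  refine ⟨1 + M, mem_uSet_iff.2 ⟨coord_ext ?_ fun i => ?_, coord_ext ?_ fun i => ?_, h0⟩, hc⟩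
  · rw [fstM_mul, fstM_conjTranspose, h0, fstM_one]; simp
  · rw [coord_mul, coord_conjTranspose, hc, (mem_uSet_iff.1 (hu i)).1, coord_one]
  · rw [fstM_mul, fstM_conjTranspose, h0, fstM_one]; simp
  · rw [coord_mul, coord_conjTranspose, hc, (mem_uSet_iff.1 (hu i)).2.1, coord_one]

lemma IsPair.of_coord {P U : Matrix ι ι (Unitization ℂ (lp B ∞))} (hP : IsStarProjection P)
    (hP0 : fstM P = 0) (hU : U ∈ uSet (lp B ∞) ι)
    (h : ∀ i, IsPair (coord i P) (coord i U - 1)) : IsPair P (U - 1) := by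
  have h0 : fstM (U - 1) = 0 := by rw [fstM_sub, hU.2, fstM_one, sub_self]
  have hc : ∀ i, coord i (U - 1) = coord i U - 1 := fun i => by rw [coord_sub, coord_one]
  refine ⟨hP, coord_ext ?_ fun i => ?_, coord_ext ?_ fun i => ?_⟩
  · rw [fstM_mul, hP0, Matrix.zero_mul, h0]
  · rw [coord_mul, hc, (h i).left]
  · rw [fstM_mul, hP0, Matrix.mul_zero, h0]
  · rw [coord_mul, hc, (h i).right]

end Lift

lemma norm_sub_le_of_coord {u v : Matrix (Fin 1) (Fin 1) (Unitization ℂ (lp B ∞))}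
    (hu : u ∈ uSet (lp B ∞) (Fin 1)) (hv : v ∈ uSet (lp B ∞) (Fin 1)) {K : ℝ} (hK : 0 ≤ K)
    (h : ∀ i, ‖coord i u - coord i v‖ ≤ K) : ‖u - v‖ ≤ K := by
  have h0 : fstM (u - v) = 0 := by rw [fstM_sub, hu.2, hv.2, sub_self]
  refine (norm_matrix_le_sum _).trans ?_
  simp only [Finset.univ_unique, Finset.sum_singleton, Fin.default_eq_zero]
  rw [exists_inr_of_fstM h0, Unitization.norm_inr]
  refine lp.norm_le_of_forall_le hK fun i => ?_
  have h1 : fstM (coord i u - coord i v) = 0 := by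
    rw [← coord_sub]; exact (fstM_starMap _ _).trans h0
  have h2 : ((u - v) 0 0).snd i = ((coord i u - coord i v) 0 0).snd := by
    rw [← coord_sub, coord_apply, (starMap_apply _ _).2]; rfl
  rw [h2, ← Unitization.norm_inr (𝕜 := ℂ), ← exists_inr_of_fstM h1]
  exact (norm_matrix_entry_le _ _ _).trans (h i)

lemma UEqv.of_coord (hB : ∀ i, StableLike (B i))
    {u v : Matrix (Fin 1) (Fin 1) (Unitization ℂ (lp B ∞))} (hu : u ∈ uSet (lp B ∞) (Fin 1))
    (hv : v ∈ uSet (lp B ∞) (Fin 1)) (H : ∀ i, UEqv (coord i u) (coord i v)) : UEqv u v := by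
  choose u' hu' v' hv' a ha c hc hun hvn hac p f hp0 hf0 hpu hpv hfa hfc hiso using
    fun i => (hB i).exists_pairIso (H i)
  obtain ⟨U, hU, hUi⟩ := exists_coord_mem_uSet hu'
  obtain ⟨V, hV, hVi⟩ := exists_coord_mem_uSet hv'
  obtain ⟨A, hA, hAi⟩ := exists_coord_mem_uSet ha
  obtain ⟨D, hD, hDi⟩ := exists_coord_mem_uSet hc
  obtain ⟨P, hP, hP0, hPi⟩ := exists_coord_isStarProjection (fun i => (hpu i).proj) hp0
  obtain ⟨F, hF, hF0, hFi⟩ := exists_coord_isStarProjection (fun i => (hfa i).proj) hf0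
  have hPU : IsPair P (U - 1) := .of_coord hP hP0 hU fun i => by rw [hPi, hUi]; exact hpu i
  have hPV : IsPair P (V - 1) := .of_coord hP hP0 hV fun i => by rw [hPi, hVi]; exact hpv i
  have hFA : IsPair F (A - 1) := .of_coord hF hF0 hA fun i => by rw [hFi, hAi]; exact hfa i
  have hFD : IsPair F (D - 1) := .of_coord hF hF0 hD fun i => by rw [hFi, hDi]; exact hfc i
  have h1 := hPU.fromBlocks hFD
  have h2 := hFA.fromBlocks hPV
  have hiso' : PairIso (Matrix.fromBlocks P 0 0 F) (Matrix.fromBlocks (U - 1) 0 0 (D - 1))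
      (Matrix.fromBlocks F 0 0 P) (Matrix.fromBlocks (A - 1) 0 0 (V - 1)) := by
    refine (PairClass.cls_eq_iff h1 h2).1 (cls_eq_of_coord h1 h2 ?_ ?_ fun i => ?_)
    · rw [fstM_fromBlocks, hP0, hF0]; simp
    · rw [fstM_fromBlocks, hP0, hF0]; simp
    · simp only [coord_fromBlocks, coord_sub, coord_one, hPi, hFi, hUi, hVi, hAi, hDi]
      exact hiso i
  rw [← fromBlocks_sub_one, ← fromBlocks_sub_one] at hiso'
  rw [← fromBlocks_sub_one] at h1
  have hUD := UEqv.of_pairIso (fromBlocks_mem_uSet hU hD) h1 hiso'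
  have hnU : ‖U - u‖ ≤ 1 / 2 := norm_sub_le_of_coord hU hu (by norm_num) fun i => by
    rw [hUi]; exact hun i
  have hnV : ‖V - v‖ ≤ 1 / 2 := norm_sub_le_of_coord hV hv (by norm_num) fun i => by
    rw [hVi]; exact hvn i
  have hnA : ‖A - D‖ ≤ 1 / 2 := norm_sub_le_of_coord hA hD (by norm_num) fun i => by
    rw [hAi, hDi]; exact hac i
  have hAD : UEqv A D := .of_norm_sub_le hA hD hnA (by norm_num)
  have hUV : UEqv U V := .cancel hU hV hD
    ((hUD.trans (hAD.fromBlocks_left hV)).trans (.fromBlocks_swap hD hV))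
  exact ((UEqv.of_norm_sub_le hU hu hnU (by norm_num)).symm.trans hUV).trans
    (.of_norm_sub_le hV hv hnV (by norm_num))

lemma K1Cycle.ueqv_of_coord (hB : ∀ i, StableLike (B i)) {x y : {z : K1Rep (lp B ∞) // K1Good z}}
    (H : ∀ i, UEqv (K1Cycle.map (lpProj B i) x).1.u (K1Cycle.map (lpProj B i) y).1.u) :
    UEqv x.1.u y.1.u := by
  obtain ⟨u, hu, hxu⟩ := (StableLike.lp hB).exists_ueqv x.2.mem_uSet
  obtain ⟨v, hv, hyv⟩ := (StableLike.lp hB).exists_ueqv y.2.mem_uSet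
  refine (hxu.trans (UEqv.of_coord hB hu hv fun i => ?_)).trans hyv.symm
  exact ((hxu.map (lpProj B i)).symm.trans (H i)).trans (hyv.map (lpProj B i))

lemma K1Cycle.exists_coord (hB : ∀ i, StableLike (B i)) (y : ∀ i, {z : K1Rep (B i) // K1Good z}) :
    ∃ x : {z : K1Rep (lp B ∞) // K1Good z}, ∀ i,
      UEqv (K1Cycle.map (lpProj B i) x).1.u (y i).1.u := by
  choose u hu h using fun i => (hB i).exists_ueqv (y i).2.mem_uSet
  obtain ⟨U, hU, hUi⟩ := exists_coord_mem_uSet hu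
  refine ⟨⟨⟨1, U⟩, mem_uSet_iff_unitary.1 hU⟩, fun i => ?_⟩
  have : UEqv (coord i U) (y i).1.u := by rw [hUi]; exact (h i).symm
  exact this

theorem K1.map_lpProj_bijective (hB : ∀ i, StableLike (B i)) :
    Function.Bijective fun (X : K1 (lp B ∞)) (i : I) => K1.map (lpProj B i) X := by
  constructor
  · intro X Y
    induction X using Quot.ind with
    | _ x =>
    induction Y using Quot.ind with
    | _ y =>
    intro h
    exact K1.mk_eq_iff.2 (K1Cycle.ueqv_of_coord hB fun i => K1.mk_eq_iff.1 (congrFun h i))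
  · intro Y
    choose y hy using fun i => Quot.exists_rep (Y i)
    obtain ⟨x, hx⟩ := K1Cycle.exists_coord hB y
    exact ⟨Quot.mk _ x, funext fun i => (K1.mk_eq_iff.2 (hx i)).trans (hy i)⟩

theorem K1.exists_equiv_pi (hB : ∀ i, StableLike (B i)) :
    ∃ e : K1 (lp B ∞) ≃ (∀ i, K1 (B i)),
      (∀ (x : {z : K1Rep (lp B ∞) // K1Good z})
         (y : ∀ i, {z : K1Rep (B i) // K1Good z}),
        (∀ i, (y i).1 = K1RepMap (lpProj B i) x.1) →
        e (Quot.mk _ x) = fun i => Quot.mk _ (y i)) ∧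
      ∀ (x x' z : {w : K1Rep (lp B ∞) // K1Good w})
        (y y' w : ∀ i, {v : K1Rep (B i) // K1Good v}),
        z.1 = K1RepAdd x.1 x'.1 →
        (∀ i, (w i).1 = K1RepAdd (y i).1 (y' i).1) →
        e (Quot.mk _ x) = (fun i => Quot.mk _ (y i)) →
        e (Quot.mk _ x') = (fun i => Quot.mk _ (y' i)) →
        e (Quot.mk _ z) = fun i => Quot.mk _ (w i) := by
  refine ⟨Equiv.ofBijective _ (K1.map_lpProj_bijective hB), fun x y h => ?_,
    fun x x' z y y' w hz hw hx hx' => ?_⟩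
  · exact funext fun i => congrArg (Quot.mk _) (Subtype.ext (h i).symm)
  · refine funext fun i => K1.mk_eq_iff.2 ?_
    have h1 := K1.mk_eq_iff.1 (congrFun hx i)
    have h2 := K1.mk_eq_iff.1 (congrFun hx' i)
    have hz' : (K1Cycle.map (lpProj B i) z).1 = K1RepAdd (K1Cycle.map (lpProj B i) x).1
        (K1Cycle.map (lpProj B i) x').1 :=
      (congrArg (K1RepMap (lpProj B i)) hz).trans (K1RepMap_add _ _ _)
    exact ((UEqv.of_eq_K1RepAdd hz').symm.trans (h1.fromBlocks h2)).trans
      (UEqv.of_eq_K1RepAdd (hw i))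

end KOneProduct

/-- Let `(A i)` be a family of unital C*-algebras, `H` a
separable infinite-dimensional Hilbert space, and `(B i)` realizations of the
stabilizations `A i ⊗ K(H)`.  Then the map
`Θ : K_*(∏_i (A i ⊗ K(H))) → ∏_i K_*(A i ⊗ K(H))` induced on the `i`-th
factor by the canonical coordinate projection of the C*-product
`∏_i (A i ⊗ K(H)) = lp B ∞` is an isomorphism of abelian groups in degrees
`* = 0` and `* = 1` (a bijection compatible with the block-sum addition). -/
theorem stmt11 {I : Type*} (A : I → Type*) [∀ i, CStarAlgebra (A i)]
    (B : I → Type*) [∀ i, NonUnitalCStarAlgebra (B i)]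
    (stab : ∀ i, IsStabilization (A i) (B i)) :
    (∃ e : K0 (lp B ∞) ≃ (∀ i, K0 (B i)),
      (∀ (x : {z : K0Rep (lp B ∞) // K0Good z})
         (y : ∀ i, {z : K0Rep (B i) // K0Good z}),
        (∀ i, (y i).1 = K0RepMap (lpProj B i) x.1) →
        e (Quot.mk _ x) = fun i => Quot.mk _ (y i)) ∧
      -- additivity: the bijection intertwines the block-sum additions
      ∀ (x x' z : {w : K0Rep (lp B ∞) // K0Good w})
        (y y' w : ∀ i, {v : K0Rep (B i) // K0Good v}),
        z.1 = K0RepAdd x.1 x'.1 →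
        (∀ i, (w i).1 = K0RepAdd (y i).1 (y' i).1) →
        e (Quot.mk _ x) = (fun i => Quot.mk _ (y i)) →
        e (Quot.mk _ x') = (fun i => Quot.mk _ (y' i)) →
        e (Quot.mk _ z) = fun i => Quot.mk _ (w i)) ∧
    (∃ e : K1 (lp B ∞) ≃ (∀ i, K1 (B i)),
      (∀ (x : {z : K1Rep (lp B ∞) // K1Good z})
         (y : ∀ i, {z : K1Rep (B i) // K1Good z}),
        (∀ i, (y i).1 = K1RepMap (lpProj B i) x.1) →
        e (Quot.mk _ x) = fun i => Quot.mk _ (y i)) ∧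
      ∀ (x x' z : {w : K1Rep (lp B ∞) // K1Good w})
        (y y' w : ∀ i, {v : K1Rep (B i) // K1Good v}),
        z.1 = K1RepAdd x.1 x'.1 →
        (∀ i, (w i).1 = K1RepAdd (y i).1 (y' i).1) →
        e (Quot.mk _ x) = (fun i => Quot.mk _ (y i)) →
        e (Quot.mk _ x') = (fun i => Quot.mk _ (y' i)) →
        e (Quot.mk _ z) = fun i => Quot.mk _ (w i)) := by
  exact ⟨K0.exists_equiv_pi fun i => (stab i).stableLike,
    K1.exists_equiv_pi fun i => (stab i).stableLike⟩

end
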